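/- arXiv:2504.21253 — 2 statements merged into one kernel-verified Lean document; each statement's English description precedes it below -/
import Mathlib

section
/- Let n ≥ 2, 0 < λ ≤ Λ, q ∈ [0,n), and let v be a generalized solution of λ v^q χ_{{v>0}} ≤ det D²v ≤ Λ v^q χ_{{v>0}} in an open convex set Ω ⊆ ℝⁿ, with coincidence set K := {x ∈ Ω : v(x)=0}. Assume at least one of the following: (1) Ω = ℝⁿ; (2) Ω is bounded and v extends to a continuous function on Ω̄ with v > 0 at every point of ∂Ω; (3) n = 2 and q = 0. Then every point of Ω ∩ ∂K is an exposed point of K. -/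
open MeasureTheory Set Metric
open scoped RealInnerProductSpace

noncomputable section

/-- The subdifferential of a convex function `v` at `x`, relative to the domain `Ω`. -/
def subgrad {n : ℕ} (Ω : Set (EuclideanSpace ℝ (Fin n))) (v : EuclideanSpace ℝ (Fin n) → ℝ)
    (x : EuclideanSpace ℝ (Fin n)) : Set (EuclideanSpace ℝ (Fin n)) :=
  {p | ∀ y ∈ Ω, v x + ⟪p, y - x⟫ ≤ v y}

/-- The image `∂v(E) = ⋃_{x ∈ E} ∂v(x)` of a set under the subdifferential. -/
def subgradImg {n : ℕ} (Ω : Set (EuclideanSpace ℝ (Fin n))) (v : EuclideanSpace ℝ (Fin n) → ℝ)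
    (E : Set (EuclideanSpace ℝ (Fin n))) : Set (EuclideanSpace ℝ (Fin n)) :=
  ⋃ x ∈ E, subgrad Ω v x

/-- The last coordinate `x_n` of a point of `ℝⁿ`. -/
def lastCoord {n : ℕ} (x : EuclideanSpace ℝ (Fin n)) : ℝ :=
  if h : 0 < n then x ⟨n - 1, by omega⟩ else 0

/-- The first `n-1` coordinates `x'` of a point of `ℝⁿ`. -/
def fstCoords {n : ℕ} (x : EuclideanSpace ℝ (Fin n)) : EuclideanSpace ℝ (Fin (n - 1)) :=
  (EuclideanSpace.equiv (Fin (n - 1)) ℝ).symm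
    (fun i => x ⟨i, lt_of_lt_of_le i.isLt (Nat.sub_le n 1)⟩)

/-- The point `(x', t) ∈ ℝⁿ = ℝ^{n-1} × ℝ`. -/
def app (n : ℕ) (x' : EuclideanSpace ℝ (Fin (n - 1))) (t : ℝ) : EuclideanSpace ℝ (Fin n) :=
  (EuclideanSpace.equiv (Fin n) ℝ).symm
    (fun i => if h : (i : ℕ) < n - 1 then x' ⟨i, h⟩ else t)

/-- `v` is a generalized (Aleksandrov) solution of
`λ v^q χ_{v>0} ≤ det D²v ≤ Λ v^q χ_{v>0}` on the open convex set `Ω`: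
`v` is continuous, convex and nonnegative on `Ω`, and for every Borel `E ⊆ Ω` one has
`|∂v(E)| ≤ Λ ∫_{E ∩ {v>0}} v^q` and `|∂v(E ∩ {v>0})| ≥ λ ∫_{E ∩ {v>0}} v^q`. -/
def GenSol (n : ℕ) (q lam Lam : ℝ) (Ω : Set (EuclideanSpace ℝ (Fin n)))
    (v : EuclideanSpace ℝ (Fin n) → ℝ) : Prop :=
  ContinuousOn v Ω ∧ ConvexOn ℝ Ω v ∧ (∀ x ∈ Ω, 0 ≤ v x) ∧
  (∀ E : Set (EuclideanSpace ℝ (Fin n)), MeasurableSet E → E ⊆ Ω →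
    volume (subgradImg Ω v E) ≤
      ENNReal.ofReal Lam * ∫⁻ x in E ∩ {x | 0 < v x}, ENNReal.ofReal (v x ^ q)) ∧
  (∀ E : Set (EuclideanSpace ℝ (Fin n)), MeasurableSet E → E ⊆ Ω →
    ENNReal.ofReal lam * ∫⁻ x in E ∩ {x | 0 < v x}, ENNReal.ofReal (v x ^ q) ≤
      volume (subgradImg Ω v (E ∩ {x | 0 < v x})))

/-- The coincidence set `K = {x ∈ Ω : v x = 0}`. -/
def coin {n : ℕ} (Ω : Set (EuclideanSpace ℝ (Fin n))) (v : EuclideanSpace ℝ (Fin n) → ℝ) :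
    Set (EuclideanSpace ℝ (Fin n)) :=
  {x ∈ Ω | v x = 0}

/-- The polar of a set `S` with respect to the point `x₀`. -/
def polarAt {n : ℕ} (S : Set (EuclideanSpace ℝ (Fin n))) (x₀ : EuclideanSpace ℝ (Fin n)) :
    Set (EuclideanSpace ℝ (Fin n)) :=
  {p | ∀ x ∈ S, ⟪p, x - x₀⟫ ≤ 1}

open scoped Pointwise in
lemma volume_image_add_smul {n : ℕ} (c : EuclideanSpace ℝ (Fin n)) (t : ℝ)
    (S : Set (EuclideanSpace ℝ (Fin n))) :
    volume ((fun x => c + t • x) '' S) = ENNReal.ofReal (|t| ^ n) * volume S := by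
  have h : (fun x => c + t • x) '' S = c +ᵥ (t • S) := by
    ext y
    simp [Set.mem_vadd_set, Set.mem_smul_set]
  rw [h, measure_vadd, Measure.addHaar_smul, finrank_euclideanSpace_fin, abs_pow]

lemma volume_image_homothety {n : ℕ} (y x₀ : EuclideanSpace ℝ (Fin n)) (t : ℝ)
    (S : Set (EuclideanSpace ℝ (Fin n))) :
    volume ((fun x => y + t • (x - x₀)) '' S) = ENNReal.ofReal (|t| ^ n) * volume S := by
  rw [← volume_image_add_smul (y - t • x₀)]
  congr 2
  ext1 x
  rw [smul_sub]
  abel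

lemma isClosed_polarAt {n : ℕ} (S : Set (EuclideanSpace ℝ (Fin n)))
    (x₀ : EuclideanSpace ℝ (Fin n)) : IsClosed (polarAt S x₀) := by
  have : polarAt S x₀ = ⋂ x ∈ S, {p | ⟪p, x - x₀⟫ ≤ 1} := by
    ext p; simp [polarAt]
  rw [this]
  exact isClosed_biInter fun x _ => isClosed_le (by fun_prop) continuous_const

lemma isBounded_polarAt {n : ℕ} {S : Set (EuclideanSpace ℝ (Fin n))}
    {x₀ : EuclideanSpace ℝ (Fin n)} (hS : IsOpen S) (hx₀ : x₀ ∈ S) :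
    Bornology.IsBounded (polarAt S x₀) := by
  obtain ⟨r, hr, hrS⟩ := Metric.isOpen_iff.1 hS x₀ hx₀
  refine (Metric.isBounded_iff_subset_closedBall 0).2 ⟨2 / r, fun p hp => ?_⟩
  rw [mem_closedBall_zero_iff]
  by_cases hp0 : p = 0
  · rw [hp0, norm_zero]; positivity
  have hpn : 0 < ‖p‖ := norm_pos_iff.2 hp0
  have hmem : x₀ + (r / (2 * ‖p‖)) • p ∈ S := by
    apply hrS
    rw [Metric.mem_ball, dist_eq_norm, add_sub_cancel_left, norm_smul, Real.norm_eq_abs,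
      abs_of_pos (by positivity)]
    field_simp
    linarith
  have h := hp _ hmem
  rw [add_sub_cancel_left, inner_smul_right, real_inner_self_eq_norm_sq] at h
  rw [le_div_iff₀ hr]
  field_simp at h
  linarith

lemma polarAt_mem_nhds {n : ℕ} {S : Set (EuclideanSpace ℝ (Fin n))}
    (x₀ : EuclideanSpace ℝ (Fin n)) (hS : Bornology.IsBounded S) :
    polarAt S x₀ ∈ nhds (0 : EuclideanSpace ℝ (Fin n)) := by
  obtain ⟨r, hr⟩ := (Metric.isBounded_iff_subset_closedBall x₀).1 hS
  refine Filter.mem_of_superset (Metric.ball_mem_nhds 0 (by positivity : 0 < 1 / (|r| + 1))) ?_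
  intro p hp x hx
  rw [mem_ball_zero_iff] at hp
  have h1 : ‖x - x₀‖ ≤ |r| + 1 := by
    have := hr hx
    rw [Metric.mem_closedBall, dist_eq_norm] at this
    linarith [le_abs_self r]
  calc ⟪p, x - x₀⟫ ≤ ‖p‖ * ‖x - x₀‖ := real_inner_le_norm _ _
    _ ≤ 1 / (|r| + 1) * (|r| + 1) := by gcongr
    _ = 1 := by field_simp

lemma volume_polarAt_pos {n : ℕ} {S : Set (EuclideanSpace ℝ (Fin n))}
    (x₀ : EuclideanSpace ℝ (Fin n)) (hS : Bornology.IsBounded S) :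
    0 < volume (polarAt S x₀) :=
  Measure.measure_pos_of_mem_nhds _ (polarAt_mem_nhds x₀ hS)

lemma volume_polarAt_lt_top {n : ℕ} {S : Set (EuclideanSpace ℝ (Fin n))}
    {x₀ : EuclideanSpace ℝ (Fin n)} (hS : IsOpen S) (hx₀ : x₀ ∈ S) :
    volume (polarAt S x₀) < ⊤ :=
  (isBounded_polarAt hS hx₀).measure_lt_top

/-- A subgradient at a point around which a rescaled copy of `S` carries small oscillation of `v`
lies in a multiple of the polar of `S`. -/
lemma subgrad_subset_smul_polarAt {n : ℕ} {Ω S : Set (EuclideanSpace ℝ (Fin n))}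
    {v : EuclideanSpace ℝ (Fin n) → ℝ} {x x₀ : EuclideanSpace ℝ (Fin n)} {s M : ℝ}
    (hs : 0 < s) (hM : 0 < M)
    (h : ∀ z ∈ S, x + s • (z - x₀) ∈ Ω ∧ v (x + s • (z - x₀)) - v x ≤ M) :
    subgrad Ω v x ⊆ (fun p => 0 + (M / s) • p) '' polarAt S x₀ := by
  intro p hp
  refine ⟨(s / M) • p, fun z hz => ?_, ?_⟩
  · obtain ⟨h1, h2⟩ := h z hz
    have h3 := hp _ h1
    rw [add_sub_cancel_left, inner_smul_right] at h3
    rw [inner_smul_left]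
    simp only [RCLike.conj_to_real]
    rw [div_mul_eq_mul_div, div_le_one hM]
    linarith
  · simp only [zero_add, smul_smul]
    rw [div_mul_div_cancel₀ hs.ne', div_self hM.ne', one_smul]

/-- For a convex function, the superlevel set `{v ≥ v z}` fills at least half of a symmetric
neighbourhood of `z`. -/
lemma volume_superlevel_ge {n : ℕ} {Ω S : Set (EuclideanSpace ℝ (Fin n))}
    {v : EuclideanSpace ℝ (Fin n) → ℝ} {z x₀ : EuclideanSpace ℝ (Fin n)} {C τ : ℝ}
    (hC : 1 ≤ C) (hconv : ConvexOn ℝ Ω v) (hS : Convex ℝ S) (hx₀ : x₀ ∈ S)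
    (hbal : ∀ x ∈ S, x₀ - (1 / C) • (x - x₀) ∈ S)
    (hsub : ∀ x ∈ S, z + τ • (x - x₀) ∈ Ω) :
    ENNReal.ofReal (|τ / C| ^ n) * volume S ≤
      2 * volume ({y | v z ≤ v y} ∩ (fun x => z + τ • (x - x₀)) '' S) := by
  set T := {y | v z ≤ v y} ∩ (fun x => z + τ • (x - x₀)) '' S with hT
  have hCpos : 0 < C := by linarith
  have hmem : ∀ x ∈ S, x₀ + (1 / C) • (x - x₀) ∈ S := by
    intro x hx
    have := hS.add_smul_sub_mem hx₀ hx
      (t := 1 / C) ⟨by positivity, by rw [div_le_one hCpos]; exact hC⟩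
    exact this
  have hcover : (fun x => z + (τ / C) • (x - x₀)) '' S ⊆
      T ∪ (fun y => (2 : ℝ) • z + (-1 : ℝ) • y) '' T := by
    rintro _ ⟨x, hx, rfl⟩
    simp only
    set a := (τ / C) • (x - x₀) with ha
    have ha1 : z + a = z + τ • ((x₀ + (1 / C) • (x - x₀)) - x₀) := by
      rw [add_sub_cancel_left, smul_smul, ha]; congr 2; ring
    have ha2 : z - a = z + τ • ((x₀ - (1 / C) • (x - x₀)) - x₀) := by
      rw [sub_sub_cancel_left, smul_neg, smul_smul, ha, ← sub_eq_add_neg]; congr 2; ring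
    have h1 : z + a ∈ (fun x => z + τ • (x - x₀)) '' S := ⟨_, hmem x hx, ha1.symm⟩
    have h2 : z - a ∈ (fun x => z + τ • (x - x₀)) '' S := ⟨_, hbal x hx, ha2.symm⟩
    have hΩ : ∀ y ∈ (fun x => z + τ • (x - x₀)) '' S, y ∈ Ω := by
      rintro _ ⟨x, hx, rfl⟩; exact hsub x hx
    have hc := hconv.2 (hΩ _ h1) (hΩ _ h2) (by norm_num : (0:ℝ) ≤ 1/2)
      (by norm_num : (0:ℝ) ≤ 1/2) (by norm_num)
    have hz : (1/2 : ℝ) • (z + a) + (1/2 : ℝ) • (z - a) = z := by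
      module
    rw [hz, smul_eq_mul, smul_eq_mul] at hc
    rcases le_total (v z) (v (z + a)) with h | h
    · exact Or.inl ⟨h, h1⟩
    · refine Or.inr ⟨z - a, ⟨?_, h2⟩, ?_⟩
      · show v z ≤ v (z - a)
        linarith
      · simp only; module
  calc ENNReal.ofReal (|τ / C| ^ n) * volume S
      = volume ((fun x => z + (τ / C) • (x - x₀)) '' S) := (volume_image_homothety _ _ _ _).symm
    _ ≤ volume (T ∪ (fun y => (2 : ℝ) • z + (-1 : ℝ) • y) '' T) := measure_mono hcover
    _ ≤ volume T + volume ((fun y => (2 : ℝ) • z + (-1 : ℝ) • y) '' T) := measure_union_le _ _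
    _ = 2 * volume T := by
        rw [volume_image_add_smul]; simp [two_mul]

lemma isOpen_image_homothety {n : ℕ} (y x₀ : EuclideanSpace ℝ (Fin n)) {t : ℝ} (ht : t ≠ 0)
    {S : Set (EuclideanSpace ℝ (Fin n))} (hS : IsOpen S) :
    IsOpen ((fun x => y + t • (x - x₀)) '' S) := by
  have : (fun x => y + t • (x - x₀)) '' S = (fun w => x₀ + t⁻¹ • (w - y)) ⁻¹' S := by
    ext w
    constructor
    · rintro ⟨x, hx, rfl⟩
      simpa [smul_smul, ht] using hx
    · intro hw
      refine ⟨_, hw, ?_⟩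
      simp [smul_smul, ht]
  rw [this]
  exact hS.preimage (by fun_prop)

/-- If an inequality `φ(t/2)^q ≲ t^{-2n} φ(t)^n` with `q < n` holds at all scales for a function
bounded below, then `φ` is bounded below quantitatively, independently of that lower bound. -/
lemma growth_of_scale_inequality {n : ℕ} {q K ρ δ : ℝ} {φ : ℝ → ℝ} (hq0 : 0 ≤ q) (hqn : q < n)
    (hρ : 0 < ρ) (hδ : 0 < δ) (hK : 0 < K) (hφ : ∀ t, 0 < t → t ≤ ρ → δ ≤ φ t)
    (h : ∀ t, 0 < t → t ≤ ρ → K * t ^ (2 * n) * (φ (t / 2) / 2) ^ q ≤ φ t ^ n) :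
    ((2 : ℝ) ^ (-(2 * n / (n - q)) - 2)) ^ q * 2 ^ (-(n - q)) * K * ρ ^ (2 * n) ≤
      φ ρ ^ ((n : ℝ) - q) := by
  set β : ℝ := 2 * n / (n - q) with hβ
  have hnq : 0 < (n : ℝ) - q := by linarith
  have hβ0 : 0 ≤ β := by positivity
  set f : ℝ → ℝ := fun t => φ t / t ^ β with hf
  have hfpos : ∀ t, 0 < t → t ≤ ρ → δ / ρ ^ β ≤ f t := by
    intro t ht htρ
    have h1 := hφ t ht htρ
    have h2 : 0 ≤ φ t := hδ.le.trans h1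
    simp only [hf]
    gcongr
  have hbdd : BddBelow (f '' Ioc 0 ρ) := ⟨δ / ρ ^ β, by
    rintro _ ⟨t, ht, rfl⟩; exact hfpos t ht.1 ht.2⟩
  have hne : (f '' Ioc 0 ρ).Nonempty := ⟨f ρ, ρ, ⟨hρ, le_rfl⟩, rfl⟩
  set m := sInf (f '' Ioc 0 ρ) with hm
  have hm0 : 0 < m := lt_of_lt_of_le (by positivity : 0 < δ / ρ ^ β) (le_csInf hne (by
    rintro _ ⟨t, ht, rfl⟩; exact hfpos t ht.1 ht.2))
  have hmle : ∀ t, 0 < t → t ≤ ρ → m ≤ f t := fun t h1 h2 => csInf_le hbdd ⟨t, ⟨h1, h2⟩, rfl⟩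
  obtain ⟨_, ⟨t, ⟨ht0, htρ⟩, rfl⟩, htm⟩ := exists_lt_of_csInf_lt hne (by linarith : m < 2 * m)
  have hφt : 0 < φ t := lt_of_lt_of_le hδ (hφ t ht0 htρ)
  have htβ : 0 < t ^ β := by positivity
  have hφf : φ t = f t * t ^ β := by simp only [hf]; field_simp
  have hft : 0 < f t := by simp only [hf]; positivity
  have hhalf : (2 : ℝ) ^ (-β - 2) * φ t ≤ φ (t / 2) / 2 := by
    have h1 := hmle (t / 2) (by positivity) (by linarith)
    have h2 : f t / 2 ≤ f (t / 2) := by linarith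
    have h3 : f t / 2 * (t / 2) ^ β ≤ φ (t / 2) := by
      have : φ (t / 2) = f (t / 2) * (t / 2) ^ β := by
        simp only [hf]
        have : 0 < (t / 2) ^ β := by positivity
        field_simp
      rw [this]; gcongr
    rw [Real.rpow_sub (by norm_num), Real.rpow_neg (by norm_num), hφf]
    rw [Real.div_rpow ht0.le (by norm_num)] at h3
    have h2β : (0 : ℝ) < 2 ^ β := by positivity
    have e : (2 : ℝ) ^ (2 : ℝ) = 4 := by norm_num
    rw [e]
    calc ((2 : ℝ) ^ β)⁻¹ / 4 * (f t * t ^ β) = f t / 2 * (t ^ β / 2 ^ β) / 2 := by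
          field_simp; norm_num
      _ ≤ φ (t / 2) / 2 := by linarith
  have h1 := h t ht0 htρ
  have h2 : K * t ^ (2 * n) * ((2 : ℝ) ^ (-β - 2) * φ t) ^ q ≤ φ t ^ n :=
    le_trans (by gcongr) h1
  rw [Real.mul_rpow (by positivity) hφt.le, ← Real.rpow_natCast (φ t) n] at h2
  have h3 : K * t ^ (2 * n) * ((2 : ℝ) ^ (-β - 2)) ^ q ≤ φ t ^ ((n : ℝ) - q) := by
    rw [Real.rpow_sub hφt, le_div_iff₀ (by positivity)]
    linarith
  have hpow : ∀ s : ℝ, 0 < s → (s ^ β) ^ ((n : ℝ) - q) = s ^ (2 * n) := by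
    intro s hs
    rw [← Real.rpow_mul hs.le, hβ, div_mul_cancel₀ _ hnq.ne']
    exact_mod_cast Real.rpow_natCast s (2 * n)
  rw [hφf, Real.mul_rpow hft.le htβ.le, hpow t ht0] at h3
  have ht2 : 0 < t ^ (2 * n) := by positivity
  have h4 : K * ((2 : ℝ) ^ (-β - 2)) ^ q ≤ f t ^ ((n : ℝ) - q) := by
    refine le_of_mul_le_mul_right ?_ ht2
    linarith
  have hfρ : f t / 2 ≤ f ρ := by
    have := hmle ρ hρ le_rfl
    linarith
  have h5 : (f t / 2) ^ ((n : ℝ) - q) ≤ f ρ ^ ((n : ℝ) - q) := by gcongr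
  have h6 : φ ρ = f ρ * ρ ^ β := by simp only [hf]; field_simp
  rw [h6, Real.mul_rpow (le_trans (by positivity) hfρ) (by positivity), hpow ρ hρ]
  rw [Real.div_rpow hft.le (by norm_num)] at h5
  have h2nq : (0 : ℝ) < 2 ^ ((n : ℝ) - q) := by positivity
  rw [Real.rpow_neg (by norm_num)]
  gcongr ?_ * _
  refine le_trans ?_ h5
  rw [le_div_iff₀ h2nq]
  calc ((2 : ℝ) ^ (-β - 2)) ^ q * (2 ^ ((n : ℝ) - q))⁻¹ * K * 2 ^ ((n : ℝ) - q)
      = K * ((2 : ℝ) ^ (-β - 2)) ^ q := by field_simp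
    _ ≤ _ := h4

/-- One step of the comparison between the size of `v` on a rescaled copy of `S` and the size of
its subgradients there. -/
lemma GenSol.local_inequality {n : ℕ} {q lam Lam : ℝ} {Ω S : Set (EuclideanSpace ℝ (Fin n))}
    {v : EuclideanSpace ℝ (Fin n) → ℝ} (hv : GenSol n q lam Lam Ω v) (hq0 : 0 ≤ q)
    (hlam : 0 < lam) {x₀ z : EuclideanSpace ℝ (Fin n)} {C τ s M : ℝ}
    (hC : 1 ≤ C) (hSo : IsOpen S) (hS : Convex ℝ S) (hSb : Bornology.IsBounded S) (hx₀ : x₀ ∈ S)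
    (hbal : ∀ x ∈ S, x₀ - (1 / C) • (x - x₀) ∈ S)
    (hτ : 0 < τ) (hs : 0 < s) (hM : 0 < M)
    (hsub : ∀ x ∈ S, z + τ • (x - x₀) ∈ Ω ∧ 0 < v (z + τ • (x - x₀)))
    (hbd : ∀ x ∈ S, ∀ w ∈ S, z + τ • (x - x₀) + s • (w - x₀) ∈ Ω ∧
      v (z + τ • (x - x₀) + s • (w - x₀)) ≤ M) :
    lam * (v z) ^ q * ((τ / C) ^ n * volume.real S) ≤
      2 * ((M / s) ^ n * volume.real (polarAt S x₀)) := by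
  obtain ⟨hcont, hconv, hnn, -, hlow⟩ := hv
  have hCpos : 0 < C := by linarith
  set D := (fun x => z + τ • (x - x₀)) '' S with hD
  have hDo : IsOpen D := isOpen_image_homothety _ _ hτ.ne' hSo
  have hDΩ : D ⊆ Ω := by rintro _ ⟨x, hx, rfl⟩; exact (hsub x hx).1
  have hDpos : ∀ y ∈ D, 0 < v y := by rintro _ ⟨x, hx, rfl⟩; exact (hsub x hx).2
  have hzD : z ∈ D := ⟨x₀, hx₀, by simp⟩
  have hvz : 0 < v z := hDpos z hzD
  have hDv : D ∩ {x | 0 < v x} = D := inter_eq_left.2 hDpos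
  have h1 := hlow D hDo.measurableSet hDΩ
  rw [hDv] at h1
  set T := {y | v z ≤ v y} ∩ D with hT
  have hTm : MeasurableSet T := by
    have : T = D \ (D ∩ v ⁻¹' Iio (v z)) := by
      ext y; simp only [hT, mem_inter_iff, mem_ofPred_eq, mem_sdiff, mem_preimage, mem_Iio]
      constructor
      · rintro ⟨a, b⟩; exact ⟨b, fun hh => not_lt.2 a hh.2⟩
      · rintro ⟨a, b⟩; exact ⟨not_lt.1 fun hh => b ⟨a, hh⟩, a⟩
    rw [this]
    exact hDo.measurableSet.diff
      ((hcont.mono hDΩ).isOpen_inter_preimage hDo isOpen_Iio).measurableSet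
  have h2 : ENNReal.ofReal (v z ^ q) * volume T ≤ ∫⁻ x in D, ENNReal.ofReal (v x ^ q) := by
    calc ENNReal.ofReal (v z ^ q) * volume T = ∫⁻ _ in T, ENNReal.ofReal (v z ^ q) := by
          rw [setLIntegral_const]
      _ ≤ ∫⁻ x in T, ENNReal.ofReal (v x ^ q) := by
          refine setLIntegral_mono' hTm fun x hx => ENNReal.ofReal_le_ofReal ?_
          exact Real.rpow_le_rpow hvz.le hx.1 hq0
      _ ≤ _ := lintegral_mono_set inter_subset_right
  have h3 := volume_superlevel_ge (v := v) (z := z) (τ := τ) hC hconv hS hx₀ hbal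
    (fun x hx => (hsub x hx).1)
  have h4 : volume (subgradImg Ω v D) ≤
      ENNReal.ofReal ((M / s) ^ n) * volume (polarAt S x₀) := by
    have : subgradImg Ω v D ⊆ (fun p => 0 + (M / s) • p) '' polarAt S x₀ := by
      refine iUnion₂_subset ?_
      rintro _ ⟨x, hx, rfl⟩
      refine subgrad_subset_smul_polarAt hs hM fun w hw => ⟨(hbd x hx w hw).1, ?_⟩
      have := (hbd x hx w hw).2
      have h0 := (hsub x hx).2
      simp only
      linarith
    refine (measure_mono this).trans_eq ?_
    rw [volume_image_add_smul, abs_of_pos (by positivity)]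
  have hSt : volume S ≠ ⊤ := hSb.measure_lt_top.ne
  have hPt : volume (polarAt S x₀) ≠ ⊤ := (volume_polarAt_lt_top hSo hx₀).ne
  rw [abs_of_pos (by positivity)] at h3
  have h5 : ENNReal.ofReal lam * ENNReal.ofReal (v z ^ q) *
      (ENNReal.ofReal ((τ / C) ^ n) * volume S) ≤
      2 * (ENNReal.ofReal ((M / s) ^ n) * volume (polarAt S x₀)) := by
    calc _ ≤ ENNReal.ofReal lam * ENNReal.ofReal (v z ^ q) * (2 * volume T) := by gcongr
      _ = 2 * (ENNReal.ofReal lam * (ENNReal.ofReal (v z ^ q) * volume T)) := by ring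
      _ ≤ 2 * (ENNReal.ofReal lam * ∫⁻ x in D, ENNReal.ofReal (v x ^ q)) := by gcongr
      _ ≤ 2 * volume (subgradImg Ω v D) := by gcongr
      _ ≤ _ := by gcongr
  have h6 := ENNReal.toReal_mono (by finiteness) h5
  simpa [ENNReal.toReal_mul, ENNReal.toReal_ofReal, hlam.le, Real.rpow_nonneg hvz.le,
    Measure.real, hτ.le, hs.le, hM.le, hCpos.le, div_nonneg] using h6

lemma Convex.add_two_smul_sub_mem {E : Type*} [AddCommGroup E] [Module ℝ E] {S : Set E}
    (hS : Convex ℝ S) {x₀ x y : E} (hx₀ : x₀ ∈ S) (hx : x ∈ S) (hy : y ∈ S) {a b : ℝ} (ha : 0 ≤ a)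
    (hb : 0 ≤ b) (hab : a + b ≤ 1) : x₀ + a • (x - x₀) + b • (y - x₀) ∈ S := by
  have h := hS.sum_mem (t := Finset.univ) (w := ![a, b, 1 - a - b]) (z := ![x, y, x₀]) ?_ ?_ ?_
  · simp only [Fin.sum_univ_three, Matrix.cons_val_zero, Matrix.cons_val_one,
      Matrix.cons_val] at h
    convert h using 1
    module
  · intro i _
    fin_cases i
    · exact ha
    · exact hb
    · simp; linarith
  · simp [Fin.sum_univ_three]
  · intro i _
    fin_cases i <;> simpa

/-- Nondegeneracy: on a balanced convex set `S` about a boundary point `x₀` of the coincidence set,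
`v` cannot be too small compared with the volumes of `S` and of its polar. -/
lemma GenSol.exists_nondegeneracy {n : ℕ} {q lam C : ℝ} (hq0 : 0 ≤ q) (hqn : q < n)
    (hlam : 0 < lam) (hC : 1 ≤ C) :
    ∃ c > 0, ∀ {Lam : ℝ} {Ω S : Set (EuclideanSpace ℝ (Fin n))}
      {v : EuclideanSpace ℝ (Fin n) → ℝ} {x₀ ν : EuclideanSpace ℝ (Fin n)} {B : ℝ},
      GenSol n q lam Lam Ω v → IsOpen S → Convex ℝ S → Bornology.IsBounded S → x₀ ∈ S → S ⊆ Ω →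
      (∀ x ∈ S, x₀ - (1 / C) • (x - x₀) ∈ S) → (∀ x ∈ S, v x ≤ B) → ν ≠ 0 →
      (∀ x ∈ Ω, 0 < ⟪ν, x - x₀⟫ → 0 < v x) →
      c * volume.real S ≤ B ^ ((n : ℝ) - q) * volume.real (polarAt S x₀) := by
  have hCpos : 0 < C := by linarith
  set ρ : ℝ := 1 / (16 * C) with hρ
  have hρ0 : 0 < ρ := by positivity
  have hρ1 : ρ ≤ 1 / 16 := by
    rw [hρ]; apply one_div_le_one_div_of_le <;> linarith
  set c₀ : ℝ := ((2 : ℝ) ^ (-(2 * n / (n - q)) - 2)) ^ q * 2 ^ (-(n - q)) with hc₀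
  have hc₀pos : 0 < c₀ := by positivity
  refine ⟨c₀ * (lam / (2 * (4 * C) ^ n * 4 ^ n)) * ρ ^ (2 * n), by positivity, ?_⟩
  intro Lam Ω S v x₀ ν B hv hSo hS hSb hx₀ hSΩ hbal hB hν hpos
  have hSv : 0 < volume.real S :=
    ENNReal.toReal_pos (hSo.measure_pos _ ⟨x₀, hx₀⟩).ne' hSb.measure_lt_top.ne
  have hPv : 0 < volume.real (polarAt S x₀) :=
    ENNReal.toReal_pos (volume_polarAt_pos x₀ hSb).ne' (volume_polarAt_lt_top hSo hx₀).ne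
  -- a point of `S` almost maximizing the linear functional
  obtain ⟨a, haS, ha0, ha⟩ : ∃ a ∈ S, 0 < ⟪ν, a - x₀⟫ ∧
      ∀ x ∈ S, ⟪ν, x - x₀⟫ ≤ 2 * ⟪ν, a - x₀⟫ := by
    set G := (fun x => ⟪ν, x - x₀⟫) '' S with hG
    have hGb : BddAbove G := by
      obtain ⟨r, hr⟩ := (Metric.isBounded_iff_subset_closedBall x₀).1 hSb
      refine ⟨‖ν‖ * r, ?_⟩
      rintro _ ⟨x, hx, rfl⟩
      refine (real_inner_le_norm _ _).trans ?_
      have := hr hx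
      rw [Metric.mem_closedBall, dist_eq_norm] at this
      gcongr
    have hGpos : 0 < sSup G := by
      obtain ⟨r, hr, hrS⟩ := Metric.isOpen_iff.1 hSo x₀ hx₀
      have hνn : 0 < ‖ν‖ := norm_pos_iff.2 hν
      have hmem : x₀ + (r / (2 * ‖ν‖)) • ν ∈ S := by
        apply hrS
        rw [Metric.mem_ball, dist_eq_norm, add_sub_cancel_left, norm_smul, Real.norm_eq_abs,
          abs_of_pos (by positivity)]
        field_simp
        linarith
      refine lt_of_lt_of_le ?_ (le_csSup hGb ⟨_, hmem, rfl⟩)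
      simp only [add_sub_cancel_left, inner_smul_right, real_inner_self_eq_norm_sq]
      positivity
    obtain ⟨_, ⟨a, haS, rfl⟩, ha⟩ :=
      exists_lt_of_lt_csSup (⟨_, x₀, hx₀, rfl⟩ : G.Nonempty) (by linarith : sSup G / 2 < sSup G)
    simp only at ha
    refine ⟨a, haS, by linarith, fun x hx => ?_⟩
    have := le_csSup hGb ⟨x, hx, rfl⟩
    simp only at this
    linarith
  set g := ⟪ν, a - x₀⟫ with hg
  have hlower : ∀ x ∈ S, -(2 * C * g) ≤ ⟪ν, x - x₀⟫ := by
    intro x hx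
    have h1 := ha _ (hbal x hx)
    rw [sub_sub_cancel_left, inner_neg_right, inner_smul_right] at h1
    have h2 : -(⟪ν, x - x₀⟫) = C * -(1 / C * ⟪ν, x - x₀⟫) := by field_simp
    nlinarith
  set y := x₀ + (1 / 4 : ℝ) • (a - x₀) with hy
  have hin : ∀ t, 0 ≤ t → t ≤ ρ → ∀ x ∈ S, y + t • (x - x₀) ∈ S := by
    intro t ht htρ x hx
    exact hS.add_two_smul_sub_mem hx₀ haS hx (by norm_num) ht (by linarith)
  have hvpos : ∀ t, 0 ≤ t → t ≤ ρ → ∀ x ∈ S, 0 < v (y + t • (x - x₀)) := by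
    intro t ht htρ x hx
    refine hpos _ (hSΩ (hin t ht htρ x hx)) ?_
    have e : y + t • (x - x₀) - x₀ = (1 / 4 : ℝ) • (a - x₀) + t • (x - x₀) := by
      rw [hy]; abel
    rw [e, inner_add_right, inner_smul_right, inner_smul_right, ← hg]
    have h1 := hlower x hx
    have h2 : t * (2 * C * g) ≤ ρ * (2 * C * g) := by gcongr
    have h3 : ρ * (2 * C * g) = g / 8 := by rw [hρ]; field_simp; norm_num
    nlinarith
  set φ : ℝ → ℝ := fun t => sSup (v '' ((fun x => y + t • (x - x₀)) '' S)) with hφ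
  have hbdd : ∀ t, 0 ≤ t → t ≤ ρ → BddAbove (v '' ((fun x => y + t • (x - x₀)) '' S)) := by
    intro t ht htρ
    refine ⟨B, ?_⟩
    rintro _ ⟨_, ⟨x, hx, rfl⟩, rfl⟩
    exact hB _ (hin t ht htρ x hx)
  have hle : ∀ t, 0 ≤ t → t ≤ ρ → ∀ x ∈ S, v (y + t • (x - x₀)) ≤ φ t := fun t ht htρ x hx =>
    le_csSup (hbdd t ht htρ) ⟨_, ⟨x, hx, rfl⟩, rfl⟩
  have hvy : 0 < v y := by
    have := hvpos 0 le_rfl hρ0.le x₀ hx₀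
    simpa using this
  have hδ : ∀ t, 0 < t → t ≤ ρ → v y ≤ φ t := by
    intro t ht htρ
    have := hle t ht.le htρ x₀ hx₀
    simpa using this
  set K := lam / (2 * (4 * C) ^ n * 4 ^ n) * (volume.real S / volume.real (polarAt S x₀)) with hK
  have hK0 : 0 < K := by positivity
  have key := growth_of_scale_inequality (φ := φ) hq0 hqn hρ0 hvy hK0 hδ ?_
  · have hφB : φ ρ ≤ B := by
      refine csSup_le ⟨_, _, ⟨x₀, hx₀, rfl⟩, rfl⟩ ?_
      rintro _ ⟨_, ⟨x, hx, rfl⟩, rfl⟩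
      exact hB _ (hin ρ hρ0.le le_rfl x hx)
    have hφ0 : 0 ≤ φ ρ := hvy.le.trans (hδ ρ hρ0 le_rfl)
    have h1 : φ ρ ^ ((n : ℝ) - q) ≤ B ^ ((n : ℝ) - q) :=
      Real.rpow_le_rpow hφ0 hφB (by linarith)
    rw [← hc₀] at key
    have h2 := key.trans h1
    calc c₀ * (lam / (2 * (4 * C) ^ n * 4 ^ n)) * ρ ^ (2 * n) * volume.real S
        = c₀ * K * ρ ^ (2 * n) * volume.real (polarAt S x₀) := by
          rw [hK]; field_simp
      _ ≤ _ := by gcongr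
  · intro t ht htρ
    have hφt2 : 0 < φ (t / 2) := hvy.trans_le (hδ _ (by positivity) (by linarith))
    have hφt : 0 < φ t := hvy.trans_le (hδ _ ht htρ)
    obtain ⟨_, ⟨_, ⟨w, hw, rfl⟩, rfl⟩, hz⟩ :=
      exists_lt_of_lt_csSup (⟨_, _, ⟨x₀, hx₀, rfl⟩, rfl⟩ :
        (v '' ((fun x => y + (t / 2) • (x - x₀)) '' S)).Nonempty)
        (by show φ (t / 2) / 2 < φ (t / 2); linarith)
    simp only at hz
    set z := y + (t / 2) • (w - x₀) with hzdef
    have hz1 : ∀ x ∈ S, ∃ w' ∈ S, z + (t / 4) • (x - x₀) = y + t • (w' - x₀) ∧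
        ∀ u ∈ S, ∃ w' ∈ S, z + (t / 4) • (x - x₀) + (t / 4) • (u - x₀) = y + t • (w' - x₀) := by
      intro x hx
      have hx1 := hS.add_two_smul_sub_mem hx₀ hw hx (a := 1 / 2) (b := 1 / 4)
        (by norm_num) (by norm_num) (by norm_num)
      refine ⟨_, hx1, by rw [hzdef]; module, fun u hu => ?_⟩
      have hx2 := hS.add_two_smul_sub_mem hx₀ hx hu (a := 1 / 2) (b := 1 / 2)
        (by norm_num) (by norm_num) (by norm_num)
      have hx3 := hS.add_two_smul_sub_mem hx₀ hw hx2 (a := 1 / 2) (b := 1 / 2)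
        (by norm_num) (by norm_num) (by norm_num)
      exact ⟨_, hx3, by rw [hzdef]; module⟩
    have h1 := hv.local_inequality (z := z) (τ := t / 4) (s := t / 4) (M := φ t) hq0 hlam hC hSo hS
      hSb hx₀ hbal (by positivity) (by positivity) hφt
      (by
        intro x hx
        obtain ⟨w', hw', e, -⟩ := hz1 x hx
        rw [e]
        exact ⟨hSΩ (hin t ht.le htρ _ hw'), hvpos t ht.le htρ _ hw'⟩)
      (by
        intro x hx u hu
        obtain ⟨-, -, -, h⟩ := hz1 x hx
        obtain ⟨w', hw', e⟩ := h u hu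
        rw [e]
        exact ⟨hSΩ (hin t ht.le htρ _ hw'), hle t ht.le htρ _ hw'⟩)
    have h2 : (φ (t / 2) / 2) ^ q ≤ v z ^ q := by gcongr
    have h3 : lam * (φ (t / 2) / 2) ^ q * ((t / 4 / C) ^ n * volume.real S) ≤
        2 * ((φ t / (t / 4)) ^ n * volume.real (polarAt S x₀)) := le_trans (by gcongr) h1
    have e1 : (t / 4 / C) ^ n = t ^ n / (4 * C) ^ n := by rw [div_div, div_pow]
    have e2 : (φ t / (t / 4)) ^ n = φ t ^ n * 4 ^ n / t ^ n := by
      rw [← mul_pow, ← div_pow]; congr 1; field_simp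
    rw [e1, e2] at h3
    have htn : 0 < t ^ n := by positivity
    rw [hK]
    have e3 : lam / (2 * (4 * C) ^ n * 4 ^ n) * (volume.real S / volume.real (polarAt S x₀)) *
        t ^ (2 * n) * (φ (t / 2) / 2) ^ q =
        (lam * (φ (t / 2) / 2) ^ q * (t ^ n / (4 * C) ^ n * volume.real S)) *
          (t ^ n / (2 * 4 ^ n * volume.real (polarAt S x₀))) := by
      rw [two_mul n, pow_add]; field_simp
    have e4 : φ t ^ n = (2 * (φ t ^ n * 4 ^ n / t ^ n * volume.real (polarAt S x₀))) *
          (t ^ n / (2 * 4 ^ n * volume.real (polarAt S x₀))) := by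
      field_simp
    rw [e3, e4]
    gcongr

/-- The dimensional constant with which sections are balanced. -/
def balConst (n : ℕ) : ℝ := 2 ^ (n + 2) + 3

lemma one_le_balConst (n : ℕ) : 1 ≤ balConst n := by
  have : (0 : ℝ) < 2 ^ (n + 2) := by positivity
  unfold balConst
  linarith

lemma ConvexOn.sub_affine {n : ℕ} {U : Set (EuclideanSpace ℝ (Fin n))}
    {v : EuclideanSpace ℝ (Fin n) → ℝ} (hconv : ConvexOn ℝ U v) (p x₀ : EuclideanSpace ℝ (Fin n))
    (h : ℝ) : ConvexOn ℝ U (fun x => v x - (h + ⟪p, x - x₀⟫)) := by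
  refine hconv.sub ⟨hconv.1, fun x _ y _ a b _ _ hab => le_of_eq ?_⟩
  have e : a • x + b • y - x₀ = a • (x - x₀) + b • (y - x₀) := by
    have : x₀ = (a + b) • x₀ := by rw [hab, one_smul]
    nth_rewrite 1 [this]; module
  have e2 : h = a * h + b * h := by rw [← add_mul, hab, one_mul]
  simp only [e, inner_add_right, inner_smul_right, smul_eq_mul]
  linarith

lemma isOpen_section {n : ℕ} {U : Set (EuclideanSpace ℝ (Fin n))}
    {v : EuclideanSpace ℝ (Fin n) → ℝ} (hUo : IsOpen U) (hcont : ContinuousOn v U)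
    (p x₀ : EuclideanSpace ℝ (Fin n)) (h : ℝ) : IsOpen {x ∈ U | v x < h + ⟪p, x - x₀⟫} := by
  have hsec : {x ∈ U | v x < h + ⟪p, x - x₀⟫} = {x ∈ U | v x - (h + ⟪p, x - x₀⟫) < 0} := by
    ext x; simp [sub_neg]
  have : ContinuousOn (fun x => v x - (h + ⟪p, x - x₀⟫)) U :=
    hcont.sub (Continuous.continuousOn (by fun_prop))
  rw [hsec]
  exact this.isOpen_inter_preimage hUo isOpen_Iio

lemma convex_section {n : ℕ} {U : Set (EuclideanSpace ℝ (Fin n))}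
    {v : EuclideanSpace ℝ (Fin n) → ℝ} (hconv : ConvexOn ℝ U v)
    (p x₀ : EuclideanSpace ℝ (Fin n)) (h : ℝ) : Convex ℝ {x ∈ U | v x < h + ⟪p, x - x₀⟫} := by
  have hsec : {x ∈ U | v x < h + ⟪p, x - x₀⟫} = {x ∈ U | v x - (h + ⟪p, x - x₀⟫) < 0} := by
    ext x; simp [sub_neg]
  rw [hsec]
  exact (hconv.sub_affine p x₀ h).convex_lt 0

/-- A convex function `v ≥ 0` with `v x₀ = 0` on a bounded domain has, at every height `h`, a
section at `x₀` that is balanced about `x₀`, with a constant depending only on the dimension. -/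
lemma exists_balanced_section {n : ℕ} {U : Set (EuclideanSpace ℝ (Fin n))}
    {v : EuclideanSpace ℝ (Fin n) → ℝ} {x₀ : EuclideanSpace ℝ (Fin n)} {h : ℝ}
    (hUo : IsOpen U) (hUb : Bornology.IsBounded U) (hcont : ContinuousOn v U)
    (hconv : ConvexOn ℝ U v) (hnn : ∀ x ∈ U, 0 ≤ v x) (hx₀ : x₀ ∈ U) (hv0 : v x₀ = 0)
    (hh : 0 < h) :
    ∃ p : EuclideanSpace ℝ (Fin n), ∀ x ∈ U, v x < h + ⟪p, x - x₀⟫ →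
      (x₀ - (1 / balConst n) • (x - x₀) ∈ U ∧
        v (x₀ - (1 / balConst n) • (x - x₀)) <
          h + ⟪p, x₀ - (1 / balConst n) • (x - x₀) - x₀⟫) := by
  have hUm := hUo.measurableSet
  have hUt : volume U ≠ ⊤ := hUb.measure_lt_top.ne
  obtain ⟨R, hR⟩ : ∃ R, ∀ x ∈ U, ‖x - x₀‖ ≤ R := by
    obtain ⟨r, hr⟩ := (Metric.isBounded_iff_subset_closedBall x₀).1 hUb
    exact ⟨r, fun x hx => by simpa [dist_eq_norm] using hr hx⟩
  have hR0 : 0 ≤ R := by simpa using hR x₀ hx₀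
  set G : EuclideanSpace ℝ (Fin n) → EuclideanSpace ℝ (Fin n) → ℝ :=
    fun p x => max (h + ⟪p, x - x₀⟫ - v x) 0 with hG
  set F : EuclideanSpace ℝ (Fin n) → ℝ := fun p => ∫ x in U, G p x with hF
  have hGcont : ∀ p, ContinuousOn (G p) U := fun p => by
    have : ContinuousOn (fun x => h + ⟪p, x - x₀⟫ - v x) U :=
      (Continuous.continuousOn (by fun_prop)).sub hcont
    exact this.sup continuousOn_const
  have hGnn : ∀ p x, 0 ≤ G p x := fun p x => le_max_right _ _
  have hGbd : ∀ p, ∀ x ∈ U, ‖G p x‖ ≤ h + ‖p‖ * R := by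
    intro p x hx
    rw [Real.norm_eq_abs, abs_of_nonneg (hGnn p x)]
    have h1 := real_inner_le_norm p (x - x₀)
    have h2 : ‖p‖ * ‖x - x₀‖ ≤ ‖p‖ * R := by gcongr; exact hR x hx
    have h3 := hnn x hx
    exact max_le (by linarith) (by positivity)
  have hGint : ∀ p, IntegrableOn (G p) U := fun p =>
    IntegrableOn.of_bound hUt.lt_top ((hGcont p).aestronglyMeasurable hUm)
      (h + ‖p‖ * R) ((ae_restrict_iff' hUm).2 (Filter.Eventually.of_forall (hGbd p)))
  have hFcont : Continuous F := by
    refine LipschitzWith.continuous (K := (R * volume.real U).toNNReal) ?_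
    refine LipschitzWith.of_dist_le_mul fun p p' => ?_
    rw [Real.coe_toNNReal _ (by positivity), Real.dist_eq, ← Real.norm_eq_abs, hF]
    simp only
    rw [← integral_sub (hGint p) (hGint p')]
    refine (norm_setIntegral_le_of_norm_le_const (C := R * dist p p') hUt.lt_top ?_).trans_eq
      (by ring)
    intro x hx
    rw [Real.norm_eq_abs]
    refine (abs_max_sub_max_le_abs _ _ _).trans ?_
    have e : h + ⟪p, x - x₀⟫ - v x - (h + ⟪p', x - x₀⟫ - v x) = ⟪p - p', x - x₀⟫ := by
      rw [inner_sub_left]; ring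
    rw [e, dist_eq_norm]
    refine (abs_real_inner_le_norm _ _).trans ?_
    rw [mul_comm]
    gcongr
    exact hR x hx
  have hbounded : Bornology.IsBounded {p | F p ≤ F 0} := by
    obtain ⟨r, hr, hrU⟩ := Metric.nhds_basis_closedBall.mem_iff.1 (hUo.mem_nhds hx₀)
    obtain ⟨M, hM⟩ := (isCompact_closedBall x₀ r).bddAbove_image (hcont.mono hrU)
    have hM' : ∀ x ∈ closedBall x₀ r, v x ≤ M := fun x hx => hM ⟨x, hx, rfl⟩
    set V := volume.real (ball (0 : EuclideanSpace ℝ (Fin n)) (r / 4)) with hV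
    have hVpos : 0 < V := ENNReal.toReal_pos (measure_ball_pos _ _ (by positivity)).ne'
      measure_ball_lt_top.ne
    refine (Metric.isBounded_iff_subset_closedBall 0).2 ⟨|(F 0 / V + M) * 4 / r|, fun p hp => ?_⟩
    rw [mem_closedBall_zero_iff]
    by_cases hp0 : p = 0
    · rw [hp0, norm_zero]; positivity
    have hpn : 0 < ‖p‖ := norm_pos_iff.2 hp0
    refine le_trans ?_ (le_abs_self _)
    set y := x₀ + (r / (2 * ‖p‖)) • p with hy
    have hyn : ‖(r / (2 * ‖p‖)) • p‖ = r / 2 := by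
      rw [norm_smul, Real.norm_eq_abs, abs_of_pos (by positivity)]; field_simp
    have hball : ball y (r / 4) ⊆ closedBall x₀ r := by
      intro x hx
      rw [Metric.mem_ball, dist_eq_norm] at hx
      rw [Metric.mem_closedBall, dist_eq_norm]
      have e : x - x₀ = (x - y) + (r / (2 * ‖p‖)) • p := by rw [hy]; abel
      rw [e]
      refine (norm_add_le _ _).trans ?_
      rw [hyn]; linarith
    have hlow : ∀ x ∈ ball y (r / 4), ‖p‖ * r / 4 - M ≤ G p x := by
      intro x hx
      refine le_trans ?_ (le_max_left _ _)
      have h1 := hM' x (hball hx)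
      rw [Metric.mem_ball, dist_eq_norm] at hx
      have e : x - x₀ = (x - y) + (r / (2 * ‖p‖)) • p := by rw [hy]; abel
      have h2 : ⟪p, x - x₀⟫ = ⟪p, x - y⟫ + ‖p‖ * r / 2 := by
        rw [e, inner_add_right, inner_smul_right, real_inner_self_eq_norm_sq]
        field_simp
      have h3 := (abs_le.1 (abs_real_inner_le_norm p (x - y))).1
      have h4 : ‖p‖ * ‖x - y‖ ≤ ‖p‖ * (r / 4) := by gcongr
      linarith
    have h1 : (‖p‖ * r / 4 - M) * V ≤ F p := by
      have e : volume.real (ball y (r / 4)) = V := by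
        rw [hV, Measure.real, Measure.real, Measure.addHaar_ball_center]
      calc (‖p‖ * r / 4 - M) * V = ∫ _ in ball y (r / 4), (‖p‖ * r / 4 - M) := by
            rw [setIntegral_const, e, smul_eq_mul, mul_comm]
        _ ≤ ∫ x in ball y (r / 4), G p x :=
            setIntegral_mono_on (integrableOn_const measure_ball_lt_top.ne)
              ((hGint p).mono_set (hball.trans hrU)) measurableSet_ball hlow
        _ ≤ F p := setIntegral_mono_set (hGint p)
            (Filter.Eventually.of_forall (hGnn p)) (hball.trans hrU).eventuallyLE
    have h2 : (‖p‖ * r / 4 - M) * V ≤ F 0 := h1.trans hp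
    rw [← le_div_iff₀ hVpos] at h2
    rw [le_div_iff₀ hr]
    linarith
  obtain ⟨p, hp⟩ := hFcont.exists_forall_le_of_isBounded 0 hbounded
  refine ⟨p, fun a haU ha => ?_⟩
  set C : ℝ := balConst n with hC
  have hCpos : 0 < C := by linarith [one_le_balConst n]
  by_contra hcon
  set S := {x ∈ U | v x < h + ⟪p, x - x₀⟫} with hS
  have hseco : ∀ p' : EuclideanSpace ℝ (Fin n), IsOpen {x ∈ U | v x < h + ⟪p', x - x₀⟫} :=
    fun p' => isOpen_section hUo hcont p' x₀ h
  have hsecc : ∀ p' : EuclideanSpace ℝ (Fin n), Convex ℝ {x ∈ U | v x < h + ⟪p', x - x₀⟫} :=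
    fun p' => convex_section hconv p' x₀ h
  have hx₀S : x₀ ∈ S := ⟨hx₀, by simp [hv0, hh]⟩
  obtain ⟨q, hqS, hqa⟩ : ∃ q : EuclideanSpace ℝ (Fin n), (∀ x ∈ S, ⟪q, x - x₀⟫ < 1) ∧
      ⟪q, a - x₀⟫ = -C := by
    obtain ⟨f, hf⟩ := geometric_hahn_banach_open_point (hsecc p) (hseco p)
      (x := x₀ - (1 / C) • (a - x₀)) hcon
    have hf0 := hf x₀ hx₀S
    rw [map_sub, map_smul, smul_eq_mul] at hf0
    set d := -(1 / C * f (a - x₀)) with hd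
    have hd0 : 0 < d := by linarith
    refine ⟨d⁻¹ • (InnerProductSpace.toDual ℝ _).symm f, fun x hx => ?_, ?_⟩
    · rw [inner_smul_left, InnerProductSpace.toDual_symm_apply]
      have := hf x hx
      rw [map_sub, map_smul, smul_eq_mul] at this
      simp only [RCLike.conj_to_real]
      rw [inv_mul_lt_one₀ hd0, map_sub]
      linarith
    · rw [inner_smul_left, InnerProductSpace.toDual_symm_apply]
      simp only [RCLike.conj_to_real]
      have : f (a - x₀) = -C * d := by rw [hd]; field_simp
      rw [this]; field_simp
  set δ := h + ⟪p, a - x₀⟫ - v a with hδ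
  have hδ0 : 0 < δ := by linarith
  set t := min (h / 2) (δ / (2 * C)) with ht
  have ht0 : 0 < t := by positivity
  have hth : t ≤ h / 2 := min_le_left _ _
  have htC : t * C < δ := by
    have h1 : t ≤ δ / (2 * C) := min_le_right _ _
    have h2 : t * C ≤ δ / (2 * C) * C := by gcongr
    have h3 : δ / (2 * C) * C = δ / 2 := by field_simp
    linarith
  set St := {x ∈ U | v x < h + ⟪p + t • q, x - x₀⟫} with hSt
  have hinn : ∀ x, ⟪p + t • q, x - x₀⟫ = ⟪p, x - x₀⟫ + t * ⟪q, x - x₀⟫ := by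
    intro x
    rw [inner_add_left, inner_smul_left]
    simp
  have hSto : IsOpen St := hseco _
  have hStc : Convex ℝ St := hsecc _
  have hx₀St : x₀ ∈ St := ⟨hx₀, by simp [hv0, hh]⟩
  have haSt : a ∈ St := ⟨haU, by rw [hinn, hqa]; linarith⟩
  have hStU : St ⊆ U := fun x hx => hx.1
  have hq2 : ∀ x ∈ St, ⟪q, x - x₀⟫ ≤ 2 := by
    intro x hx
    by_contra! hlt
    set s := 1 / ⟪q, x - x₀⟫ with hs
    have hs0 : 0 < s := by positivity
    have hs1 : s < 1 / 2 := by
      rw [hs]; exact one_div_lt_one_div_of_lt (by norm_num) hlt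
    have hsq : s * ⟪q, x - x₀⟫ = 1 := by rw [hs]; field_simp
    have hcvx := hconv.2 hx₀ hx.1 (by linarith : 0 ≤ 1 - s) hs0.le (by ring)
    have e : (1 - s) • x₀ + s • x = x₀ + s • (x - x₀) := by module
    rw [e, hv0, smul_zero, zero_add, smul_eq_mul] at hcvx
    have hxU : x₀ + s • (x - x₀) ∈ U :=
      hconv.1.add_smul_sub_mem hx₀ hx.1 ⟨hs0.le, by linarith⟩
    have hx2 := hx.2
    rw [hinn] at hx2
    have hmem : x₀ + s • (x - x₀) ∈ S := by
      refine ⟨hxU, ?_⟩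
      rw [add_sub_cancel_left, inner_smul_right]
      have h1 : s * v x < s * (h + (⟪p, x - x₀⟫ + t * ⟪q, x - x₀⟫)) := by gcongr
      have h2 : s * (h + (⟪p, x - x₀⟫ + t * ⟪q, x - x₀⟫)) = s * h + s * ⟪p, x - x₀⟫ + t := by
        linear_combination t * hsq
      have h3 : s * h < 1 / 2 * h := by gcongr
      linarith
    have := hqS _ hmem
    rw [add_sub_cancel_left, inner_smul_right] at this
    linarith
  have hlinint : IntegrableOn (fun x => ⟪q, x - x₀⟫) U := by
    refine IntegrableOn.of_bound hUt.lt_top (Continuous.aestronglyMeasurable (by fun_prop))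
      (‖q‖ * R) ((ae_restrict_iff' hUm).2 (Filter.Eventually.of_forall fun x hx => ?_))
    refine (norm_inner_le_norm _ _).trans ?_
    gcongr
    exact hR x hx
  have hStm := hSto.measurableSet
  have hpos : 0 ≤ ∫ x in St, ⟪q, x - x₀⟫ := by
    have h1 : 0 ≤ ∫ x in U, (G (p + t • q) x - G p x) := by
      rw [integral_sub (hGint _) (hGint _)]
      have := hp (p + t • q)
      simp only [hF] at this
      linarith
    have h2 : ∫ x in U, (G (p + t • q) x - G p x) ≤
        ∫ x in U, St.indicator (fun x => t * ⟪q, x - x₀⟫) x := by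
      refine setIntegral_mono_on ((hGint _).sub (hGint _))
        ((hlinint.const_mul t).indicator hStm) hUm fun x hx => ?_
      by_cases hxS : x ∈ St
      · rw [indicator_of_mem hxS]
        have h3 := hxS.2
        have h4 : G (p + t • q) x = h + ⟪p + t • q, x - x₀⟫ - v x :=
          max_eq_left (by linarith)
        have h5 : h + ⟪p, x - x₀⟫ - v x ≤ G p x := le_max_left _ _
        rw [h4, hinn]; linarith
      · rw [indicator_of_notMem hxS]
        have h3 : h + ⟪p + t • q, x - x₀⟫ ≤ v x := not_lt.1 fun hlt => hxS ⟨hx, hlt⟩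
        have h4 : G (p + t • q) x = 0 := max_eq_right (by linarith)
        rw [h4]
        linarith [hGnn p x]
    rw [setIntegral_indicator hStm, inter_eq_self_of_subset_right hStU, integral_const_mul] at h2
    have h3 := h1.trans h2
    exact nonneg_of_mul_nonneg_right h3 ht0
  -- the part of the section near `a` makes the integral negative
  set W := (fun x => a + (1 / 2 : ℝ) • (x - a)) '' St with hW
  have hWS : W ⊆ St := by
    rintro _ ⟨x, hx, rfl⟩
    exact hStc.add_smul_sub_mem haSt hx ⟨by norm_num, by norm_num⟩
  have hWm : MeasurableSet W := (isOpen_image_homothety _ _ (by norm_num) hSto).measurableSet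
  have hWv : volume.real W = (1 / 2) ^ n * volume.real St := by
    rw [Measure.real, hW, volume_image_homothety, ENNReal.toReal_mul, Measure.real,
      ENNReal.toReal_ofReal (by positivity), abs_of_pos (by norm_num)]
  have hStt : volume St ≠ ⊤ := ((measure_mono hStU).trans_lt hUt.lt_top).ne
  have hWt : volume W ≠ ⊤ := ((measure_mono hWS).trans_lt hStt.lt_top).ne
  have hVpos : 0 < volume.real St :=
    ENNReal.toReal_pos (hSto.measure_pos _ ⟨x₀, hx₀St⟩).ne' hStt
  have hI1 : ∫ x in W, ⟪q, x - x₀⟫ ≤ (2 - C) / 2 * volume.real W := by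
    calc ∫ x in W, ⟪q, x - x₀⟫ ≤ ∫ _ in W, (2 - C) / 2 := by
          refine setIntegral_mono_on (hlinint.mono_set (hWS.trans hStU))
            (integrableOn_const hWt) hWm ?_
          rintro _ ⟨x, hx, rfl⟩
          have e : a + (1 / 2 : ℝ) • (x - a) - x₀ =
              (1 / 2 : ℝ) • (a - x₀) + (1 / 2 : ℝ) • (x - x₀) := by module
          simp only
          rw [e, inner_add_right, inner_smul_right, inner_smul_right, hqa]
          linarith [hq2 x hx]
      _ = _ := by rw [setIntegral_const, smul_eq_mul, mul_comm]
  have hI2 : ∫ x in St \ W, ⟪q, x - x₀⟫ ≤ 2 * volume.real St := by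
    calc ∫ x in St \ W, ⟪q, x - x₀⟫ ≤ ∫ _ in St \ W, (2 : ℝ) :=
          setIntegral_mono_on (hlinint.mono_set (sdiff_subset.trans hStU))
            (integrableOn_const ((measure_mono sdiff_subset).trans_lt hStt.lt_top).ne)
            (hStm.diff hWm) fun x hx => hq2 x hx.1
      _ = 2 * volume.real (St \ W) := by rw [setIntegral_const, smul_eq_mul, mul_comm]
      _ ≤ _ := by gcongr; exact sdiff_subset
  have hsplit : ∫ x in St, ⟪q, x - x₀⟫ =
      (∫ x in St \ W, ⟪q, x - x₀⟫) + ∫ x in W, ⟪q, x - x₀⟫ := by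
    have := setIntegral_sdiff hWm (hlinint.mono_set hStU) hWS
    linarith
  rw [hWv] at hI1
  have h2n : (2 - C) / 2 * ((1 / 2) ^ n * volume.real St) =
      -(2 + (1 / 2) * (1 / 2) ^ n) * volume.real St := by
    have e : (1 / 2 : ℝ) ^ n * 2 ^ n = 1 := by rw [← mul_pow]; norm_num
    rw [hC, balConst, pow_add]
    linear_combination (-2 * volume.real St) * e
  have h3 : 0 < (1 / 2 : ℝ) * (1 / 2) ^ n * volume.real St := by positivity
  rw [h2n] at hI1
  nlinarith

/-- Aleksandrov's estimate for a compactly contained section. -/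
lemma GenSol.volume_polarAt_le {n : ℕ} {q lam Lam : ℝ} {Ω U Q : Set (EuclideanSpace ℝ (Fin n))}
    {v : EuclideanSpace ℝ (Fin n) → ℝ} (hv : GenSol n q lam Lam Ω v) (hq0 : 0 ≤ q)
    (hLam : 0 ≤ Lam) (hUo : IsOpen U) (hUΩ : U ⊆ Ω)
    (hQ : IsCompact Q) (hQU : Q ⊆ U) {p x₀ y : EuclideanSpace ℝ (Fin n)} {h B : ℝ} (hh : 0 < h)
    (hSQ : {x ∈ U | v x < h + ⟪p, x - x₀⟫} ⊆ Q)
    (hB : ∀ x ∈ {x ∈ U | v x < h + ⟪p, x - x₀⟫}, v x ≤ B)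
    (hy : y ∈ U) (hvy : v y = 0) (hpy : 0 ≤ ⟪p, y - x₀⟫) :
    h ^ n * volume.real (polarAt {x ∈ U | v x < h + ⟪p, x - x₀⟫} y) ≤
      Lam * B ^ q * volume.real {x ∈ U | v x < h + ⟪p, x - x₀⟫} := by
  obtain ⟨hcont, hconv, hnn, hup, -⟩ := hv
  have hcontU := hcont.mono hUΩ
  have hSo := isOpen_section hUo hcontU p x₀ h
  set S := {x ∈ U | v x < h + ⟪p, x - x₀⟫} with hS
  have hyS : y ∈ S := ⟨hy, by rw [hvy]; linarith⟩
  have hSU : S ⊆ U := fun x hx => hx.1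
  have hSΩ : S ⊆ Ω := hSU.trans hUΩ
  have hB0 : 0 ≤ B := (hvy ▸ hB y hyS :)
  have hcl : closure S ⊆ Q := closure_minimal hSQ hQ.isClosed
  have hclc : IsCompact (closure S) := hQ.of_isClosed_subset isClosed_closure hcl
  have hSt : volume S ≠ ⊤ := ((measure_mono hSQ).trans_lt hQ.measure_lt_top).ne
  have himg : (fun p' => p + h • p') '' polarAt S y ⊆ subgradImg Ω v S := by
    rintro _ ⟨p', hp', rfl⟩
    set f : EuclideanSpace ℝ (Fin n) → ℝ := fun z => v z - (0 + ⟪p + h • p', z - y⟫) with hf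
    have hfc : ConvexOn ℝ Ω f := hconv.sub_affine _ _ _
    have hfcont : ContinuousOn f (closure S) :=
      (hcontU.mono (hcl.trans hQU)).sub (Continuous.continuousOn (by fun_prop))
    obtain ⟨z, hzS, hz⟩ : ∃ z ∈ S, IsMinOn f (closure S) z := by
      obtain ⟨z, hz, hzmin⟩ := hclc.exists_isMinOn ⟨y, subset_closure hyS⟩ hfcont
      by_cases hzS : z ∈ S
      · exact ⟨z, hzS, hzmin⟩
      refine ⟨y, hyS, fun w hw => (?_ : f y ≤ f z).trans (hzmin hw)⟩
      have h1 : h + ⟪p, z - x₀⟫ ≤ v z := not_lt.1 fun hlt => hzS ⟨hQU (hcl hz), hlt⟩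
      have h2 : ⟪p', z - y⟫ ≤ 1 := by
        have hcl' : IsClosed {w | ⟪p', w - y⟫ ≤ 1} := isClosed_le (by fun_prop) continuous_const
        exact closure_minimal (fun w hw => hp' w hw) hcl' hz
      have e : z - x₀ = (z - y) + (y - x₀) := by abel
      rw [e, inner_add_right] at h1
      have h3 : h * ⟪p', z - y⟫ ≤ h * 1 := by gcongr
      simp only [hf, hvy, sub_self, inner_zero_right, inner_add_left, inner_smul_left,
        RCLike.conj_to_real, zero_add]
      linarith
    have hloc : IsLocalMinOn f Ω z := by
      filter_upwards [mem_nhdsWithin_of_mem_nhds (hSo.mem_nhds hzS)] with w hw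
      exact hz (subset_closure hw)
    have hglob := IsMinOn.of_isLocalMinOn_of_convexOn (hSΩ hzS) hloc hfc
    refine mem_biUnion hzS fun w hw => ?_
    have h1 : f z ≤ f w := hglob hw
    have e : w - z = (w - y) - (z - y) := by abel
    rw [e, inner_sub_right]
    simp only [hf] at h1
    linarith
  have hmS : MeasurableSet S := hSo.measurableSet
  have hmS' : MeasurableSet (S ∩ {x | 0 < v x}) :=
    ((hcontU.mono hSU).isOpen_inter_preimage hSo isOpen_Ioi).measurableSet
  have h1 : ENNReal.ofReal (h ^ n) * volume (polarAt S y) ≤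
      ENNReal.ofReal (Lam * B ^ q) * volume S := by
    calc ENNReal.ofReal (h ^ n) * volume (polarAt S y)
        = volume ((fun p' => p + h • p') '' polarAt S y) := by
          rw [volume_image_add_smul, abs_of_pos hh]
      _ ≤ volume (subgradImg Ω v S) := measure_mono himg
      _ ≤ ENNReal.ofReal Lam * ∫⁻ x in S ∩ {x | 0 < v x}, ENNReal.ofReal (v x ^ q) :=
          hup S hmS hSΩ
      _ ≤ ENNReal.ofReal Lam * ∫⁻ _ in S ∩ {x | 0 < v x}, ENNReal.ofReal (B ^ q) := by
          gcongr 1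
          refine setLIntegral_mono' hmS' fun x hx => ENNReal.ofReal_le_ofReal ?_
          exact Real.rpow_le_rpow (hnn x (hSΩ hx.1)) (hB x hx.1) hq0
      _ ≤ ENNReal.ofReal Lam * (ENNReal.ofReal (B ^ q) * volume S) := by
          rw [setLIntegral_const]
          gcongr
          exact inter_subset_left
      _ = _ := by rw [ENNReal.ofReal_mul hLam, mul_assoc]
  have h2 := ENNReal.toReal_mono (ENNReal.mul_ne_top ENNReal.ofReal_ne_top hSt) h1
  rwa [ENNReal.toReal_mul, ENNReal.toReal_mul, ENNReal.toReal_ofReal (by positivity),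
    ENNReal.toReal_ofReal (by positivity)] at h2

/-- If the ray from `x₀` through `x₀ + e` leaves a balanced convex set `S ∋ x₀ + e` shortly after
`x₀ + e`, then the polar of `S` with respect to `x₀ + e` is much larger than the polar with respect
to `x₀`. -/
lemma volume_polarAt_add_ge {n : ℕ} {S : Set (EuclideanSpace ℝ (Fin n))}
    {x₀ e : EuclideanSpace ℝ (Fin n)} {C δ : ℝ} {N : ℕ} (hC : 0 < C) (hSo : IsOpen S)
    (hSc : Convex ℝ S) (hx₀ : x₀ ∈ S) (hbal : ∀ x ∈ S, x₀ - (1 / C) • (x - x₀) ∈ S)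
    (he : x₀ + e ∈ S) (hδ : 0 < δ) (hNδ : N * δ < 1 - δ) (hw : x₀ + (1 / (1 - δ)) • e ∉ S) :
    N * (1 / (2 * (C + 1))) ^ n * volume.real (polarAt S x₀) ≤
      volume.real (polarAt S (x₀ + e)) := by
  have hδ1 : 0 < 1 - δ := lt_of_le_of_lt (by positivity) hNδ
  obtain ⟨r, hrS, hre⟩ : ∃ r ∈ polarAt S x₀, ⟪r, e⟫ = 1 - δ := by
    obtain ⟨f, hf⟩ := geometric_hahn_banach_open_point hSc hSo hw
    have hf0 := hf x₀ hx₀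
    rw [map_add, map_smul, smul_eq_mul] at hf0
    set d := 1 / (1 - δ) * f e with hd
    have hd0 : 0 < d := by linarith
    refine ⟨d⁻¹ • (InnerProductSpace.toDual ℝ _).symm f, fun x hx => ?_, ?_⟩
    · rw [inner_smul_left, InnerProductSpace.toDual_symm_apply]
      have := hf x hx
      rw [map_add, map_smul, smul_eq_mul] at this
      simp only [RCLike.conj_to_real]
      rw [inv_mul_le_one₀ hd0, map_sub]
      linarith
    · rw [inner_smul_left, InnerProductSpace.toDual_symm_apply]
      simp only [RCLike.conj_to_real]
      have : f e = (1 - δ) * d := by rw [hd]; field_simp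
      rw [this]; field_simp
  have hPe1 : ∀ p ∈ polarAt S x₀, ⟪p, e⟫ ≤ 1 := fun p hp => by simpa using hp _ he
  have hPe2 : ∀ p ∈ polarAt S x₀, -C ≤ ⟪p, e⟫ := fun p hp => by
    have := hp _ (hbal _ he)
    have e1 : x₀ - (1 / C) • (x₀ + e - x₀) - x₀ = -((1 / C) • e) := by
      rw [add_sub_cancel_left]; abel
    rw [e1, inner_neg_right, inner_smul_right, neg_le, one_div, inv_mul_eq_div,
      le_div_iff₀ hC] at this
    linarith
  set κ := 1 / (2 * (C + 1)) with hκ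
  have hκ0 : 0 < κ := by positivity
  have hκC : κ * (C + 1) = 1 / 2 := by rw [hκ]; field_simp
  set T : ℕ → Set (EuclideanSpace ℝ (Fin n)) := fun j =>
    (fun p => ((j / N : ℝ) * (1 / (2 * δ))) • r + κ • p) '' polarAt S x₀ with hT
  have hcomp : IsCompact (polarAt S x₀) :=
    Metric.isCompact_of_isClosed_isBounded (isClosed_polarAt _ _) (isBounded_polarAt hSo hx₀)
  have hTsub : ∀ j ∈ Finset.range N, T j ⊆ polarAt S (x₀ + e) := by
    rintro j hj _ ⟨p, hp, rfl⟩ x hx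
    have hj' : (j : ℝ) < N := by exact_mod_cast Finset.mem_range.1 hj
    have hN : (0 : ℝ) < N := lt_of_le_of_lt (by positivity) hj'
    have e1 : x - (x₀ + e) = (x - x₀) - e := by abel
    rw [e1, inner_add_left, inner_smul_left, inner_smul_left, inner_sub_right r _ e,
      inner_sub_right p _ e, hre]
    simp only [RCLike.conj_to_real]
    have h1 := hp x hx
    have h2 := hPe2 p hp
    have h3 := hrS x hx
    have h4 : κ * (⟪p, x - x₀⟫ - ⟪p, e⟫) ≤ κ * (C + 1) := by gcongr; linarith
    have h5 : (j / N : ℝ) * (1 / (2 * δ)) * (⟪r, x - x₀⟫ - (1 - δ)) ≤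
        (j / N : ℝ) * (1 / (2 * δ)) * δ := by gcongr; linarith
    have h6 : (j / N : ℝ) * (1 / (2 * δ)) * δ = (j / N : ℝ) / 2 := by field_simp
    have h7 : (j / N : ℝ) ≤ 1 := by rw [div_le_one hN]; exact hj'.le
    linarith
  have hlt : ∀ j k : ℕ, k < j → j < N → Disjoint (T j) (T k) := by
    intro j k hkj hjN
    rw [Set.disjoint_left]
    rintro _ ⟨p, hp, rfl⟩ ⟨p', hp', heq⟩
    have h0 := congrArg (fun z => ⟪z, e⟫) heq
    simp only [inner_add_left, inner_smul_left, hre, RCLike.conj_to_real] at h0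
    have hN : (0 : ℝ) < N := by exact_mod_cast (Nat.zero_le j).trans_lt hjN
    have h1 : (k : ℝ) + 1 ≤ j := by exact_mod_cast hkj
    have h2 : κ * (⟪p', e⟫ - ⟪p, e⟫) ≤ κ * (C + 1) := by
      gcongr; linarith [hPe1 p' hp', hPe2 p hp]
    have h3 : ((j : ℝ) / N - k / N) * (1 / (2 * δ)) * (1 - δ) ≤ 1 / 2 := by linarith
    have h4 : (1 : ℝ) / N ≤ (j : ℝ) / N - k / N := by
      rw [← sub_div]; gcongr; linarith
    have h5 : (1 : ℝ) / N * (1 / (2 * δ)) * (1 - δ) ≤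
        ((j : ℝ) / N - k / N) * (1 / (2 * δ)) * (1 - δ) := by gcongr
    have h6 : (1 : ℝ) / N * (1 / (2 * δ)) * (1 - δ) = (1 - δ) / (N * δ) / 2 := by field_simp
    have h7 : 1 < (1 - δ) / (N * δ) := by rwa [one_lt_div (by positivity)]
    linarith
  have hdisj : Set.PairwiseDisjoint (↑(Finset.range N)) T := by
    intro j hj k hk hjk
    rcases lt_or_gt_of_ne hjk with h | h
    · exact (hlt k j h (Finset.mem_range.1 hk)).symm
    · exact hlt j k h (Finset.mem_range.1 hj)
  have hmeas : ∀ j ∈ Finset.range N, MeasurableSet (T j) := fun j _ =>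
    (hcomp.image (by fun_prop)).isClosed.measurableSet
  have hvolT : ∀ j, volume.real (T j) = κ ^ n * volume.real (polarAt S x₀) := fun j => by
    rw [Measure.real, hT, volume_image_add_smul, ENNReal.toReal_mul, Measure.real,
      ENNReal.toReal_ofReal (by positivity), abs_of_pos hκ0]
  calc N * κ ^ n * volume.real (polarAt S x₀) = ∑ j ∈ Finset.range N, volume.real (T j) := by
        simp_rw [hvolT]
        rw [Finset.sum_const, Finset.card_range, nsmul_eq_mul, mul_assoc]
    _ = volume.real (⋃ j ∈ Finset.range N, T j) :=
        (measureReal_biUnion_finset hdisj hmeas fun j _ =>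
          (hcomp.image (by fun_prop)).measure_lt_top.ne).symm
    _ ≤ volume.real (polarAt S (x₀ + e)) :=
        measureReal_mono (iUnion₂_subset hTsub) (volume_polarAt_lt_top hSo he).ne

lemma section_le_of_balanced {n : ℕ} {U : Set (EuclideanSpace ℝ (Fin n))}
    {v : EuclideanSpace ℝ (Fin n) → ℝ} (hnn : ∀ x ∈ U, 0 ≤ v x) {p x₀ x : EuclideanSpace ℝ (Fin n)}
    {h C : ℝ} (hC : 0 < C) (hx : v x < h + ⟪p, x - x₀⟫)
    (hbal : x₀ - (1 / C) • (x - x₀) ∈ U ∧ v (x₀ - (1 / C) • (x - x₀)) <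
      h + ⟪p, x₀ - (1 / C) • (x - x₀) - x₀⟫) : v x ≤ (C + 1) * h := by
  have h1 := hnn _ hbal.1
  have h2 := hbal.2
  have e1 : x₀ - (1 / C) • (x - x₀) - x₀ = -((1 / C) • (x - x₀)) := by abel
  rw [e1, inner_neg_right, inner_smul_right] at h2
  have h3 : C * (1 / C * ⟪p, x - x₀⟫) < C * h := by gcongr; linarith
  have h4 : C * (1 / C * ⟪p, x - x₀⟫) = ⟪p, x - x₀⟫ := by field_simp
  linarith

/-- Zeros of `v` inside a compactly contained balanced section cannot be close to its boundary. -/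
lemma GenSol.exists_section_extension {n : ℕ} {q lam Lam C : ℝ} (hq0 : 0 ≤ q) (hqn : q < n)
    (hlam : 0 < lam) (hLam : 0 ≤ Lam) (hC : 1 ≤ C) :
    ∃ t > (1 : ℝ), ∀ {Ω U Q : Set (EuclideanSpace ℝ (Fin n))} {v : EuclideanSpace ℝ (Fin n) → ℝ}
      {p x₀ e ν : EuclideanSpace ℝ (Fin n)} {h : ℝ}, GenSol n q lam Lam Ω v →
      IsOpen U → Convex ℝ U → U ⊆ Ω → IsCompact Q → Q ⊆ U → 0 < h →
      {x ∈ U | v x < h + ⟪p, x - x₀⟫} ⊆ Q →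
      (∀ x ∈ U, v x < h + ⟪p, x - x₀⟫ → (x₀ - (1 / C) • (x - x₀) ∈ U ∧
        v (x₀ - (1 / C) • (x - x₀)) < h + ⟪p, x₀ - (1 / C) • (x - x₀) - x₀⟫)) →
      ν ≠ 0 → (∀ x ∈ Ω, 0 < ⟪ν, x - x₀⟫ → 0 < v x) → x₀ ∈ U → v x₀ = 0 →
      x₀ + e ∈ U → v (x₀ + e) = 0 → 0 ≤ ⟪p, e⟫ →
      x₀ + t • e ∈ U ∧ v (x₀ + t • e) < h + ⟪p, t • e⟫ := by
  obtain ⟨c, hc, hnd⟩ := GenSol.exists_nondegeneracy (n := n) hq0 hqn hlam hC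
  have hCpos : 0 < C := by linarith
  set κ := (1 / (2 * (C + 1))) ^ n with hκ
  have hκ0 : 0 < κ := by positivity
  obtain ⟨N, hN⟩ := exists_nat_gt (Lam * (C + 1) ^ n / (κ * c))
  rw [div_lt_iff₀ (by positivity)] at hN
  set δ : ℝ := 1 / (N + 2) with hδ
  have hδ0 : 0 < δ := by positivity
  have hNδ : N * δ < 1 - δ := by
    have : (N + 2) * δ = 1 := by rw [hδ]; field_simp
    linarith
  have hδ1 : 0 < 1 - δ := lt_of_le_of_lt (by positivity) hNδ
  refine ⟨1 / (1 - δ), by rw [gt_iff_lt, one_lt_div hδ1]; linarith, ?_⟩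
  intro Ω U Q v p x₀ e ν h hv hUo hUc hUΩ hQ hQU hh hSQ hbal hν hνv hx₀ hvx₀ heU hve hpe
  have hconvU := hv.2.1.subset hUΩ hUc
  have hcontU := hv.1.mono hUΩ
  have hnnU : ∀ x ∈ U, 0 ≤ v x := fun x hx => hv.2.2.1 x (hUΩ hx)
  have hSo := isOpen_section hUo hcontU p x₀ h
  have hSc := convex_section hconvU p x₀ h
  have hB : ∀ x ∈ {x ∈ U | v x < h + ⟪p, x - x₀⟫}, v x ≤ (C + 1) * h := fun x hx =>
    section_le_of_balanced hnnU hCpos hx.2 (hbal x hx.1 hx.2)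
  have hpe' : 0 ≤ ⟪p, x₀ + e - x₀⟫ := by rwa [add_sub_cancel_left]
  have hA := hv.volume_polarAt_le hq0 hLam hUo hUΩ hQ hQU hh hSQ hB heU hve hpe'
  by_contra hcon
  set S := {x ∈ U | v x < h + ⟪p, x - x₀⟫} with hS
  have hx₀S : x₀ ∈ S := ⟨hx₀, by simp [hvx₀, hh]⟩
  have heS : x₀ + e ∈ S := ⟨heU, by rw [hve]; linarith⟩
  have hw : x₀ + (1 / (1 - δ)) • e ∉ S := fun hw => hcon ⟨hw.1, by simpa using hw.2⟩
  have hSb : Bornology.IsBounded S := hQ.isBounded.subset hSQ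
  have hbalS : ∀ x ∈ S, x₀ - (1 / C) • (x - x₀) ∈ S := fun x hx => hbal x hx.1 hx.2
  have hT := volume_polarAt_add_ge hCpos hSo hSc hx₀S hbalS heS hδ0 hNδ hw
  have hD := hnd hv hSo hSc hSb hx₀S (fun x hx => hUΩ hx.1) hbalS hB hν hνv
  set P := volume.real (polarAt S x₀) with hP
  have hP0 : 0 < P :=
    ENNReal.toReal_pos (volume_polarAt_pos x₀ hSb).ne' (volume_polarAt_lt_top hSo hx₀S).ne
  set B := (C + 1) * h with hBdef
  have hB0 : 0 < B := by positivity
  have hBpow : B ^ q * B ^ ((n : ℝ) - q) = (C + 1) ^ n * h ^ n := by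
    rw [← Real.rpow_add hB0, add_sub_cancel, Real.rpow_natCast, hBdef, mul_pow]
  have h1 : h ^ n * P * (N * (κ * c)) ≤ h ^ n * P * (Lam * (C + 1) ^ n) := by
    calc h ^ n * P * (N * (κ * c)) = c * (h ^ n * (N * κ * P)) := by ring
      _ ≤ c * (h ^ n * volume.real (polarAt S (x₀ + e))) := by gcongr
      _ ≤ c * (Lam * B ^ q * volume.real S) := by gcongr
      _ = Lam * B ^ q * (c * volume.real S) := by ring
      _ ≤ Lam * B ^ q * (B ^ ((n : ℝ) - q) * P) := by gcongr
      _ = Lam * (B ^ q * B ^ ((n : ℝ) - q)) * P := by ring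
      _ = _ := by rw [hBpow]; ring
  have h2 := le_of_mul_le_mul_left h1 (by positivity)
  linarith

/-- Along a half line in the coincidence set, low compactly contained balanced sections have
decreasing slope. -/
lemma GenSol.exists_height_inner_neg {n : ℕ} {q lam Lam C : ℝ} (hq0 : 0 ≤ q) (hqn : q < n)
    (hlam : 0 < lam) (hLam : 0 ≤ Lam) (hC : 1 ≤ C) {Ω U Q : Set (EuclideanSpace ℝ (Fin n))}
    {v : EuclideanSpace ℝ (Fin n) → ℝ} {x₀ e ν : EuclideanSpace ℝ (Fin n)}
    (hv : GenSol n q lam Lam Ω v) (hUo : IsOpen U) (hUc : Convex ℝ U) (hUΩ : U ⊆ Ω)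
    (hQ : IsCompact Q) (hQU : Q ⊆ U) (hν : ν ≠ 0) (hνv : ∀ x ∈ Ω, 0 < ⟪ν, x - x₀⟫ → 0 < v x)
    (hx₀ : x₀ ∈ U) (hvx₀ : v x₀ = 0) (he : e ≠ 0) (heU : x₀ + e ∈ U) (hve : v (x₀ + e) = 0) :
    ∃ h₁ > 0, ∀ h p, 0 < h → h ≤ h₁ → {x ∈ U | v x < h + ⟪p, x - x₀⟫} ⊆ Q →
      (∀ x ∈ U, v x < h + ⟪p, x - x₀⟫ → (x₀ - (1 / C) • (x - x₀) ∈ U ∧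
        v (x₀ - (1 / C) • (x - x₀)) < h + ⟪p, x₀ - (1 / C) • (x - x₀) - x₀⟫)) → ⟪p, e⟫ < 0 := by
  have hCpos : 0 < C := by linarith
  have hnnU : ∀ x ∈ U, 0 ≤ v x := fun x hx => hv.2.2.1 x (hUΩ hx)
  obtain ⟨t, ht, hext⟩ := GenSol.exists_section_extension (n := n) hq0 hqn hlam hLam hC
  by_cases heQ : x₀ + e ∈ Q
  swap
  · refine ⟨1, one_pos, fun h p hh _ hSQ _ => ?_⟩
    by_contra! hpe
    exact heQ (hSQ ⟨heU, by rw [hve, add_sub_cancel_left]; linarith⟩)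
  set Z : Set ℝ := {s | 1 ≤ s ∧ x₀ + s • e ∈ Q ∩ {x | v x = 0}} with hZ
  have hZc : IsCompact Z := by
    have hcl : IsClosed (Q ∩ {x | v x = 0}) :=
      (hv.1.mono (hQU.trans hUΩ)).preimage_isClosed_of_isClosed hQ.isClosed isClosed_singleton
    refine Metric.isCompact_of_isClosed_isBounded ?_ ?_
    · exact isClosed_Ici.inter (hcl.preimage (by fun_prop : Continuous fun s : ℝ => x₀ + s • e))
    · obtain ⟨r, hr⟩ := (Metric.isBounded_iff_subset_closedBall x₀).1 hQ.isBounded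
      refine (Metric.isBounded_iff_subset_closedBall 0).2 ⟨r / ‖e‖, fun s hs => ?_⟩
      have h1 := hr hs.2.1
      rw [Metric.mem_closedBall, dist_eq_norm, add_sub_cancel_left, norm_smul] at h1
      rw [mem_closedBall_zero_iff, le_div_iff₀ (norm_pos_iff.2 he)]
      exact h1
  obtain ⟨s, hsZ, hs⟩ := hZc.exists_isGreatest
    ⟨1, le_rfl, by rwa [one_smul], by simpa using hve⟩
  have hs1 : 1 ≤ s := hsZ.1
  set w := x₀ + t • (s • e) with hw
  have key : ∀ h p, 0 < h → {x ∈ U | v x < h + ⟪p, x - x₀⟫} ⊆ Q →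
      (∀ x ∈ U, v x < h + ⟪p, x - x₀⟫ → (x₀ - (1 / C) • (x - x₀) ∈ U ∧
        v (x₀ - (1 / C) • (x - x₀)) < h + ⟪p, x₀ - (1 / C) • (x - x₀) - x₀⟫)) →
      0 ≤ ⟪p, e⟫ → w ∈ Q ∧ v w ≤ (C + 1) * h := by
    intro h p hh hSQ hbal hpe
    have hpe' : 0 ≤ ⟪p, s • e⟫ := by rw [inner_smul_right]; positivity
    have h1 := hext hv hUo hUc hUΩ hQ hQU hh hSQ hbal hν hνv hx₀ hvx₀ (hQU hsZ.2.1) hsZ.2.2 hpe'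
    have h2 : v w < h + ⟪p, w - x₀⟫ := by rw [hw, add_sub_cancel_left]; exact h1.2
    exact ⟨hSQ ⟨h1.1, h2⟩, section_le_of_balanced hnnU hCpos h2 (hbal _ h1.1 h2)⟩
  by_cases hwQ : w ∈ Q
  swap
  · refine ⟨1, one_pos, fun h p hh _ hSQ hbal => ?_⟩
    by_contra! hpe
    exact hwQ (key h p hh hSQ hbal hpe).1
  have hvw : 0 < v w := by
    refine (hnnU w (hQU hwQ)).lt_of_ne' fun h0 => ?_
    have hts : t * s ∈ Z := ⟨by nlinarith, by rw [mul_smul]; exact ⟨hwQ, h0⟩⟩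
    have := hs hts
    nlinarith
  refine ⟨v w / (2 * (C + 1)), by positivity, fun h p hh hle hSQ hbal => ?_⟩
  by_contra! hpe
  have h1 := (key h p hh hSQ hbal hpe).2
  rw [le_div_iff₀ (by positivity)] at hle
  linarith

/-- The coincidence set has no segment along a supporting hyperplane at whose midpoint all low
balanced sections are compactly contained. -/
lemma GenSol.false_of_compact_sections {n : ℕ} {q lam Lam : ℝ} (hq0 : 0 ≤ q) (hqn : q < n)
    (hlam : 0 < lam) (hLam : 0 ≤ Lam) {Ω U Q : Set (EuclideanSpace ℝ (Fin n))}
    {v : EuclideanSpace ℝ (Fin n) → ℝ} {x₀ e ν : EuclideanSpace ℝ (Fin n)} {h₀ : ℝ}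
    (hv : GenSol n q lam Lam Ω v) (hUo : IsOpen U) (hUc : Convex ℝ U)
    (hUb : Bornology.IsBounded U) (hUΩ : U ⊆ Ω) (hQ : IsCompact Q) (hQU : Q ⊆ U) (hh₀ : 0 < h₀)
    (hsec : ∀ S ⊆ U, Convex ℝ S → x₀ ∈ S →
      (∀ x ∈ S, x₀ - (1 / balConst n) • (x - x₀) ∈ S) →
      (∀ x ∈ S, v x ≤ (balConst n + 1) * h₀) → S ⊆ Q)
    (hν : ν ≠ 0) (hνv : ∀ x ∈ Ω, 0 < ⟪ν, x - x₀⟫ → 0 < v x)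
    (hx₀ : x₀ ∈ U) (hvx₀ : v x₀ = 0) (he : e ≠ 0) (heU : x₀ + e ∈ U) (hve : v (x₀ + e) = 0)
    (heU' : x₀ - e ∈ U) (hve' : v (x₀ - e) = 0) : False := by
  have hC := one_le_balConst n
  have hnnU : ∀ x ∈ U, 0 ≤ v x := fun x hx => hv.2.2.1 x (hUΩ hx)
  have hconvU := hv.2.1.subset hUΩ hUc
  obtain ⟨h₁, hh₁, H₁⟩ := hv.exists_height_inner_neg hq0 hqn hlam hLam hC hUo hUc hUΩ hQ hQU hν
    hνv hx₀ hvx₀ he heU hve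
  obtain ⟨h₂, hh₂, H₂⟩ := hv.exists_height_inner_neg hq0 hqn hlam hLam hC hUo hUc hUΩ hQ hQU hν
    hνv hx₀ hvx₀ (neg_ne_zero.2 he) (by rwa [← sub_eq_add_neg]) (by rwa [← sub_eq_add_neg])
  set h := min h₀ (min h₁ h₂) with hh
  have hpos : 0 < h := by positivity
  obtain ⟨p, hp⟩ := exists_balanced_section hUo hUb (hv.1.mono hUΩ) hconvU hnnU hx₀ hvx₀ hpos
  have hSQ : {x ∈ U | v x < h + ⟪p, x - x₀⟫} ⊆ Q := by
    refine hsec _ (fun x hx => hx.1) (convex_section hconvU p x₀ h) ⟨hx₀, by simp [hvx₀, hpos]⟩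
      (fun x hx => hp x hx.1 hx.2) fun x hx => ?_
    refine (section_le_of_balanced hnnU (by linarith) hx.2 (hp x hx.1 hx.2)).trans ?_
    have : h ≤ h₀ := min_le_left _ _
    gcongr
  have h1 := H₁ h p hpos ((min_le_right _ _).trans (min_le_left _ _)) hSQ hp
  have h2 := H₂ h p hpos ((min_le_right _ _).trans (min_le_right _ _)) hSQ hp
  rw [inner_neg_right] at h2
  linarith

/-- A global solution that is bounded on a line vanishes identically. -/
lemma GenSol.eq_zero_of_bounded_on_line {n : ℕ} {q lam Lam c : ℝ} (hlam : 0 < lam)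
    {v : EuclideanSpace ℝ (Fin n) → ℝ} {x₀ e : EuclideanSpace ℝ (Fin n)}
    (hv : GenSol n q lam Lam univ v) (he : e ≠ 0) (hline : ∀ s : ℝ, v (x₀ + s • e) ≤ c)
    (z : EuclideanSpace ℝ (Fin n)) : v z = 0 := by
  obtain ⟨hcont, -, hnn, -, hlow⟩ := hv
  have hcont' : Continuous v := continuousOn_univ.1 hcont
  by_contra hz
  have hz' : 0 < v z := (hnn z (mem_univ z)).lt_of_ne' hz
  have hEo : IsOpen {x | 0 < v x} := isOpen_lt continuous_const hcont'
  have hsub : subgradImg univ v (univ ∩ {x | 0 < v x}) ⊆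
      ((ℝ ∙ e)ᗮ : Submodule ℝ (EuclideanSpace ℝ (Fin n))) := by
    intro p hp
    simp only [subgradImg, mem_iUnion] at hp
    obtain ⟨x, -, hp⟩ := hp
    have h1 : ∀ s : ℝ, s * ⟪p, e⟫ ≤ c - v x - ⟪p, x₀ - x⟫ := by
      intro s
      have := (hp (x₀ + s • e) (mem_univ _)).trans (hline s)
      have e1 : x₀ + s • e - x = (x₀ - x) + s • e := by abel
      rw [e1, inner_add_right, inner_smul_right] at this
      linarith
    rw [SetLike.mem_coe, Submodule.mem_orthogonal_singleton_iff_inner_left]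
    by_contra hne
    have := h1 ((c - v x - ⟪p, x₀ - x⟫ + 1) / ⟪p, e⟫)
    rw [div_mul_cancel₀ _ hne] at this
    linarith
  have hne : ((ℝ ∙ e)ᗮ : Submodule ℝ (EuclideanSpace ℝ (Fin n))) ≠ ⊤ := by
    intro h
    have : e ∈ ((ℝ ∙ e)ᗮ : Submodule ℝ (EuclideanSpace ℝ (Fin n))) := h ▸ Submodule.mem_top
    rw [Submodule.mem_orthogonal_singleton_iff_inner_left, inner_self_eq_zero] at this
    exact he this
  have h0 : volume (subgradImg univ v (univ ∩ {x | 0 < v x})) = 0 :=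
    measure_mono_null hsub (Measure.addHaar_submodule _ _ hne)
  have h1 := hlow univ MeasurableSet.univ subset_rfl
  rw [h0, nonpos_iff_eq_zero, mul_eq_zero, ENNReal.ofReal_eq_zero, or_iff_right hlam.not_ge,
    univ_inter] at h1
  have hmeas : Measurable fun x => ENNReal.ofReal (v x ^ q) :=
    (hcont'.measurable.pow_const q).ennreal_ofReal
  have h2 : 0 < ∫⁻ x in {x | 0 < v x}, ENNReal.ofReal (v x ^ q) := by
    rw [setLIntegral_pos_iff hmeas]
    refine (hEo.measure_pos _ ⟨z, hz'⟩).trans_le (measure_mono fun x hx => ⟨?_, hx⟩)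
    exact (ENNReal.ofReal_pos.2 (Real.rpow_pos_of_pos hx q)).ne'
  exact h2.ne' h1

lemma GenSol.false_of_segment_univ {n : ℕ} {q lam Lam : ℝ} (hq0 : 0 ≤ q) (hqn : q < n)
    (hlam : 0 < lam) (hLam : 0 ≤ Lam) {v : EuclideanSpace ℝ (Fin n) → ℝ}
    {x₀ e ν : EuclideanSpace ℝ (Fin n)} (hv : GenSol n q lam Lam univ v)
    (hν : ν ≠ 0) (hνv : ∀ x, 0 < ⟪ν, x - x₀⟫ → 0 < v x) (hvx₀ : v x₀ = 0) (he : e ≠ 0)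
    (hve : v (x₀ + e) = 0) (hve' : v (x₀ - e) = 0) : False := by
  have hC := one_le_balConst n
  have hCpos : 0 < balConst n := by linarith
  have hcont : Continuous v := continuousOn_univ.1 hv.1
  set c := (balConst n + 1) * 1 with hc
  obtain ⟨k, hk⟩ : ∃ k : ℕ, ∀ u ∈ sphere (0 : EuclideanSpace ℝ (Fin n)) 1,
      ¬ ∀ s : ℝ, |s| ≤ k → v (x₀ + s • u) ≤ c := by
    by_contra! hcon
    choose u hu hub using hcon
    obtain ⟨w, hw, φ, hφ, hlim⟩ :=
      (isCompact_sphere (0 : EuclideanSpace ℝ (Fin n)) 1).tendsto_subseq hu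
    have hw0 : w ≠ 0 := by
      rintro rfl
      simp at hw
    have hline : ∀ s : ℝ, v (x₀ + s • w) ≤ c := by
      intro s
      have h1 : Filter.Tendsto (fun j => v (x₀ + s • u (φ j))) Filter.atTop
          (nhds (v (x₀ + s • w))) :=
        ((by fun_prop : Continuous fun y => v (x₀ + s • y)).tendsto w).comp hlim
      refine le_of_tendsto h1 ?_
      obtain ⟨m, hm⟩ := exists_nat_ge |s|
      filter_upwards [Filter.eventually_ge_atTop m] with j hj
      refine hub (φ j) s (hm.trans ?_)
      exact_mod_cast hj.trans (hφ.id_le j)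
    have h1 := hv.eq_zero_of_bounded_on_line hlam hw0 hline (x₀ + ν)
    have h2 := hνv (x₀ + ν) (by rw [add_sub_cancel_left]; exact real_inner_self_pos.2 hν)
    exact h2.ne' h1
  set R : ℝ := balConst n * k + ‖e‖ with hR
  have hRe : ‖e‖ ≤ R := by rw [hR]; nlinarith [k.cast_nonneg (α := ℝ)]
  refine hv.false_of_compact_sections hq0 hqn hlam hLam (U := ball x₀ (R + 1))
    (Q := closedBall x₀ R) isOpen_ball (convex_ball _ _) isBounded_ball (subset_univ _)
    (isCompact_closedBall _ _) (closedBall_subset_ball (by linarith)) one_pos ?_ hν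
    (fun x _ => hνv x) (mem_ball_self (by positivity)) hvx₀ he
    (by rw [mem_ball, dist_eq_norm, add_sub_cancel_left]; linarith) hve
    (by rw [mem_ball, dist_eq_norm, sub_sub_cancel_left, norm_neg]; linarith) hve'
  intro S _ hSc hx₀S hbal hvS x hxS
  by_contra hx
  rw [mem_closedBall, dist_eq_norm, not_le] at hx
  set ρ := ‖x - x₀‖ with hρ
  have hρ0 : 0 < ρ := (norm_nonneg e).trans_lt (hRe.trans_lt hx)
  have hkρ : balConst n * k ≤ ρ := by
    have := norm_nonneg e
    linarith
  refine hk (ρ⁻¹ • (x - x₀)) (by rw [mem_sphere_zero_iff_norm, norm_smul, norm_inv, norm_norm,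
    ← hρ, inv_mul_cancel₀ hρ0.ne']) fun s hs => hvS _ ?_
  rw [abs_le] at hs
  rcases le_total 0 s with h0 | h0
  · have : x₀ + s • ρ⁻¹ • (x - x₀) = x₀ + (s / ρ) • (x - x₀) := by rw [smul_smul, div_eq_mul_inv]
    rw [this]
    refine hSc.add_smul_sub_mem hx₀S hxS ⟨by positivity, ?_⟩
    rw [div_le_one hρ0]
    nlinarith [k.cast_nonneg (α := ℝ)]
  · have : x₀ + s • ρ⁻¹ • (x - x₀) = x₀ + (-s * balConst n / ρ) •
        (x₀ - (1 / balConst n) • (x - x₀) - x₀) := by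
      rw [sub_sub_cancel_left, smul_neg, smul_smul, smul_smul, ← neg_smul]
      congr 2
      field_simp
    rw [this]
    refine hSc.add_smul_sub_mem hx₀S (hbal x hxS) ⟨?_, ?_⟩
    · have : 0 ≤ -s := by linarith
      positivity
    · rw [div_le_one hρ0]
      nlinarith

lemma GenSol.false_of_segment_bounded {n : ℕ} {q lam Lam : ℝ} (hq0 : 0 ≤ q) (hqn : q < n)
    (hlam : 0 < lam) (hLam : 0 ≤ Lam) {Ω : Set (EuclideanSpace ℝ (Fin n))}
    {v vbar : EuclideanSpace ℝ (Fin n) → ℝ} {x₀ e ν : EuclideanSpace ℝ (Fin n)}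
    (hv : GenSol n q lam Lam Ω v) (hΩo : IsOpen Ω) (hΩb : Bornology.IsBounded Ω)
    (hvbar : ContinuousOn vbar (closure Ω)) (heq : ∀ x ∈ Ω, vbar x = v x)
    (hfr : ∀ x ∈ frontier Ω, 0 < vbar x) (hν : ν ≠ 0)
    (hνv : ∀ x ∈ Ω, 0 < ⟪ν, x - x₀⟫ → 0 < v x) (hx₀ : x₀ ∈ Ω) (hvx₀ : v x₀ = 0) (he : e ≠ 0)
    (heU : x₀ + e ∈ Ω) (hve : v (x₀ + e) = 0) (heU' : x₀ - e ∈ Ω) (hve' : v (x₀ - e) = 0) :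
    False := by
  have hC := one_le_balConst n
  have hcomp : IsCompact (closure Ω) := hΩb.isCompact_closure
  obtain ⟨c, hc, hcfr⟩ := (hcomp.of_isClosed_subset isClosed_frontier
    frontier_subset_closure).exists_forall_le' (hvbar.mono frontier_subset_closure) hfr
  refine hv.false_of_compact_sections hq0 hqn hlam hLam (U := Ω)
    (Q := closure Ω ∩ vbar ⁻¹' Iic (c / 2)) (h₀ := c / 2 / (balConst n + 1)) hΩo hv.2.1.1 hΩb
    subset_rfl ?_ ?_ (by positivity) ?_ hν hνv hx₀ hvx₀ he heU hve heU' hve'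
  · exact hcomp.of_isClosed_subset
      (hvbar.preimage_isClosed_of_isClosed isClosed_closure isClosed_Iic) inter_subset_left
  · rintro x ⟨hx, hxc⟩
    by_contra hxΩ
    have h1 := hcfr x (hΩo.frontier_eq ▸ ⟨hx, hxΩ⟩)
    have h2 : vbar x ≤ c / 2 := hxc
    linarith
  · intro S hS _ _ _ hvS x hx
    refine ⟨subset_closure (hS hx), ?_⟩
    have := hvS x hx
    rw [mul_div_cancel₀ _ (by positivity)] at this
    rw [mem_preimage, heq x (hS hx)]
    exact this

lemma eq_inner_smul_add_inner_smul {ν e : EuclideanSpace ℝ (Fin 2)} (hν : ‖ν‖ = 1) (he : e ≠ 0)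
    (hνe : ⟪ν, e⟫ = 0) (x : EuclideanSpace ℝ (Fin 2)) :
    x = (⟪ν, x⟫) • ν + (⟪e, x⟫ / ‖e‖ ^ 2) • e := by
  have he2 : ‖e‖ ^ 2 ≠ 0 := by simpa using he
  set w := x - ((⟪ν, x⟫) • ν + (⟪e, x⟫ / ‖e‖ ^ 2) • e) with hw
  have h1 : ⟪ν, w⟫ = 0 := by
    rw [hw, inner_sub_right, inner_add_right, inner_smul_right, inner_smul_right, hνe,
      real_inner_self_eq_norm_sq, hν]
    ring
  have h2 : ⟪e, w⟫ = 0 := by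
    rw [hw, inner_sub_right, inner_add_right, inner_smul_right, inner_smul_right,
      real_inner_comm ν e, hνe, real_inner_self_eq_norm_sq]
    field_simp
    ring
  have hν2 : ‖ν‖ ^ 2 = 1 := by rw [hν, one_pow]
  rw [← real_inner_self_eq_norm_sq] at hν2 he2
  simp only [PiLp.inner_apply, Fin.sum_univ_two, RCLike.inner_apply, conj_trivial]
    at h1 h2 hνe hν2 he2
  have hdet : (ν 0 * e 1 - ν 1 * e 0) ≠ 0 := by
    intro h0
    apply he2
    linear_combination (ν 0 * e 1 - ν 1 * e 0) * h0 + (e 0 * ν 0 + e 1 * ν 1) * hνe -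
      (e 0 * e 0 + e 1 * e 1) * hν2
  have hw0 : w 0 = 0 := by
    refine (mul_eq_zero.1 ?_).resolve_right hdet
    linear_combination e 1 * h1 - ν 1 * h2
  have hw1 : w 1 = 0 := by
    refine (mul_eq_zero.1 ?_).resolve_right hdet
    linear_combination ν 0 * h2 - e 0 * h1
  rw [← sub_eq_zero, ← hw]
  ext i
  fin_cases i
  · exact hw0
  · exact hw1

/-- The linear map stretching the direction of the unit vector `ν` by the factor `c`. -/
def stretch {n : ℕ} (ν : EuclideanSpace ℝ (Fin n)) (c : ℝ) :
    EuclideanSpace ℝ (Fin n) →ₗ[ℝ] EuclideanSpace ℝ (Fin n) :=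
  LinearMap.transvection (innerₗ _ ν) ((c - 1) • ν)

lemma stretch_apply {n : ℕ} (ν x : EuclideanSpace ℝ (Fin n)) (c : ℝ) :
    stretch ν c x = x + (⟪ν, x⟫) • ((c - 1) • ν) := by
  simp [stretch, LinearMap.transvection.apply]

lemma inner_stretch {n : ℕ} {ν : EuclideanSpace ℝ (Fin n)} (hν : ‖ν‖ = 1) (c : ℝ)
    (x : EuclideanSpace ℝ (Fin n)) : ⟪ν, stretch ν c x⟫ = c * ⟪ν, x⟫ := by
  rw [stretch_apply, inner_add_right, inner_smul_right, inner_smul_right,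
    real_inner_self_eq_norm_sq, hν]
  ring

lemma stretch_stretch_inv {n : ℕ} {ν : EuclideanSpace ℝ (Fin n)} (hν : ‖ν‖ = 1) {c : ℝ}
    (hc : c ≠ 0) (x : EuclideanSpace ℝ (Fin n)) : stretch ν c (stretch ν c⁻¹ x) = x := by
  rw [stretch_apply, inner_stretch hν, stretch_apply]
  match_scalars
  · rfl
  · field_simp
    ring

lemma inner_stretch_of_orthogonal {n : ℕ} {ν e : EuclideanSpace ℝ (Fin n)} (hνe : ⟪ν, e⟫ = 0)
    (c : ℝ) (x : EuclideanSpace ℝ (Fin n)) : ⟪e, stretch ν c x⟫ = ⟪e, x⟫ := by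
  rw [stretch_apply, inner_add_right, inner_smul_right, inner_smul_right, real_inner_comm ν e, hνe]
  ring

lemma volume_image_stretch {n : ℕ} {ν : EuclideanSpace ℝ (Fin n)} (hν : ‖ν‖ = 1) (c : ℝ)
    (S : Set (EuclideanSpace ℝ (Fin n))) :
    volume (stretch ν c '' S) = ENNReal.ofReal |c| * volume S := by
  rw [Measure.addHaar_image_linearMap, stretch, LinearMap.transvection.det, innerₗ_apply_apply,
    inner_smul_right, real_inner_self_eq_norm_sq, hν]
  congr 3
  ring

/-- Near an interior point of a flat boundary segment, a convex function is trapped between two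
nearby linear functions. -/
lemma exists_slope_bounds {n : ℕ} {Ω : Set (EuclideanSpace ℝ (Fin n))}
    {v : EuclideanSpace ℝ (Fin n) → ℝ} {x₀ e ν : EuclideanSpace ℝ (Fin n)} {η : ℝ}
    (hΩo : IsOpen Ω) (hconv : ConvexOn ℝ Ω v) (hnn : ∀ x ∈ Ω, 0 ≤ v x) (hη : 0 < η)
    (hx₀ : x₀ ∈ Ω) (hvx₀ : v x₀ = 0)
    (heU : x₀ + e ∈ Ω) (hve : v (x₀ + e) = 0) (heU' : x₀ - e ∈ Ω) (hve' : v (x₀ - e) = 0) :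
    ∃ a σ : ℝ, 0 < σ ∧ ∀ s t : ℝ, 0 < s → s ≤ σ → |t| ≤ 1 / 2 →
      x₀ + s • ν + t • e ∈ Ω ∧ a * s ≤ v (x₀ + s • ν + t • e) ∧
        v (x₀ + s • ν + t • e) ≤ (a + η) * s := by
  have hseg : ∀ t : ℝ, |t| ≤ 1 → x₀ + t • e ∈ Ω ∧ v (x₀ + t • e) = 0 := by
    intro t ht
    rw [abs_le] at ht
    have e1 : ((1 - t) / 2) • (x₀ - e) + ((1 + t) / 2) • (x₀ + e) = x₀ + t • e := by module
    have hmem := hconv.1 heU' heU (by linarith : 0 ≤ (1 - t) / 2) (by linarith : 0 ≤ (1 + t) / 2)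
      (by ring)
    have hle := hconv.2 heU' heU (by linarith : 0 ≤ (1 - t) / 2) (by linarith : 0 ≤ (1 + t) / 2)
      (by ring)
    rw [e1] at hmem hle
    rw [hve, hve', smul_zero, smul_zero, add_zero] at hle
    exact ⟨hmem, le_antisymm hle (hnn _ hmem)⟩
  obtain ⟨σ₀, hσ₀, hσΩ⟩ : ∃ σ₀ > (0 : ℝ), x₀ + σ₀ • ν ∈ Ω := by
    have hc : Continuous fun s : ℝ => x₀ + s • ν := by fun_prop
    have h0 : (fun s : ℝ => x₀ + s • ν) ⁻¹' Ω ∈ nhds 0 :=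
      (hΩo.preimage hc).mem_nhds (by simpa using hx₀)
    obtain ⟨r, hr, hrΩ⟩ := Metric.nhds_basis_closedBall.mem_iff.1 h0
    exact ⟨r, hr, hrΩ (by simp [abs_of_pos hr])⟩
  have hray : ∀ s r : ℝ, 0 < r → x₀ + r • ν ∈ Ω → 0 ≤ s → s ≤ r →
      x₀ + s • ν ∈ Ω ∧ v (x₀ + s • ν) ≤ s / r * v (x₀ + r • ν) := by
    intro s r hr hrΩ hs hsr
    have h1 : 0 ≤ s / r := by positivity
    have h2 : s / r ≤ 1 := (div_le_one hr).2 hsr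
    have e1 : (1 - s / r) • x₀ + (s / r) • (x₀ + r • ν) = x₀ + s • ν := by
      have : s = s / r * r := by field_simp
      nth_rewrite 3 [this]
      module
    have hmem := hconv.1 hx₀ hrΩ (by linarith : 0 ≤ 1 - s / r) h1 (by ring)
    have hle := hconv.2 hx₀ hrΩ (by linarith : 0 ≤ 1 - s / r) h1 (by ring)
    rw [e1] at hmem hle
    rw [hvx₀, smul_zero, zero_add, smul_eq_mul] at hle
    exact ⟨hmem, hle⟩
  set A := (fun s : ℝ => v (x₀ + s • ν) / s) '' Ioc 0 σ₀ with hA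
  have hAb : BddBelow A := by
    refine ⟨0, ?_⟩
    rintro _ ⟨s, hs, rfl⟩
    exact div_nonneg (hnn _ (hray s σ₀ hσ₀ hσΩ hs.1.le hs.2).1) hs.1.le
  have hAn : A.Nonempty := ⟨_, σ₀, ⟨hσ₀, le_rfl⟩, rfl⟩
  obtain ⟨_, ⟨r, hr, rfl⟩, hrη⟩ := exists_lt_of_csInf_lt hAn (lt_add_of_pos_right (sInf A) hη)
  set a := sInf A with ha
  have hrΩ := (hray r σ₀ hσ₀ hσΩ hr.1.le hr.2).1
  have hlow : ∀ s, 0 < s → s ≤ r → a * s ≤ v (x₀ + s • ν) := by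
    intro s hs hsr
    rw [← le_div_iff₀ hs]
    exact csInf_le hAb ⟨s, ⟨hs, hsr.trans hr.2⟩, rfl⟩
  have hupp : ∀ s, 0 < s → s ≤ r → v (x₀ + s • ν) ≤ (a + η) * s := by
    intro s hs hsr
    refine (hray s r hr.1 hrΩ hs.le hsr).2.trans ?_
    have e1 : s / r * v (x₀ + r • ν) = v (x₀ + r • ν) / r * s := by ring
    rw [e1]
    gcongr
  refine ⟨a, r / 2, by linarith [hr.1], fun s t hs hsr ht => ?_⟩
  have ht' := abs_le.1 ht
  have h2s := (hray (2 * s) r hr.1 hrΩ (by linarith) (by linarith)).1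
  have h2t := hseg (2 * t) (by rw [abs_le]; constructor <;> linarith)
  have hnt := hseg (-t) (by rw [abs_neg]; linarith)
  have e1 : (1 / 2 : ℝ) • (x₀ + (2 * s) • ν) + (1 / 2 : ℝ) • (x₀ + (2 * t) • e) =
      x₀ + s • ν + t • e := by module
  have hmem := hconv.1 h2s h2t.1 (by norm_num : (0 : ℝ) ≤ 1 / 2) (by norm_num : (0 : ℝ) ≤ 1 / 2)
    (by norm_num)
  have hle := hconv.2 h2s h2t.1 (by norm_num : (0 : ℝ) ≤ 1 / 2) (by norm_num : (0 : ℝ) ≤ 1 / 2)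
    (by norm_num)
  rw [e1] at hmem hle
  have e2 : (1 / 2 : ℝ) • (x₀ + s • ν + t • e) + (1 / 2 : ℝ) • (x₀ + (-t) • e) =
      x₀ + (s / 2) • ν := by module
  have hle2 := hconv.2 hmem hnt.1 (by norm_num : (0 : ℝ) ≤ 1 / 2)
    (by norm_num : (0 : ℝ) ≤ 1 / 2) (by norm_num)
  rw [e2] at hle2
  rw [h2t.2, smul_zero, add_zero, smul_eq_mul] at hle
  rw [hnt.2, smul_zero, add_zero, smul_eq_mul] at hle2
  have h1 := hupp (2 * s) (by linarith) (by linarith)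
  have h2 := hlow (s / 2) (by linarith) (by linarith)
  exact ⟨hmem, by linarith, by linarith⟩

lemma GenSol.false_of_segment_plane {lam Lam : ℝ} (hlam : 0 < lam)
    {Ω : Set (EuclideanSpace ℝ (Fin 2))} {v : EuclideanSpace ℝ (Fin 2) → ℝ}
    {x₀ e ν : EuclideanSpace ℝ (Fin 2)} (hv : GenSol 2 0 lam Lam Ω v) (hΩo : IsOpen Ω)
    (hν : ‖ν‖ = 1) (hνe : ⟪ν, e⟫ = 0) (hνv : ∀ x ∈ Ω, 0 < ⟪ν, x - x₀⟫ → 0 < v x)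
    (hx₀ : x₀ ∈ Ω) (hvx₀ : v x₀ = 0) (he : e ≠ 0)
    (heU : x₀ + e ∈ Ω) (hve : v (x₀ + e) = 0) (heU' : x₀ - e ∈ Ω) (hve' : v (x₀ - e) = 0) :
    False := by
  obtain ⟨-, hconv, hnn, -, hlow⟩ := hv
  have hepos : 0 < ‖e‖ := norm_pos_iff.2 he
  set κ := min (1 / 4) (‖e‖ ^ 2 / 4) with hκ
  have hκ0 : 0 < κ := by positivity
  set η := κ * √lam / 9 with hη
  have hη0 : 0 < η := by positivity
  obtain ⟨a, σ, hσ, hbd⟩ :=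
    exists_slope_bounds (ν := ν) hΩo hconv hnn hη0 hx₀ hvx₀ heU hve heU' hve'
  set D : Set (EuclideanSpace ℝ (Fin 2)) := {x | |⟪ν, x⟫| < 1} ∩ {x | |⟪e, x⟫| < 1} with hD
  have hDo : IsOpen D := (isOpen_lt (by fun_prop) continuous_const).inter
    (isOpen_lt (by fun_prop) continuous_const)
  have hDb : Bornology.IsBounded D := by
    refine (Metric.isBounded_iff_subset_closedBall 0).2 ⟨1 + 1 / ‖e‖ ^ 2 * ‖e‖, fun x hx => ?_⟩
    rw [mem_closedBall_zero_iff, eq_inner_smul_add_inner_smul hν he hνe x]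
    refine (norm_add_le _ _).trans ?_
    rw [norm_smul, norm_smul, hν, norm_div, norm_pow, norm_norm, mul_one]
    have h1 : ‖⟪ν, x⟫‖ < 1 := hx.1
    have h2 : ‖⟪e, x⟫‖ < 1 := hx.2
    gcongr
  have hDpos : 0 < volume D := hDo.measure_pos _ ⟨0, by simp [hD]⟩
  have hDt : volume D ≠ ⊤ := hDb.measure_lt_top.ne
  set E := (fun x => (x₀ + (σ / 2) • ν) + κ • x) '' (stretch ν σ '' D) with hE
  have hcoord : ∀ x ∈ E, ∃ s t : ℝ, x = x₀ + s • ν + t • e ∧ σ / 4 < s ∧ s < 3 * σ / 4 ∧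
      |t| < 1 / 4 := by
    rintro _ ⟨_, ⟨x, hx, rfl⟩, rfl⟩
    refine ⟨σ / 2 + κ * (σ * ⟪ν, x⟫), κ * (⟪e, x⟫ / ‖e‖ ^ 2), ?_, ?_, ?_, ?_⟩
    · have h1 := eq_inner_smul_add_inner_smul hν he hνe (stretch ν σ x)
      rw [inner_stretch hν, inner_stretch_of_orthogonal hνe] at h1
      simp only
      nth_rewrite 1 [h1]
      module
    · have hx1 : |⟪ν, x⟫| < 1 := hx.1
      have h1 := (abs_lt.1 hx1).1
      have h2 : κ * (σ * (-1)) < κ * (σ * ⟪ν, x⟫) := by gcongr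
      have h3 : κ * σ ≤ 1 / 4 * σ := by gcongr; exact min_le_left _ _
      linarith
    · have hx1 : |⟪ν, x⟫| < 1 := hx.1
      have h1 := (abs_lt.1 hx1).2
      have h2 : κ * (σ * ⟪ν, x⟫) < κ * (σ * 1) := by gcongr
      have h3 : κ * σ ≤ 1 / 4 * σ := by gcongr; exact min_le_left _ _
      linarith
    · rw [abs_mul, abs_div, abs_of_pos hκ0, abs_of_pos (by positivity : 0 < ‖e‖ ^ 2)]
      have h1 : κ * (|⟪e, x⟫| / ‖e‖ ^ 2) < κ * (1 / ‖e‖ ^ 2) := by gcongr; exact hx.2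
      have h2 : κ * (1 / ‖e‖ ^ 2) ≤ ‖e‖ ^ 2 / 4 * (1 / ‖e‖ ^ 2) := by
        gcongr; exact min_le_right _ _
      have h3 : ‖e‖ ^ 2 / 4 * (1 / ‖e‖ ^ 2) = 1 / 4 := by field_simp
      linarith
  have hνc : ∀ s t : ℝ, ⟪ν, x₀ + s • ν + t • e - x₀⟫ = s := by
    intro s t
    have : x₀ + s • ν + t • e - x₀ = s • ν + t • e := by abel
    rw [this, inner_add_right, inner_smul_right, inner_smul_right, hνe,
      real_inner_self_eq_norm_sq, hν]
    ring
  have hEΩ : E ⊆ Ω := by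
    intro x hx
    obtain ⟨s, t, rfl, h1, h2, h3⟩ := hcoord x hx
    exact (hbd s t (by linarith) (by linarith) (by linarith)).1
  have hEpos : E ∩ {x | 0 < v x} = E := by
    refine inter_eq_self_of_subset_left fun x hx => hνv x (hEΩ hx) ?_
    obtain ⟨s, t, rfl, h1, h2, h3⟩ := hcoord x hx
    rw [hνc]
    linarith
  have hEm : MeasurableSet E := by
    have h1 : stretch ν σ '' D = stretch ν σ⁻¹ ⁻¹' D := by
      refine Subset.antisymm ?_ fun x hx => ⟨_, hx, stretch_stretch_inv hν hσ.ne' x⟩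
      rintro _ ⟨y, hy, rfl⟩
      have := stretch_stretch_inv hν (inv_ne_zero hσ.ne') y
      rw [inv_inv] at this
      rwa [mem_preimage, this]
    have h2 : IsOpen ((stretch ν σ⁻¹) ⁻¹' D) :=
      hDo.preimage (LinearMap.continuous_of_finiteDimensional _)
    have h3 := isOpen_image_homothety (x₀ + (σ / 2) • ν) 0 hκ0.ne' h2
    simp only [sub_zero] at h3
    rw [hE, h1]
    exact h3.measurableSet
  have himg : subgradImg Ω v E ⊆
      (fun w => a • ν + (8 * η * σ) • w) '' (stretch ν σ⁻¹ '' D) := by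
    intro p hp
    simp only [subgradImg, mem_iUnion] at hp
    obtain ⟨x, hx, hp⟩ := hp
    obtain ⟨s, t, rfl, hs1, hs2, ht⟩ := hcoord x hx
    have ht' := abs_lt.1 ht
    have hx2 := (hbd s t (by linarith) (by linarith) (by linarith)).2.1
    have key : ∀ s' t' : ℝ, 0 < s' → s' ≤ σ → |t'| ≤ 1 / 2 →
        (s' - s) * ⟪p - a • ν, ν⟫ + (t' - t) * ⟪p - a • ν, e⟫ ≤ η * σ := by
      intro s' t' hs' hs'σ ht'
      obtain ⟨h1, h2, h3⟩ := hbd s' t' hs' hs'σ ht'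
      have h4 := hp _ h1
      have e1 : x₀ + s' • ν + t' • e - (x₀ + s • ν + t • e) = (s' - s) • ν + (t' - t) • e := by
        module
      rw [e1, inner_add_right, inner_smul_right, inner_smul_right] at h4
      rw [inner_sub_left, inner_sub_left, inner_smul_left, inner_smul_left, hνe,
        real_inner_self_eq_norm_sq, hν]
      simp only [RCLike.conj_to_real]
      have h5 : η * s' ≤ η * σ := by gcongr
      linarith
    have k1 := key (s + σ / 4) t (by linarith) (by linarith) (by linarith)
    have k2 := key (s - σ / 4) t (by linarith) (by linarith) (by linarith)
    have k3 := key s (t + 1 / 4) (by linarith) (by linarith)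
      (by rw [abs_le]; constructor <;> linarith)
    have k4 := key s (t - 1 / 4) (by linarith) (by linarith)
      (by rw [abs_le]; constructor <;> linarith)
    set w := (1 / (8 * η * σ)) • (p - a • ν) with hw
    have hησ : 0 < η * σ := by positivity
    have hwσ := stretch_stretch_inv hν (inv_ne_zero hσ.ne') w
    rw [inv_inv] at hwσ
    refine ⟨w, ⟨stretch ν σ w, ⟨?_, ?_⟩, hwσ⟩, ?_⟩
    · change |⟪ν, stretch ν σ w⟫| < 1
      rw [inner_stretch hν, hw, inner_smul_right, real_inner_comm]
      have e1 : σ * (1 / (8 * η * σ) * ⟪p - a • ν, ν⟫) =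
          (σ * ⟪p - a • ν, ν⟫) / (8 * (η * σ)) := by field_simp
      rw [e1, abs_div, abs_of_pos (by positivity : 0 < 8 * (η * σ)), div_lt_one (by positivity),
        abs_lt]
      constructor <;> linarith
    · change |⟪e, stretch ν σ w⟫| < 1
      rw [inner_stretch_of_orthogonal hνe, hw, inner_smul_right, real_inner_comm]
      have e1 : 1 / (8 * η * σ) * ⟪p - a • ν, e⟫ = ⟪p - a • ν, e⟫ / (8 * (η * σ)) := by
        field_simp
      rw [e1, abs_div, abs_of_pos (by positivity : 0 < 8 * (η * σ)), div_lt_one (by positivity),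
        abs_lt]
      constructor <;> linarith
    · simp only [hw, smul_smul]
      rw [mul_one_div_cancel (by positivity), one_smul]
      abel
  have h1 := hlow E hEm hEΩ
  rw [hEpos] at h1
  simp only [Real.rpow_zero, ENNReal.ofReal_one, setLIntegral_const, one_mul] at h1
  have h2 := h1.trans (measure_mono himg)
  rw [hE, volume_image_add_smul, volume_image_add_smul, volume_image_stretch hν,
    volume_image_stretch hν] at h2
  have h3 := ENNReal.toReal_mono (ENNReal.mul_ne_top ENNReal.ofReal_ne_top
    (ENNReal.mul_ne_top ENNReal.ofReal_ne_top hDt)) h2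
  simp only [ENNReal.toReal_mul] at h3
  rw [ENNReal.toReal_ofReal hlam.le, ENNReal.toReal_ofReal (by positivity),
    ENNReal.toReal_ofReal (by positivity), ENNReal.toReal_ofReal (by positivity),
    ENNReal.toReal_ofReal (by positivity), abs_of_pos hκ0, abs_of_pos hσ,
    abs_of_pos (by positivity : 0 < 8 * η * σ), abs_of_pos (by positivity : 0 < σ⁻¹)] at h3
  have hd : 0 < (volume D).toReal := ENNReal.toReal_pos hDpos.ne' hDt
  have hsq : √lam ^ 2 = lam := Real.sq_sqrt hlam.le
  have e1 : lam * (κ ^ 2 * (σ * (volume D).toReal)) =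
      (lam * κ ^ 2) * (σ * (volume D).toReal) := by ring
  have e2 : (8 * η * σ) ^ 2 * (σ⁻¹ * (volume D).toReal) =
      (64 / 81 * (lam * κ ^ 2)) * (σ * (volume D).toReal) := by
    have e3 : (8 * η * σ) ^ 2 * (σ⁻¹ * (volume D).toReal) =
        64 * η ^ 2 * (σ * (volume D).toReal) := by
      field_simp
      ring
    rw [e3, hη, div_pow, mul_pow, hsq]
    ring
  rw [e1, e2] at h3
  have h4 := le_of_mul_le_mul_right h3 (by positivity)
  have h5 : 0 < lam * κ ^ 2 := by positivity
  linarith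

/-- A convex set in a finite-dimensional inner product space has a supporting hyperplane through
every point that is not interior to it. -/
lemma Convex.exists_inner_sub_nonpos {E : Type*} [NormedAddCommGroup E] [InnerProductSpace ℝ E]
    [FiniteDimensional ℝ E] {K : Set E} (hK : Convex ℝ K) {x : E} (hx : x ∈ K)
    (hxi : x ∉ interior K) : ∃ ν : E, ν ≠ 0 ∧ ∀ y ∈ K, ⟪ν, y - x⟫ ≤ 0 := by
  by_cases hint : (interior K).Nonempty
  · obtain ⟨f, hf, hfK⟩ := geometric_hahn_banach_of_nonempty_interior_point hK hxi hint
    refine ⟨(InnerProductSpace.toDual ℝ E).symm f, by simpa using hf, fun y hy => ?_⟩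
    rw [InnerProductSpace.toDual_symm_apply, map_sub]
    linarith [hfK y hy]
  · have hspan : affineSpan ℝ K ≠ ⊤ :=
      fun h => hint (hK.interior_nonempty_iff_affineSpan_eq_top.2 h)
    have hdir : vectorSpan ℝ K ≠ ⊤ := fun h =>
      hspan ((AffineSubspace.affineSpan_eq_top_iff_vectorSpan_eq_top_of_nonempty ℝ E E ⟨x, hx⟩).2 h)
    have hperp : (vectorSpan ℝ K)ᗮ ≠ ⊥ := fun h => hdir (Submodule.orthogonal_eq_bot_iff.1 h)
    obtain ⟨ν, hν, hν0⟩ := Submodule.exists_mem_ne_zero_of_ne_bot hperp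
    refine ⟨ν, hν0, fun y hy => le_of_eq ?_⟩
    exact (Submodule.mem_orthogonal' _ _).1 hν _ (vsub_mem_vectorSpan ℝ hy hx)

lemma GenSol.convex_coin {n : ℕ} {q lam Lam : ℝ} {Ω : Set (EuclideanSpace ℝ (Fin n))}
    {v : EuclideanSpace ℝ (Fin n) → ℝ} (hv : GenSol n q lam Lam Ω v) : Convex ℝ (coin Ω v) := by
  have h : coin Ω v = {x ∈ Ω | v x ≤ 0} := by
    ext x
    exact and_congr_right fun hx => ⟨le_of_eq, fun h => le_antisymm h (hv.2.2.1 x hx)⟩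
  rw [h]
  exact hv.2.1.convex_le 0

lemma GenSol.mem_coin_of_mem_closure {n : ℕ} {q lam Lam : ℝ}
    {Ω : Set (EuclideanSpace ℝ (Fin n))} {v : EuclideanSpace ℝ (Fin n) → ℝ}
    (hv : GenSol n q lam Lam Ω v) {x : EuclideanSpace ℝ (Fin n)} (hx : x ∈ Ω)
    (hxK : x ∈ closure (coin Ω v)) : x ∈ coin Ω v := by
  have hcont : ContinuousWithinAt v (coin Ω v) x := (hv.1 x hx).mono fun y hy => hy.1
  have h := hcont.mem_closure_image hxK
  have himg : v '' coin Ω v ⊆ {0} := by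
    rintro _ ⟨y, hy, rfl⟩
    exact hy.2
  exact ⟨hx, by simpa using closure_mono himg h⟩

/-- **Absence of the non-strictly convex part of the free boundary** (Proposition 2.13):
if `Ω = ℝⁿ`, or `Ω` is bounded and `v` extends continuously to `Ω̄` with `v > 0` on `∂Ω`,
or `n = 2` and `q = 0`, then every point of `Ω ∩ ∂K` is an exposed point of `K`. -/
theorem free_boundary_all_exposed
    (n : ℕ) (hn : 2 ≤ n) (q lam Lam : ℝ)
    (hq0 : 0 ≤ q) (hqn : q < n) (hlam : 0 < lam) (hlL : lam ≤ Lam)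
    (Ω : Set (EuclideanSpace ℝ (Fin n))) (hΩo : IsOpen Ω) (hΩc : Convex ℝ Ω)
    (v : EuclideanSpace ℝ (Fin n) → ℝ) (hv : GenSol n q lam Lam Ω v)
    (hcase :
      (Ω = Set.univ) ∨
      (Bornology.IsBounded Ω ∧
        ∃ vbar : EuclideanSpace ℝ (Fin n) → ℝ,
          ContinuousOn vbar (closure Ω) ∧ (∀ x ∈ Ω, vbar x = v x) ∧
          ∀ x ∈ frontier Ω, 0 < vbar x) ∨
      (n = 2 ∧ q = 0)) :
    ∀ x ∈ Ω ∩ frontier (coin Ω v), x ∈ Set.exposedPoints ℝ (coin Ω v) := by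

  rintro x ⟨hxΩ, hxK⟩
  have hK := hv.convex_coin
  have hxmem := hv.mem_coin_of_mem_closure hxΩ hxK.1
  obtain ⟨ν, hν, hνK⟩ := hK.exists_inner_sub_nonpos hxmem hxK.2
  refine ⟨hxmem, InnerProductSpace.toDual ℝ _ ν, fun y hy => ?_⟩
  have hyx := hνK y hy
  rw [InnerProductSpace.toDual_apply_apply, InnerProductSpace.toDual_apply_apply]
  rw [inner_sub_right] at hyx
  refine ⟨by linarith, fun hle => ?_⟩
  by_contra hne
  set e : EuclideanSpace ℝ (Fin n) := (1 / 2 : ℝ) • (y - x) with he_def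
  have he : e ≠ 0 := smul_ne_zero (by norm_num) (sub_ne_zero.2 hne)
  have hνe : ⟪ν, e⟫ = 0 := by
    rw [he_def, inner_smul_right, inner_sub_right]
    linarith
  have hadd : x + e + e = y := by
    rw [he_def]
    module
  have hsub : x + e - e = x := add_sub_cancel_right x e
  have hmid : x + e ∈ coin Ω v := by
    have h : x + e = (1 / 2 : ℝ) • x + (1 / 2 : ℝ) • y := by
      rw [he_def]
      module
    rw [h]
    exact hK hxmem hy (by norm_num) (by norm_num) (by norm_num)
  have hpos : ∀ z ∈ Ω, 0 < ⟪ν, z - (x + e)⟫ → 0 < v z := by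
    intro z hz hνz
    refine (hv.2.2.1 z hz).lt_of_ne fun h0 => ?_
    have h := hνK z ⟨hz, h0.symm⟩
    rw [← sub_sub, inner_sub_right, hνe, sub_zero] at hνz
    exact h.not_gt hνz
  have hy0 : x + e + e ∈ coin Ω v := hadd.symm ▸ hy
  have hx0 : x + e - e ∈ coin Ω v := hsub.symm ▸ hxmem
  have hLam : 0 ≤ Lam := hlam.le.trans hlL
  rcases hcase with rfl | ⟨hΩb, vbar, hvbar, heq, hfr⟩ | ⟨rfl, rfl⟩
  · exact hv.false_of_segment_univ hq0 hqn hlam hLam hν (fun z => hpos z (mem_univ z))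
      hmid.2 he hy0.2 hx0.2
  · exact hv.false_of_segment_bounded hq0 hqn hlam hLam hΩo hΩb hvbar heq hfr hν hpos
      hmid.1 hmid.2 he hy0.1 hy0.2 hx0.1 hx0.2
  · have hνpos : 0 < ‖ν‖⁻¹ := inv_pos.2 (norm_pos_iff.2 hν)
    refine hv.false_of_segment_plane (ν := ‖ν‖⁻¹ • ν) hlam hΩo ?_ ?_ ?_
      hmid.1 hmid.2 he hy0.1 hy0.2 hx0.1 hx0.2
    · rw [norm_smul, norm_inv, norm_norm, inv_mul_cancel₀ (norm_ne_zero_iff.2 hν)]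
    · rw [real_inner_smul_left, hνe, mul_zero]
    · intro z hz hνz
      rw [real_inner_smul_left] at hνz
      exact hpos z hz (pos_of_mul_pos_right hνz hνpos.le)
end
end

section
/- Let n ≥ 2, 0 < λ ≤ Λ, q ∈ [0,n), and let v be a generalized solution of λ v^q χ_{{v>0}} ≤ det D²v ≤ Λ v^q χ_{{v>0}} in an open convex set Ω ⊆ ℝⁿ, with coincidence set K := {x ∈ Ω : v(x)=0}. Then v is differentiable at every point x₀ ∈ Ω that is an exposed point of K (and necessarily ∇v(x₀) = 0 at such points). -/
open MeasureTheory Set Metric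
open scoped RealInnerProductSpace

noncomputable section

/-- Among the simplices with one vertex at the origin and the others in a compact neighbourhood `C`
of the origin, one of largest volume gives a basis in which `C` lies in the unit cube. -/
lemma exists_maximal_simplex {n : ℕ} {C : Set (EuclideanSpace ℝ (Fin n))} (hC : IsCompact C)
    (h0 : C ∈ nhds 0) :
    ∃ b : Fin n → EuclideanSpace ℝ (Fin n), (∀ i, b i ∈ C) ∧
      (Matrix.of fun i j => b i j).det ≠ 0 ∧
      ∀ x ∈ C, ∃ t : Fin n → ℝ, (∀ i, |t i| ≤ 1) ∧ x = ∑ i, t i • b i := by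
  have h00 : (0 : EuclideanSpace ℝ (Fin n)) ∈ C := mem_of_mem_nhds h0
  have hcomp : IsCompact (Set.univ.pi fun _ : Fin n => C) := isCompact_univ_pi fun _ => hC
  have hcont : Continuous fun b : Fin n → EuclideanSpace ℝ (Fin n) =>
      |(Matrix.of fun i j => b i j).det| := by
    refine continuous_abs.comp (Continuous.matrix_det ?_)
    refine continuous_matrix fun i j => ?_
    simp only [Matrix.of_apply]
    fun_prop
  obtain ⟨b, hb, hmax⟩ := hcomp.exists_isMaxOn ⟨fun _ => 0, fun _ _ => h00⟩ hcont.continuousOn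
  have hbC : ∀ i, b i ∈ C := fun i => hb i (Set.mem_univ i)
  have hdet : (Matrix.of fun i j => b i j).det ≠ 0 := by
    obtain ⟨r, hr, hball⟩ := Metric.mem_nhds_iff.1 h0
    have hmem : (fun i => (r / 2) • EuclideanSpace.single i (1 : ℝ)) ∈
        Set.univ.pi fun _ : Fin n => C := by
      intro i _
      apply hball
      simp [norm_smul, abs_of_pos hr]
      linarith
    have h1 := isMaxOn_iff.1 hmax _ hmem
    have h2 : (Matrix.of fun i j : Fin n =>
        ((r / 2) • EuclideanSpace.single i (1 : ℝ) : EuclideanSpace ℝ (Fin n)) j)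
          = (r / 2) • (1 : Matrix (Fin n) (Fin n) ℝ) := by
      ext i j
      simp [Matrix.one_apply, eq_comm]
    rw [h2, Matrix.det_smul, Matrix.det_one, mul_one] at h1
    intro h3
    rw [h3, abs_zero] at h1
    have : 0 < |(r / 2) ^ Fintype.card (Fin n)| := abs_pos.2 (by positivity)
    linarith
  refine ⟨b, hbC, hdet, fun x hx => ?_⟩
  set M : Matrix (Fin n) (Fin n) ℝ := Matrix.of fun i j => b i j with hM
  refine ⟨fun i => M.transpose.cramer x i / M.det, fun i => ?_, ?_⟩
  · rw [abs_div, div_le_one (abs_pos.2 hdet), Matrix.cramer_transpose_apply]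
    have hmem : Function.update b i x ∈ Set.univ.pi fun _ : Fin n => C := by
      intro j _
      rcases eq_or_ne j i with rfl | hji
      · simpa using hx
      · simpa [hji] using hbC j
    have h1 := isMaxOn_iff.1 hmax _ hmem
    have hMup : M.updateRow i x.ofLp = Matrix.of fun j k => Function.update b i x j k := by
      ext j k
      rcases eq_or_ne j i with rfl | hji
      · simp
      · simp [hji, hM]
    rwa [hMup]
  · have h1 := Matrix.mulVec_cramer M.transpose x.ofLp
    rw [Matrix.det_transpose] at h1
    ext j
    have h2 := congrFun h1 j
    simp only [Matrix.mulVec, dotProduct, Matrix.transpose_apply, Pi.smul_apply,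
      smul_eq_mul] at h2
    simp only [WithLp.ofLp_sum, WithLp.ofLp_smul, Finset.sum_apply, Pi.smul_apply, smul_eq_mul]
    rw [eq_comm, ← mul_right_inj' hdet, ← h2, Finset.mul_sum]
    refine Finset.sum_congr rfl fun i _ => ?_
    rw [show M i j = b i j from rfl]
    field_simp

lemma sum_smul_mem_of_zero_mem {n : ℕ} {C : Set (EuclideanSpace ℝ (Fin n))} (hC : Convex ℝ C)
    (h0 : (0 : EuclideanSpace ℝ (Fin n)) ∈ C) {b : Fin n → EuclideanSpace ℝ (Fin n)}
    (hb : ∀ i, b i ∈ C) {t : Fin n → ℝ} (ht : ∀ i, 0 ≤ t i) (ht1 : ∑ i, t i ≤ 1) :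
    ∑ i, t i • b i ∈ C := by
  rcases (Finset.sum_nonneg fun i (_ : i ∈ Finset.univ) => ht i).eq_or_lt' with h | h
  · have : ∀ i, t i = 0 := fun i =>
      (Finset.sum_eq_zero_iff_of_nonneg fun i _ => ht i).1 h i (Finset.mem_univ i)
    simpa [this] using h0
  · have h1 : ∑ i, (t i / ∑ j, t j) • b i ∈ C := by
      refine hC.sum_mem (fun i _ => div_nonneg (ht i) h.le) ?_ fun i _ => hb i
      rw [← Finset.sum_div, div_self h.ne']
    have h2 := hC h0 h1 (a := 1 - ∑ j, t j) (b := ∑ j, t j) (by linarith) h.le (by ring)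
    rw [smul_zero, zero_add, Finset.smul_sum] at h2
    convert h2 using 2 with i
    rw [smul_smul, mul_div_cancel₀ _ h.ne']

lemma volume_image_toLp {n : ℕ} (Q : Set (Fin n → ℝ)) :
    volume (WithLp.toLp 2 '' Q : Set (EuclideanSpace ℝ (Fin n))) = volume Q := by
  have h := (PiLp.volume_preserving_ofLp (Fin n)).measure_preimage_equiv
    (f := (MeasurableEquiv.toLp 2 (Fin n → ℝ)).symm) Q
  rw [← h]
  congr 1
  ext x
  constructor
  · rintro ⟨y, hy, rfl⟩
    exact hy
  · intro hx
    exact ⟨x.ofLp, hx, rfl⟩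

/-- The volume of the image of a set of coordinate vectors under `t ↦ ∑ tᵢ bᵢ`. -/
lemma volume_image_sum_smul {n : ℕ} (b : Fin n → EuclideanSpace ℝ (Fin n))
    (Q : Set (Fin n → ℝ)) :
    volume ((fun t : Fin n → ℝ => ∑ i, t i • b i) '' Q) =
      ENNReal.ofReal |(Matrix.of fun i j => b i j).det| * volume Q := by
  have h := Measure.addHaar_image_linearMap volume
    (Matrix.toLin' (Matrix.of fun i j => b i j).transpose) Q
  rw [LinearMap.det_toLin', Matrix.det_transpose] at h
  rw [← h, ← volume_image_toLp, Set.image_image]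
  congr 1
  refine Set.image_congr' fun t => ?_
  ext j
  simp [Matrix.mulVec, dotProduct, mul_comm]

/-- The volume of the set of vectors whose inner products against a basis lie in a given set. -/
lemma volume_setOf_inner_mem {n : ℕ} (b : Fin n → EuclideanSpace ℝ (Fin n))
    (hb : (Matrix.of fun i j => b i j).det ≠ 0) (Q : Set (Fin n → ℝ)) :
    volume {y : EuclideanSpace ℝ (Fin n) | (fun i => ⟪y, b i⟫) ∈ Q} =
      ENNReal.ofReal |(Matrix.of fun i j => b i j).det|⁻¹ * volume Q := by
  have h := Measure.addHaar_preimage_linearMap volume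
    (f := Matrix.toLin' (Matrix.of fun i j => b i j)) (by rwa [LinearMap.det_toLin']) Q
  rw [LinearMap.det_toLin', abs_inv] at h
  rw [← h, ← volume_image_toLp]
  congr 1
  have key : ∀ y : EuclideanSpace ℝ (Fin n),
      (fun i => ⟪y, b i⟫) = Matrix.toLin' (Matrix.of fun i j => b i j) y.ofLp := by
    intro y
    ext i
    simp [Matrix.mulVec, dotProduct, PiLp.inner_apply]
  ext y
  rw [Set.mem_ofPred_eq, key]
  constructor
  · intro hy
    exact ⟨y.ofLp, hy, rfl⟩
  · rintro ⟨z, hz, rfl⟩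
    exact hz

/-- Upper bound for the squared volume of a section `C` of `v` on which `v` reaches the size `G`,
coming from the lower Monge-Ampère bound. -/
lemma det_le_of_lower_bound {n : ℕ} (hn : 0 < n) {q lam : ℝ} (hq0 : 0 ≤ q)
    {Ω : Set (EuclideanSpace ℝ (Fin n))} {v : EuclideanSpace ℝ (Fin n) → ℝ}
    (hlower : ∀ E : Set (EuclideanSpace ℝ (Fin n)), MeasurableSet E → E ⊆ Ω →
      ENNReal.ofReal lam * ∫⁻ x in E ∩ {x | 0 < v x}, ENNReal.ofReal (v x ^ q) ≤
        volume (subgradImg Ω v (E ∩ {x | 0 < v x})))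
    {x₀ P p z : EuclideanSpace ℝ (Fin n)} {C : Set (EuclideanSpace ℝ (Fin n))} {h G : ℝ}
    (hlam : 0 < lam) (hh : 0 < h) (hG : 8 * h ≤ G)
    (hCΩ : ∀ u ∈ C, x₀ + u ∈ Ω) (hC : Convex ℝ C) (h0 : (0 : EuclideanSpace ℝ (Fin n)) ∈ C)
    (hle : ∀ u ∈ C, v (x₀ + u) ≤ ⟪P, u⟫ + h) (hge : ∀ u ∈ C, ⟪P, u⟫ - h ≤ v (x₀ + u))
    (hpv : ∀ u ∈ C, ⟪p, u⟫ ≤ v (x₀ + u)) (hp : ∀ u ∈ C, -(4 * h) ≤ ⟪p, u⟫)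
    (hz : z ∈ C) (hpz : ⟪p, z⟫ = G)
    {b : Fin n → EuclideanSpace ℝ (Fin n)} (hb : ∀ i, b i ∈ C)
    (hdet : (Matrix.of fun i j => b i j).det ≠ 0) :
    lam * ((G / 4) ^ q * (|(Matrix.of fun i j => b i j).det| * (1 / (4 * n)) ^ n)) ≤
      |(Matrix.of fun i j => b i j).det|⁻¹ * (32 * n * h) ^ n := by
  have hn' : (0 : ℝ) < n := Nat.cast_pos.2 hn
  set d := |(Matrix.of fun i j => b i j).det| with hd
  have hdpos : 0 < d := abs_pos.2 hdet
  set Q : Set (Fin n → ℝ) := Set.Icc (fun _ => 1 / (8 * n)) (fun _ => 3 / (8 * n)) with hQ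
  set T : (Fin n → ℝ) → EuclideanSpace ℝ (Fin n) := fun t => ∑ i, t i • b i with hT
  have hTC : ∀ t : Fin n → ℝ, (∀ i, 0 ≤ t i) → (∀ i, t i ≤ 3 / (8 * n)) →
      ∀ s : ℝ, -(1 / (8 * n)) ≤ s → s ≤ 1 / (8 * n) → ∀ i, 0 ≤ t i + s →
      ((1 / 2 : ℝ) • z + T t) + s • b i ∈ C := by
    intro t ht0 ht1 s hs0 hs1 i hi
    have h1 : ∑ j, (2 * t j + Pi.single (M := fun _ => ℝ) i (2 * s) j) • b j ∈ C := by
      refine sum_smul_mem_of_zero_mem hC h0 hb (fun j => ?_) ?_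
      · rcases eq_or_ne j i with rfl | hji
        · simp only [Pi.single_eq_same]; linarith
        · simp only [Pi.single_eq_of_ne hji]; linarith [ht0 j]
      · rw [Finset.sum_add_distrib, Finset.sum_pi_single']
        simp only [Finset.mem_univ, if_true]
        have h2 : ∑ j, 2 * t j ≤ ∑ _j : Fin n, 2 * (3 / (8 * (n : ℝ))) :=
          Finset.sum_le_sum fun j _ => by linarith [ht1 j]
        rw [Finset.sum_const, Finset.card_univ, Fintype.card_fin, nsmul_eq_mul] at h2
        have h3 : (n : ℝ) * (2 * (3 / (8 * n))) = 3 / 4 := by field_simp; norm_num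
        have h4 : 1 / (8 * (n : ℝ)) ≤ 1 / 8 := by
          have : (1 : ℝ) ≤ n := Nat.one_le_cast.2 hn
          apply one_div_le_one_div_of_le <;> linarith
        linarith
    have h2 := hC hz h1 (a := 1 / 2) (b := 1 / 2) (by norm_num) (by norm_num) (by norm_num)
    convert h2 using 1
    rw [add_assoc]
    congr 1
    simp only [hT, add_smul, Finset.sum_add_distrib, smul_add, Finset.smul_sum, smul_smul]
    congr 1
    · exact Finset.sum_congr rfl fun j _ => by ring_nf
    · rw [Finset.sum_eq_single i]
      · simp
      · intro j _ hji
        simp [hji]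
      · simp
  have hQ0 : ∀ t ∈ Q, ∀ i, 1 / (8 * (n : ℝ)) ≤ t i := fun t ht i => ht.1 i
  have hQ1 : ∀ t ∈ Q, ∀ i, t i ≤ 3 / (8 * (n : ℝ)) := fun t ht i => ht.2 i
  have h8 : (0 : ℝ) < 1 / (8 * n) := by positivity
  have hmem : ∀ t ∈ Q, (1 / 2 : ℝ) • z + T t ∈ C := by
    intro t ht
    have := hTC t (fun i => h8.le.trans (hQ0 t ht i)) (hQ1 t ht) 0 (by linarith) h8.le ⟨0, hn⟩
      (by linarith [hQ0 t ht ⟨0, hn⟩])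
    simpa using this
  set E : Set (EuclideanSpace ℝ (Fin n)) := (fun y => (x₀ + (1 / 2 : ℝ) • z) + y) '' (T '' Q) with hE
  have hTcont : Continuous T := by fun_prop
  have hEmeas : MeasurableSet E :=
    ((isCompact_Icc.image hTcont).image (by fun_prop)).measurableSet
  have hEΩ : E ⊆ Ω := by
    rintro _ ⟨_, ⟨t, ht, rfl⟩, rfl⟩
    simpa only [add_assoc] using hCΩ _ (hmem t ht)
  have hEv : ∀ x ∈ E, G / 4 ≤ v x := by
    rintro _ ⟨_, ⟨t, ht, rfl⟩, rfl⟩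
    have h1 := hpv _ (hmem t ht)
    have h2 : T (fun i => 2 * t i) ∈ C := by
      refine sum_smul_mem_of_zero_mem hC h0 hb (fun j => ?_) ?_
      · linarith [hQ0 t ht j]
      · have h2 : ∑ j, 2 * t j ≤ ∑ _j : Fin n, 2 * (3 / (8 * (n : ℝ))) :=
          Finset.sum_le_sum fun j _ => by linarith [hQ1 t ht j]
        rw [Finset.sum_const, Finset.card_univ, Fintype.card_fin, nsmul_eq_mul] at h2
        have h3 : (n : ℝ) * (2 * (3 / (8 * n))) = 3 / 4 := by field_simp; norm_num
        linarith
    have h3 : T (fun i => 2 * t i) = (2 : ℝ) • T t := by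
      simp [hT, Finset.smul_sum, smul_smul]
    have h4 := hp _ h2
    rw [h3, inner_smul_right] at h4
    rw [inner_add_right, inner_smul_right, hpz] at h1
    simp only [add_assoc]
    linarith
  have hGpos : 0 < G := by linarith
  have hEpos : E ∩ {x | 0 < v x} = E :=
    Set.inter_eq_left.2 fun x hx => lt_of_lt_of_le (by linarith) (hEv x hx)
  have hvolE : volume E = ENNReal.ofReal (d * (1 / (4 * n)) ^ n) := by
    rw [hE, Set.image_add_left, measure_preimage_add, volume_image_sum_smul, hQ,
      Real.volume_Icc_pi, Finset.prod_const, Finset.card_univ, Fintype.card_fin,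
      ← ENNReal.ofReal_pow, ← ENNReal.ofReal_mul hdpos.le]
    · congr 3
      field_simp
      norm_num
    · rw [← sub_div]; positivity
  have hsub : subgradImg Ω v E ⊆ (fun y => -P + y) ⁻¹'
      {y | (fun i => ⟪y, b i⟫) ∈ Set.Icc (fun _ => -(16 * n * h)) (fun _ => 16 * n * h)} := by
    intro y hy
    simp only [subgradImg, Set.mem_iUnion] at hy
    obtain ⟨_, ⟨_, ⟨t, ht, rfl⟩, rfl⟩, hy⟩ := hy
    have key : ∀ s : ℝ, -(1 / (8 * n)) ≤ s → s ≤ 1 / (8 * n) → ∀ i,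
        s * ⟪-P + y, b i⟫ ≤ 2 * h := by
      intro s hs0 hs1 i
      have h1 := hTC t (fun i => h8.le.trans (hQ0 t ht i)) (hQ1 t ht) s hs0 hs1 i
        (by linarith [hQ0 t ht i])
      have h2 := hy _ (hCΩ _ h1)
      have h3 := hle _ h1
      have h4 := hge _ (hmem t ht)
      have h5 : x₀ + ((1 / 2 : ℝ) • z + (T t + s • b i)) - (x₀ + ((1 / 2 : ℝ) • z + T t)) =
          s • b i := by abel
      simp only [add_assoc] at h2
      rw [h5] at h2
      simp only [add_assoc] at h3
      rw [inner_smul_right] at h2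
      have h6 : ⟪P, (1 / 2 : ℝ) • z + (T t + s • b i)⟫ =
          ⟪P, (1 / 2 : ℝ) • z + T t⟫ + s * ⟪P, b i⟫ := by
        rw [← add_assoc, inner_add_right _ _ (s • b i), inner_smul_right]
      rw [inner_add_left, inner_neg_left]
      linarith
    constructor <;> intro i
    · have := key (-(1 / (8 * n))) le_rfl (by linarith) i
      field_simp at this
      simp only
      linarith
    · have := key (1 / (8 * n)) (by linarith) le_rfl i
      field_simp at this
      simp only
      linarith
  have hvol := measure_mono (μ := volume) hsub
  rw [measure_preimage_add, volume_setOf_inner_mem b hdet, Real.volume_Icc_pi, Finset.prod_const,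
    Finset.card_univ, Fintype.card_fin, ← ENNReal.ofReal_pow (by ring_nf; positivity),
    ← ENNReal.ofReal_mul (by positivity)] at hvol
  have hlow := hlower E hEmeas hEΩ
  rw [hEpos] at hlow
  have hint : ENNReal.ofReal ((G / 4) ^ q) * volume E ≤ ∫⁻ x in E, ENNReal.ofReal (v x ^ q) := by
    rw [← setLIntegral_const]
    exact setLIntegral_mono' hEmeas fun x hx => ENNReal.ofReal_le_ofReal
      (Real.rpow_le_rpow (by linarith) (hEv x hx) hq0)
  rw [hvolE, ← ENNReal.ofReal_mul (by positivity)] at hint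
  have hfin := ((mul_le_mul_right hint _).trans hlow).trans hvol
  rw [← ENNReal.ofReal_mul hlam.le, ENNReal.ofReal_le_ofReal_iff (by ring_nf; positivity)] at hfin
  convert hfin using 3
  ring

/-- Lower bound for the squared volume of a section `C` of `v` in which the origin is close to the
boundary in the direction `-p`, coming from the upper Monge-Ampère bound. -/
lemma le_det_of_upper_bound {n : ℕ} (hn : 0 < n) {q Lam : ℝ} (hq0 : 0 ≤ q) (hLam : 0 < Lam)
    {Ω : Set (EuclideanSpace ℝ (Fin n))} {v : EuclideanSpace ℝ (Fin n) → ℝ}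
    (hvc : ContinuousOn v Ω) (hv : ConvexOn ℝ Ω v)
    (hupper : ∀ E : Set (EuclideanSpace ℝ (Fin n)), MeasurableSet E → E ⊆ Ω →
      volume (subgradImg Ω v E) ≤
        ENNReal.ofReal Lam * ∫⁻ x in E ∩ {x | 0 < v x}, ENNReal.ofReal (v x ^ q))
    {x₀ P p z : EuclideanSpace ℝ (Fin n)} {C : Set (EuclideanSpace ℝ (Fin n))} {h G : ℝ}
    (hh : 0 < h) (hG : 0 < G) (hv0 : v x₀ = 0)
    (hCΩ : ∀ u ∈ C, x₀ + u ∈ Ω) (hC : IsCompact C) (h0 : (0 : EuclideanSpace ℝ (Fin n)) ∈ C)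
    (hint : ∀ u ∈ C, v (x₀ + u) < ⟪P, u⟫ + h → C ∈ nhds u)
    (hvG : ∀ u ∈ C, v (x₀ + u) ≤ 16 * G) (hp : ∀ u ∈ C, -(4 * h) ≤ ⟪p, u⟫)
    (hz : z ∈ C) (hpz : ⟪p, z⟫ = G)
    {b : Fin n → EuclideanSpace ℝ (Fin n)}
    (hdet : (Matrix.of fun i j => b i j).det ≠ 0)
    (hrep : ∀ x ∈ C, ∃ t : Fin n → ℝ, (∀ i, |t i| ≤ 1) ∧ x = ∑ i, t i • b i) :
    |(Matrix.of fun i j => b i j).det|⁻¹ * (G / (4 * h) * (h / (4 * n)) ^ n) ≤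
      Lam * ((16 * G) ^ q * (|(Matrix.of fun i j => b i j).det| * 2 ^ n)) := by
  have hn' : (0 : ℝ) < n := Nat.cast_pos.2 hn
  set d := |(Matrix.of fun i j => b i j).det| with hd
  have hdpos : 0 < d := abs_pos.2 hdet
  set E : Set (EuclideanSpace ℝ (Fin n)) := (fun y => x₀ + y) '' C with hE
  have hEmeas : MeasurableSet E := (hC.image (by fun_prop)).measurableSet
  have hEΩ : E ⊆ Ω := by
    rintro _ ⟨u, hu, rfl⟩
    exact hCΩ u hu
  have hvolE : volume E ≤ ENNReal.ofReal (d * 2 ^ n) := by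
    rw [hE, Set.image_add_left, measure_preimage_add]
    have hsub : C ⊆ (fun t : Fin n → ℝ => ∑ i, t i • b i) ''
        Set.Icc (fun _ => -1) (fun _ => 1) := by
      intro x hx
      obtain ⟨t, ht, rfl⟩ := hrep x hx
      exact ⟨t, ⟨fun i => (abs_le.1 (ht i)).1, fun i => (abs_le.1 (ht i)).2⟩, rfl⟩
    refine (measure_mono hsub).trans_eq ?_
    rw [volume_image_sum_smul, Real.volume_Icc_pi, Finset.prod_const,
      Finset.card_univ, Fintype.card_fin, ← ENNReal.ofReal_pow (by norm_num),
      ← ENNReal.ofReal_mul hdpos.le]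
    norm_num [hd]
  obtain ⟨i, hi⟩ : ∃ i, G / n ≤ |⟪p, b i⟫| := by
    by_contra! hcon
    obtain ⟨t, ht, hzt⟩ := hrep z hz
    rw [hzt, inner_sum] at hpz
    have h1 : ∑ i, ⟪p, t i • b i⟫ < ∑ _i : Fin n, G / n := by
      refine Finset.sum_lt_sum_of_nonempty ⟨⟨0, hn⟩, Finset.mem_univ _⟩ fun i _ => ?_
      rw [inner_smul_right]
      refine (le_abs_self _).trans_lt ?_
      rw [abs_mul]
      have := mul_le_mul_of_nonneg_right (ht i) (abs_nonneg ⟪p, b i⟫)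
      linarith [hcon i]
    rw [hpz, Finset.sum_const, Finset.card_univ, Fintype.card_fin, nsmul_eq_mul,
      mul_div_cancel₀ _ hn'.ne'] at h1
    exact lt_irrefl _ h1
  set κ : ℝ := n / (4 * h) with hκ
  have hκpos : 0 < κ := by positivity
  set B : Matrix (Fin n) (Fin n) ℝ :=
    (1 : Matrix (Fin n) (Fin n) ℝ).updateRow i (fun j => -κ * ⟪p, b j⟫) with hB
  have hBdet : B.det = -κ * ⟪p, b i⟫ := by
    rw [hB, ← Matrix.cramer_transpose_apply, Matrix.transpose_one, Matrix.cramer_one]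
    rfl
  have hBmul : ∀ (c : Fin n → ℝ) (j : Fin n), Matrix.toLin' B.transpose c j =
      Function.update c i 0 j - κ * c i * ⟪p, b j⟫ := by
    intro c j
    have h1 : ∀ k, B k j * c k = (if k = j then Function.update c i 0 j else 0) +
        if k = i then -κ * ⟪p, b j⟫ * c i else 0 := by
      intro k
      rcases eq_or_ne k i with rfl | hki
      · rcases eq_or_ne k j with rfl | hkj
        · simp [hB]
        · simp [hB, hkj]
      · rcases eq_or_ne k j with rfl | hkj
        · simp [hB, hki]
        · simp [hB, hki, hkj]
    rw [Matrix.toLin'_apply]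
    simp only [Matrix.mulVec, dotProduct, Matrix.transpose_apply, h1, Finset.sum_add_distrib,
      Finset.sum_ite_eq', Finset.mem_univ, if_true]
    ring
  set Q : Set (Fin n → ℝ) := Set.Icc (fun _ => 0) (fun _ => h / (4 * n)) with hQ
  set Y : Set (EuclideanSpace ℝ (Fin n)) :=
    {y | (fun j => ⟪y, b j⟫) ∈ Matrix.toLin' B.transpose '' Q} with hY
  have hYlt : ∀ y ∈ Y, ∀ x ∈ C, ⟪y, x⟫ < h := by
    rintro y ⟨c, hc, hcy⟩ x hx
    obtain ⟨t, ht, hxt⟩ := hrep x hx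
    have h1 : ∀ j, ⟪y, b j⟫ = Function.update c i 0 j - κ * c i * ⟪p, b j⟫ := fun j => by
      rw [← hBmul]; exact (congrFun hcy j).symm
    have h2 : ⟪y, x⟫ = ∑ j, t j * Function.update c i 0 j - κ * c i * ⟪p, x⟫ := by
      rw [hxt, inner_sum, inner_sum, Finset.mul_sum, ← Finset.sum_sub_distrib]
      refine Finset.sum_congr rfl fun j _ => ?_
      rw [inner_smul_right, inner_smul_right, h1]
      ring
    have h3 : ∑ j, t j * Function.update c i 0 j ≤ ∑ _j : Fin n, h / (4 * n) := by
      refine Finset.sum_le_sum fun j _ => ?_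
      have h4 : 0 ≤ Function.update c i 0 j ∧ Function.update c i 0 j ≤ h / (4 * n) := by
        rcases eq_or_ne j i with rfl | hji
        · simp only [Function.update_self]; constructor <;> positivity
        · simp only [Function.update_of_ne hji]; exact ⟨hc.1 j, hc.2 j⟩
      have h5 := (abs_le.1 (ht j)).2
      nlinarith
    rw [Finset.sum_const, Finset.card_univ, Fintype.card_fin, nsmul_eq_mul] at h3
    have h4 : (n : ℝ) * (h / (4 * n)) = h / 4 := by field_simp
    have h5 : κ * c i ≤ 1 / 16 := by
      calc κ * c i ≤ κ * (h / (4 * n)) := mul_le_mul_of_nonneg_left (hc.2 i) hκpos.le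
        _ = 1 / 16 := by rw [hκ]; field_simp; norm_num
    have h6 : 0 ≤ κ * c i := mul_nonneg hκpos.le (hc.1 i)
    have h7 := hp x hx
    nlinarith
  have hYsub : (fun y => P + y) '' Y ⊆ subgradImg Ω v E := by
    rintro _ ⟨y, hy, rfl⟩
    have hcont : ContinuousOn (fun x => v x - ⟪P + y, x⟫) Ω := by
      refine hvc.sub (Continuous.continuousOn ?_)
      fun_prop
    have hconv : ConvexOn ℝ Ω (fun x => v x - ⟪P + y, x⟫) := by
      refine hv.sub ?_
      exact (innerₛₗ ℝ (P + y)).concaveOn hv.1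
    obtain ⟨_, ⟨u, hu, rfl⟩, hmin⟩ := (hC.image (f := fun y => x₀ + y) (by fun_prop)).exists_isMinOn
      ⟨_, ⟨0, h0, rfl⟩⟩ (hcont.mono hEΩ)
    have hmin0 := isMinOn_iff.1 hmin _ ⟨0, h0, rfl⟩
    have hlt : v (x₀ + u) < ⟪P, u⟫ + h := by
      have := hYlt y hy u hu
      simp only [add_zero, hv0, inner_add_right, inner_add_left] at hmin0
      linarith
    have hnhds : E ∈ nhds (x₀ + u) := by
      have h1 := hint u hu hlt
      have := (Homeomorph.addLeft x₀).isOpenMap.image_mem_nhds h1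
      exact this
    have hglob : IsMinOn (fun x => v x - ⟪P + y, x⟫) Ω (x₀ + u) := by
      refine IsMinOn.of_isLocalMinOn_of_convexOn (hCΩ u hu) ?_ hconv
      exact (hmin.isLocalMin hnhds).on Ω
    simp only [subgradImg, Set.mem_iUnion]
    refine ⟨x₀ + u, ⟨u, hu, rfl⟩, fun x hx => ?_⟩
    have := isMinOn_iff.1 hglob x hx
    rw [inner_sub_right]
    linarith
  have hvol := (measure_mono (μ := volume) hYsub).trans (hupper E hEmeas hEΩ)
  rw [Set.image_add_left, measure_preimage_add, volume_setOf_inner_mem b hdet,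
    Measure.addHaar_image_linearMap, LinearMap.det_toLin', Matrix.det_transpose, hBdet,
    Real.volume_Icc_pi, Finset.prod_const, Finset.card_univ, Fintype.card_fin, sub_zero,
    ← ENNReal.ofReal_pow (by positivity), ← ENNReal.ofReal_mul (by positivity),
    ← ENNReal.ofReal_mul (by positivity)] at hvol
  have hupp : ∫⁻ x in E ∩ {x | 0 < v x}, ENNReal.ofReal (v x ^ q) ≤
      ENNReal.ofReal ((16 * G) ^ q) * volume E := by
    calc ∫⁻ x in E ∩ {x | 0 < v x}, ENNReal.ofReal (v x ^ q)
        ≤ ∫⁻ _x in E ∩ {x | 0 < v x}, ENNReal.ofReal ((16 * G) ^ q) := by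
          refine setLIntegral_mono measurable_const ?_
          rintro _ ⟨⟨u, hu, rfl⟩, hpos⟩
          exact ENNReal.ofReal_le_ofReal (Real.rpow_le_rpow (le_of_lt hpos) (hvG u hu) hq0)
      _ = ENNReal.ofReal ((16 * G) ^ q) * volume (E ∩ {x | 0 < v x}) := setLIntegral_const _ _
      _ ≤ _ := by gcongr; exact Set.inter_subset_left
  have hupp' := hupp.trans (mul_le_mul_right hvolE _)
  rw [← ENNReal.ofReal_mul (by positivity)] at hupp'
  have hfin := hvol.trans (mul_le_mul_right hupp' _)
  rw [← ENNReal.ofReal_mul hLam.le, ENNReal.ofReal_le_ofReal_iff (by positivity)] at hfin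
  refine le_trans ?_ hfin
  gcongr
  rw [abs_mul, abs_neg, abs_of_pos hκpos]
  calc G / (4 * h) = κ * (G / n) := by rw [hκ]; field_simp
    _ ≤ _ := by gcongr

/-- A nonnegative convex function which vanishes at `x₀` and has arbitrarily small slopes in every
direction from `x₀` is differentiable at `x₀` with zero derivative. -/
lemma hasFDerivAt_zero_of_small_slopes {n : ℕ} {Ω : Set (EuclideanSpace ℝ (Fin n))}
    (hΩ : IsOpen Ω) {v : EuclideanSpace ℝ (Fin n) → ℝ} (hv : ConvexOn ℝ Ω v)
    (hpos : ∀ x ∈ Ω, 0 ≤ v x) {x₀ : EuclideanSpace ℝ (Fin n)} (hx₀ : x₀ ∈ Ω) (hv0 : v x₀ = 0)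
    (hslope : ∀ e : EuclideanSpace ℝ (Fin n), ∀ c > 0, ∃ s > 0, x₀ + s • e ∈ Ω ∧
      v (x₀ + s • e) ≤ c * s) :
    HasFDerivAt v (0 : EuclideanSpace ℝ (Fin n) →L[ℝ] ℝ) x₀ := by
  rw [hasFDerivAt_iff_isLittleO_nhds_zero, Asymptotics.isLittleO_iff]
  intro c hc
  set c' : ℝ := c / (n + 1) with hc'
  have hc'pos : 0 < c' := by positivity
  set σ : Bool → ℝ := fun β => if β then 1 else -1 with hσ
  choose S hSpos hSΩ hSv using fun (i : Fin n) (β : Bool) =>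
    hslope (σ β • EuclideanSpace.single i (1 : ℝ)) c' hc'pos
  have hev : ∀ᶠ h in nhds (0 : EuclideanSpace ℝ (Fin n)), ∀ i β, |h i| / S i β ≤ 1 / (n + 1) := by
    rw [Filter.eventually_all]
    intro i
    rw [Filter.eventually_all]
    intro β
    have hcont : Continuous fun h : EuclideanSpace ℝ (Fin n) => |h i| / S i β := by fun_prop
    have := hcont.tendsto 0
    simp only [PiLp.zero_apply, abs_zero, zero_div] at this
    exact (this.eventually_lt_const (by positivity)).mono fun _ h => h.le
  have hevΩ : ∀ᶠ h in nhds (0 : EuclideanSpace ℝ (Fin n)), x₀ + h ∈ Ω := by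
    have hcont : Continuous fun h : EuclideanSpace ℝ (Fin n) => x₀ + h := by fun_prop
    exact hcont.continuousAt.eventually_mem (hΩ.mem_nhds (by simpa using hx₀))
  filter_upwards [hev, hevΩ] with h hh hhΩ
  simp only [hv0, _root_.zero_apply, sub_zero]
  rw [Real.norm_of_nonneg (hpos _ hhΩ)]
  set β : Fin n → Bool := fun i => decide (0 ≤ h i) with hβ
  have habs : ∀ i, |h i| * σ (β i) = h i := by
    intro i
    by_cases hi : 0 ≤ h i
    · simp [hσ, hβ, hi, abs_of_nonneg hi]
    · simp [hσ, hβ, hi, abs_of_neg (not_le.1 hi)]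
  set w : Fin n → ℝ := fun i => |h i| / S i (β i) with hw
  have hw1 : ∑ i, w i ≤ 1 := by
    have : ∑ i, w i ≤ ∑ _i : Fin n, 1 / ((n : ℝ) + 1) := Finset.sum_le_sum fun i _ => hh i _
    rw [Finset.sum_const, Finset.card_univ, Fintype.card_fin, nsmul_eq_mul] at this
    refine this.trans ?_
    rw [mul_one_div, div_le_one (by positivity)]
    linarith
  have hJ := hv.map_add_sum_le (t := Finset.univ) (w := w) (v := 1 - ∑ i, w i) (q := x₀)
    (p := fun i => x₀ + S i (β i) • σ (β i) • EuclideanSpace.single i (1 : ℝ))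
    (fun i _ => div_nonneg (abs_nonneg _) (hSpos i _).le) (by ring) (fun i _ => hSΩ i _)
    (by linarith) hx₀
  have hpt : (1 - ∑ i, w i) • x₀ +
      ∑ i, w i • (x₀ + S i (β i) • σ (β i) • EuclideanSpace.single i (1 : ℝ)) = x₀ + h := by
    have h1 : ∀ i, w i • (x₀ + S i (β i) • σ (β i) • EuclideanSpace.single i (1 : ℝ)) =
        w i • x₀ + EuclideanSpace.single i (h i) := by
      intro i
      rw [smul_add, smul_smul, smul_smul, hw]
      simp only
      rw [div_mul_cancel₀ _ (hSpos i _).ne', habs]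
      congr 1
      ext j
      simp
    simp only [h1, Finset.sum_add_distrib]
    rw [← Finset.sum_smul, sub_smul, one_smul, ← add_assoc, sub_add_cancel]
    congr 1
    ext j
    simp [Pi.single_apply]
  rw [hpt, hv0, smul_zero, zero_add] at hJ
  refine hJ.trans ?_
  have hsum : ∑ i, w i • v (x₀ + S i (β i) • σ (β i) • EuclideanSpace.single i (1 : ℝ)) ≤
      ∑ _i : Fin n, c' * ‖h‖ := by
    refine Finset.sum_le_sum fun i _ => ?_
    rw [smul_eq_mul]
    calc w i * v (x₀ + S i (β i) • σ (β i) • EuclideanSpace.single i (1 : ℝ))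
        ≤ w i * (c' * S i (β i)) :=
          mul_le_mul_of_nonneg_left (hSv i _) (div_nonneg (abs_nonneg _) (hSpos i _).le)
      _ = c' * |h i| := by
          have := (hSpos i (β i)).ne'
          rw [hw]; field_simp
      _ ≤ c' * ‖h‖ := by
          gcongr
          exact PiLp.norm_apply_le h i
  refine hsum.trans ?_
  rw [Finset.sum_const, Finset.card_univ, Fintype.card_fin, nsmul_eq_mul, ← mul_assoc]
  gcongr
  rw [hc', ← mul_div_assoc, div_le_iff₀ (by positivity)]
  nlinarith

/-- A convex function vanishing at `x₀` and lying above `D * s` along the ray `x₀ + s e` has a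
subgradient at `x₀` whose component along `e` is at least `D`. -/
lemma exists_subgrad_of_le_on_ray {n : ℕ} {Ω : Set (EuclideanSpace ℝ (Fin n))}
    (hΩ : IsOpen Ω) {v : EuclideanSpace ℝ (Fin n) → ℝ} (hvc : ContinuousOn v Ω)
    (hv : ConvexOn ℝ Ω v) {x₀ e : EuclideanSpace ℝ (Fin n)} (hx₀ : x₀ ∈ Ω) (hv0 : v x₀ = 0)
    {D : ℝ} (hD : ∀ s > 0, x₀ + s • e ∈ Ω → D * s ≤ v (x₀ + s • e)) :
    ∃ p, D ≤ ⟪p, e⟫ ∧ ∀ u, x₀ + u ∈ Ω → ⟪p, u⟫ ≤ v (x₀ + u) := by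
  set A : Set (EuclideanSpace ℝ (Fin n) × ℝ) := {y | y.1 ∈ Ω ∧ v y.1 < y.2} with hA
  have hAo : IsOpen A := by
    have h1 : IsOpen (Ω ×ˢ (Set.univ : Set ℝ)) := hΩ.prod isOpen_univ
    have h2 : ContinuousOn (fun y : EuclideanSpace ℝ (Fin n) × ℝ => y.2 - v y.1)
        (Ω ×ˢ (Set.univ : Set ℝ)) :=
      continuousOn_snd.sub (hvc.comp continuousOn_fst fun y hy => hy.1)
    have h3 := h2.isOpen_inter_preimage h1 (isOpen_Ioi (a := 0))
    convert h3 using 1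
    ext y
    simp [hA]
  have hAc : Convex ℝ A := hv.convex_strict_epigraph
  set R : Set (EuclideanSpace ℝ (Fin n) × ℝ) :=
    (fun s : ℝ => (x₀, (0 : ℝ)) + s • (e, D)) '' Set.Ici 0 with hR
  have hRc : Convex ℝ R := by
    have := ((convex_Ici (𝕜 := ℝ) (0 : ℝ)).is_linear_image
      (f := fun s : ℝ => s • (e, D))
      ⟨fun _ _ => add_smul _ _ _, fun (a s : ℝ) => smul_assoc a s (e, D)⟩).translate
      (x₀, (0 : ℝ))
    rwa [Set.image_image] at this
  have hdisj : Disjoint A R := by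
    rw [Set.disjoint_left]
    rintro _ ⟨h1, h2⟩ ⟨s, hs, rfl⟩
    simp only [Prod.smul_mk, Prod.mk_add_mk, smul_eq_mul, zero_add] at h1 h2
    rcases (show (0 : ℝ) ≤ s from hs).eq_or_lt with rfl | hs'
    · simp [hv0] at h2
    · have := hD s hs' h1
      linarith
  obtain ⟨f, c, hfA, hfR⟩ := geometric_hahn_banach_open hAc hAo hRc hdisj
  set α : EuclideanSpace ℝ (Fin n) →L[ℝ] ℝ := f.comp (ContinuousLinearMap.inl ℝ _ _) with hα
  set β : ℝ := f (0, 1) with hβ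
  have hf : ∀ x t, f (x, t) = α x + β * t := by
    intro x t
    have : (x, t) = (x, (0 : ℝ)) + t • ((0 : EuclideanSpace ℝ (Fin n)), (1 : ℝ)) := by simp
    rw [this, map_add, map_smul, hα, hβ, smul_eq_mul, mul_comm t]
    rfl
  have hR0 : c ≤ α x₀ := by
    have := hfR _ ⟨0, Set.mem_Ici.2 le_rfl, rfl⟩
    simpa [hf] using this
  have hle : ∀ x ∈ Ω, ∀ t, v x ≤ t → α x + β * t ≤ c := by
    intro x hx t ht
    refine le_of_tendsto (x := nhdsWithin t (Set.Ioi t)) (f := fun s => α x + β * s) ?_ ?_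
    · have : Continuous fun s : ℝ => α x + β * s := by fun_prop
      exact (this.tendsto t).mono_left nhdsWithin_le_nhds
    · filter_upwards [self_mem_nhdsWithin] with s hs
      rw [← hf]
      exact (hfA (x, s) ⟨hx, lt_of_le_of_lt ht hs⟩).le
  have hc : c = α x₀ := le_antisymm hR0 (by simpa [hv0] using hle x₀ hx₀ 0 hv0.le)
  have hβneg : β < 0 := by
    have := hfA (x₀, 1) ⟨hx₀, by simp [hv0]⟩
    rw [hf, hc] at this
    linarith
  set p := (-β)⁻¹ • (InnerProductSpace.toDual ℝ (EuclideanSpace ℝ (Fin n))).symm α with hp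
  have hpin : ∀ u, ⟪p, u⟫ = (-β)⁻¹ * α u := by
    intro u
    rw [hp, real_inner_smul_left, InnerProductSpace.toDual_symm_apply]
  refine ⟨p, ?_, fun u hu => ?_⟩
  · have := hfR _ ⟨1, Set.mem_Ici.2 zero_le_one, rfl⟩
    simp only [one_smul, Prod.mk_add_mk, zero_add, hf, map_add] at this
    rw [hpin, inv_mul_eq_div, le_div_iff₀ (by linarith)]
    linarith
  · have := hle _ hu _ le_rfl
    rw [map_add] at this
    rw [hpin, inv_mul_eq_div, div_le_iff₀ (by linarith)]
    linarith

lemma ratio_le_of_det_bounds {n : ℕ} (hn : 0 < n) {q lam Lam h G d : ℝ} (hlam : 0 < lam)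
    (hLam : 0 < Lam) (hh : 0 < h) (hG : 0 < G) (hd : 0 < d)
    (h₁ : lam * ((G / 4) ^ q * (d * (1 / (4 * n)) ^ n)) ≤ d⁻¹ * (32 * n * h) ^ n)
    (h₂ : d⁻¹ * (G / (4 * h) * (h / (4 * n)) ^ n) ≤ Lam * ((16 * G) ^ q * (d * 2 ^ n))) :
    G / (4 * h) ≤ Lam / lam * (4 ^ q * 16 ^ q * (1024 * n ^ 3) ^ n) := by
  have hn' : (0 : ℝ) < n := Nat.cast_pos.2 hn
  rw [Real.div_rpow hG.le (by norm_num)] at h₁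
  rw [Real.mul_rpow (by norm_num) hG.le] at h₂
  have h4 : (0 : ℝ) < 4 ^ q := by positivity
  have h16 : (0 : ℝ) < 16 ^ q := by positivity
  have hX : (0 : ℝ) < G ^ q := by positivity
  have h₁' : G ^ q * d ^ 2 ≤ 4 ^ q / lam * ((4 * n) ^ n * (32 * n * h) ^ n) := by
    have hk : (0 : ℝ) < d * 4 ^ q / lam * (4 * n) ^ n := by positivity
    calc G ^ q * d ^ 2
        = d * 4 ^ q / lam * (4 * n) ^ n * (lam * (G ^ q / 4 ^ q * (d * (1 / (4 * n)) ^ n))) := by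
          rw [one_div, inv_pow]; field_simp
      _ ≤ d * 4 ^ q / lam * (4 * n) ^ n * (d⁻¹ * (32 * n * h) ^ n) := by gcongr
      _ = _ := by field_simp
  calc G / (4 * h)
      = d * (4 * n / h) ^ n * (d⁻¹ * (G / (4 * h) * (h / (4 * n)) ^ n)) := by
        have : (4 * n / h) ^ n * (h / (4 * n)) ^ n = 1 := by
          rw [← mul_pow, div_mul_div_cancel₀ hh.ne', div_self (by positivity), one_pow]
        calc _ = d * d⁻¹ * (G / (4 * h)) * ((4 * n / h) ^ n * (h / (4 * n)) ^ n) := by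
              rw [this, mul_inv_cancel₀ hd.ne']; ring
          _ = _ := by ring
    _ ≤ d * (4 * n / h) ^ n * (Lam * (16 ^ q * G ^ q * (d * 2 ^ n))) := by gcongr
    _ = Lam * 16 ^ q * 2 ^ n * (4 * n / h) ^ n * (G ^ q * d ^ 2) := by ring
    _ ≤ Lam * 16 ^ q * 2 ^ n * (4 * n / h) ^ n *
          (4 ^ q / lam * ((4 * n) ^ n * (32 * n * h) ^ n)) := by gcongr
    _ = Lam / lam * (4 ^ q * 16 ^ q *
          (2 ^ n * (4 * n / h) ^ n * (4 * n) ^ n * (32 * n * h) ^ n)) := by ring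
    _ = _ := by
      rw [← mul_pow, ← mul_pow, ← mul_pow]
      congr 3
      field_simp
      norm_num

/-- If `v` has positive slope along some ray from `x₀`, there are a subgradient `p` at `x₀` and an
initial piece of the ray on which `v` exceeds `⟪p, ·⟫` by a factor at most `1 + ε`. -/
lemma exists_almost_tight_subgrad {n : ℕ} {Ω : Set (EuclideanSpace ℝ (Fin n))}
    (hΩ : IsOpen Ω) {v : EuclideanSpace ℝ (Fin n) → ℝ} (hvc : ContinuousOn v Ω)
    (hv : ConvexOn ℝ Ω v) {x₀ e : EuclideanSpace ℝ (Fin n)} (hx₀ : x₀ ∈ Ω) (hv0 : v x₀ = 0)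
    {c ε : ℝ} (hc : 0 < c) (hε : 0 < ε)
    (hray : ∀ s > 0, x₀ + s • e ∈ Ω → c * s ≤ v (x₀ + s • e)) :
    ∃ p, 0 < ⟪p, e⟫ ∧ (∀ u, x₀ + u ∈ Ω → ⟪p, u⟫ ≤ v (x₀ + u)) ∧
      ∃ s₁ > 0, ∀ s, 0 < s → s ≤ s₁ → v (x₀ + s • e) ≤ (1 + ε) * (s * ⟪p, e⟫) := by
  set A : Set ℝ := {d | ∃ s > 0, x₀ + s • e ∈ Ω ∧ d = v (x₀ + s • e) / s} with hA
  have hne : A.Nonempty := by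
    have hcont : Continuous fun s : ℝ => x₀ + s • e := by fun_prop
    have hev : ∀ᶠ s : ℝ in nhdsWithin 0 (Set.Ioi 0), x₀ + s • e ∈ Ω :=
      (hcont.continuousAt.eventually_mem (hΩ.mem_nhds (by simpa using hx₀))).filter_mono
        nhdsWithin_le_nhds
    obtain ⟨s, hs, hs0⟩ := (hev.and self_mem_nhdsWithin).exists
    exact ⟨_, s, hs0, hs, rfl⟩
  have hlb : ∀ d ∈ A, c ≤ d := by
    rintro _ ⟨s, hs, hsΩ, rfl⟩
    rw [le_div_iff₀ hs]
    exact hray s hs hsΩ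
  have hbdd : BddBelow A := ⟨c, hlb⟩
  have hDpos : 0 < sInf A := hc.trans_le (le_csInf hne hlb)
  obtain ⟨_, ⟨s₁, hs₁, hs₁Ω, rfl⟩, hlt⟩ := exists_lt_of_csInf_lt hne
    (show sInf A < (1 + ε) * sInf A by nlinarith)
  obtain ⟨p, hpD, hp⟩ := exists_subgrad_of_le_on_ray hΩ hvc hv (e := e) hx₀ hv0 (D := sInf A)
    fun s hs hsΩ => by
      rw [← le_div_iff₀ hs]
      exact csInf_le hbdd ⟨s, hs, hsΩ, rfl⟩
  refine ⟨p, hDpos.trans_le hpD, hp, s₁, hs₁, fun s hs hss => ?_⟩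
  have hs' : s / s₁ ≤ 1 := (div_le_one hs₁).2 hss
  have h1 := hv.2 hx₀ hs₁Ω (show 0 ≤ 1 - s / s₁ by linarith) (show 0 ≤ s / s₁ by positivity)
    (by ring)
  have h2 : (1 - s / s₁) • x₀ + (s / s₁) • (x₀ + s₁ • e) = x₀ + s • e := by
    rw [smul_add, smul_smul, div_mul_cancel₀ _ hs₁.ne', sub_smul, one_smul]
    abel
  rw [h2, hv0, smul_zero, zero_add, smul_eq_mul] at h1
  calc v (x₀ + s • e) ≤ s / s₁ * v (x₀ + s₁ • e) := h1
    _ = s * (v (x₀ + s₁ • e) / s₁) := by ring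
    _ ≤ s * ((1 + ε) * ⟪p, e⟫) := by
      gcongr
      exact hlt.le.trans (by gcongr)
    _ = _ := by ring

lemma eventually_mul_lt (k : ℝ) {b : ℝ} (hb : 0 < b) :
    ∀ᶠ τ : ℝ in nhdsWithin 0 (Set.Ioi 0), τ * k < b := by
  have hcont : Continuous fun τ : ℝ => τ * k := by fun_prop
  have := hcont.tendsto 0
  rw [zero_mul] at this
  exact (this.eventually_lt_const hb).filter_mono nhdsWithin_le_nhds

/-- At an exposed point `x₀` of the coincidence set, sections cut out by slight tilts of
`(1 - ε) p` in the exposing direction are compactly contained in a prescribed ball. -/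
lemma exists_tilt {n : ℕ} {V : EuclideanSpace ℝ (Fin n) → ℝ} {ℓ p : EuclideanSpace ℝ (Fin n)}
    {r ε : ℝ} (hr : 0 < r) (hε : 0 < ε) (hε1 : ε < 1)
    (hVc : ContinuousOn V (Metric.closedBall 0 r))
    (hV0 : ∀ u, ‖u‖ ≤ r → 0 ≤ V u) (hVp : ∀ u, ‖u‖ ≤ r → ⟪p, u⟫ ≤ V u)
    (hℓ : ∀ u, ‖u‖ ≤ r → V u = 0 → 0 ≤ ⟪ℓ, u⟫ → u = 0) :
    ∃ a > 0, ∀ᶠ τ : ℝ in nhdsWithin 0 (Set.Ioi 0), ∀ u, ‖u‖ ≤ r →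
      V u ≤ (1 - ε) * ⟪p, u⟫ + τ * (⟪ℓ, u⟫ + a) → ‖u‖ < r ∧ |⟪ℓ, u⟫| ≤ a := by
  have hVε : ∀ u, ‖u‖ ≤ r → (1 - ε) * ⟪p, u⟫ ≤ V u := by
    intro u hu
    have h1 := hV0 u hu
    have h2 := hVp u hu
    nlinarith
  obtain ⟨a, ha, hZ0⟩ : ∃ a > 0, ∀ u, ‖u‖ = r → V u = 0 → ⟪ℓ, u⟫ < -a := by
    set Z : Set (EuclideanSpace ℝ (Fin n)) := Metric.closedBall 0 r ∩ V ⁻¹' {0} ∩ {u | ‖u‖ = r}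
    have hZ : IsCompact Z := by
      refine IsCompact.inter_right ?_ (isClosed_eq continuous_norm continuous_const)
      exact (isCompact_closedBall _ _).of_isClosed_subset
        (hVc.preimage_isClosed_of_isClosed Metric.isClosed_closedBall isClosed_singleton)
        Set.inter_subset_left
    have hmem : ∀ u, ‖u‖ = r → V u = 0 → u ∈ Z := fun u h1 h2 =>
      ⟨⟨by simp [h1], h2⟩, h1⟩
    rcases Z.eq_empty_or_nonempty with hemp | hne
    · exact ⟨1, one_pos, fun u h1 h2 => by simpa [hemp] using hmem u h1 h2⟩
    · obtain ⟨u₀, hu₀, hmax⟩ := hZ.exists_isMaxOn hne (f := fun u => ⟪ℓ, u⟫)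
        (Continuous.continuousOn (by fun_prop))
      have hneg : ⟪ℓ, u₀⟫ < 0 := by
        by_contra! hcon
        have h1 := hℓ u₀ (le_of_eq hu₀.2) hu₀.1.2 hcon
        have h2 : ‖u₀‖ = r := hu₀.2
        rw [h1, norm_zero] at h2
        exact hr.ne h2
      refine ⟨-⟪ℓ, u₀⟫ / 2, by linarith, fun u h1 h2 => ?_⟩
      have := isMaxOn_iff.1 hmax u (hmem u h1 h2)
      linarith
  refine ⟨a, ha, ?_⟩
  set Z : Set (EuclideanSpace ℝ (Fin n)) :=
    Metric.closedBall 0 r ∩ {u | (‖u‖ = r ∨ a ≤ ⟪ℓ, u⟫) ∧ -a ≤ ⟪ℓ, u⟫}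
  have hZ : IsCompact Z := by
    have hℓc : Continuous fun u : EuclideanSpace ℝ (Fin n) => ⟪ℓ, u⟫ := by fun_prop
    refine (isCompact_closedBall _ _).inter_right ?_
    refine IsClosed.inter (IsClosed.union ?_ ?_) ?_
    · exact isClosed_eq continuous_norm continuous_const
    · exact isClosed_le continuous_const hℓc
    · exact isClosed_le continuous_const hℓc
  obtain ⟨δ, hδ, hZδ⟩ : ∃ δ > 0, ∀ u ∈ Z, δ ≤ V u - (1 - ε) * ⟪p, u⟫ := by
    rcases Z.eq_empty_or_nonempty with hemp | hne
    · exact ⟨1, one_pos, fun u hu => by simp [hemp] at hu⟩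
    · have hcont : ContinuousOn (fun u => V u - (1 - ε) * ⟪p, u⟫) Z :=
        (hVc.mono Set.inter_subset_left).sub (Continuous.continuousOn (by fun_prop))
      obtain ⟨u₀, ⟨hu₀, hu₁, hu₂⟩, hmin⟩ := hZ.exists_isMinOn hne hcont
      have hu₀r : ‖u₀‖ ≤ r := by simpa using hu₀
      refine ⟨_, ?_, isMinOn_iff.1 hmin⟩
      by_contra! hcon
      have h1 := hV0 u₀ hu₀r
      have h2 := hVp u₀ hu₀r
      have h3 : V u₀ = 0 := by nlinarith
      rcases hu₁ with h4 | h4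
      · linarith [hZ0 u₀ h4 h3]
      · have := hℓ u₀ hu₀r h3 (by linarith)
        rw [this, inner_zero_right] at h4
        linarith
  filter_upwards [eventually_mul_lt (‖ℓ‖ * r + a) hδ, self_mem_nhdsWithin] with τ hτ hτ0 u hu hVu
  have hτpos : 0 < τ := hτ0
  have hlow : -a ≤ ⟪ℓ, u⟫ := by
    have := hVε u hu
    have h1 : 0 ≤ τ * (⟪ℓ, u⟫ + a) := by linarith
    have h2 := nonneg_of_mul_nonneg_right h1 hτpos
    linarith
  have hnot : u ∉ Z := by
    intro huZ
    have h1 := hZδ u huZ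
    have h2 : ⟪ℓ, u⟫ ≤ ‖ℓ‖ * r :=
      (real_inner_le_norm _ _).trans (mul_le_mul_of_nonneg_left hu (norm_nonneg _))
    have h3 : τ * (⟪ℓ, u⟫ + a) ≤ τ * (‖ℓ‖ * r + a) := by gcongr
    linarith
  have hball : u ∈ Metric.closedBall (0 : EuclideanSpace ℝ (Fin n)) r := by simpa using hu
  constructor
  · exact lt_of_le_of_ne hu fun h => hnot ⟨hball, Or.inl h, hlow⟩
  · refine abs_le.2 ⟨hlow, ?_⟩
    by_contra! hcon
    exact hnot ⟨hball, Or.inr hcon.le, hlow⟩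

/-- **Differentiability at exposed points of the coincidence set** (Lemma 3.4): a generalized
solution `v` is differentiable at every exposed point of `K`, with vanishing gradient. -/
theorem differentiable_at_exposed_points
    (n : ℕ) (hn : 2 ≤ n) (q lam Lam : ℝ)
    (hq0 : 0 ≤ q) (hqn : q < n) (hlam : 0 < lam) (hlL : lam ≤ Lam)
    (Ω : Set (EuclideanSpace ℝ (Fin n))) (hΩo : IsOpen Ω) (hΩc : Convex ℝ Ω)
    (v : EuclideanSpace ℝ (Fin n) → ℝ) (hv : GenSol n q lam Lam Ω v) :
    ∀ x₀ ∈ Ω, x₀ ∈ Set.exposedPoints ℝ (coin Ω v) →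
      DifferentiableAt ℝ v x₀ ∧ fderiv ℝ v x₀ = 0 := by
  rintro x₀ hx₀ ⟨⟨-, hv0⟩, l, hl⟩
  obtain ⟨hvc, hconv, hnn, hup, hlo⟩ := hv
  have hn0 : 0 < n := by omega
  have hLam : 0 < Lam := hlam.trans_le hlL
  suffices H : HasFDerivAt v (0 : EuclideanSpace ℝ (Fin n) →L[ℝ] ℝ) x₀ from
    ⟨H.differentiableAt, H.fderiv⟩
  refine hasFDerivAt_zero_of_small_slopes hΩo hconv hnn hx₀ hv0 ?_
  by_contra! hcon
  obtain ⟨e, c, hc, hray⟩ := hcon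
  set K : ℝ := Lam / lam * (4 ^ q * 16 ^ q * (1024 * n ^ 3) ^ n) with hK
  have hKpos : 0 < K := by positivity
  obtain ⟨ε, hε, hε64, hεK⟩ : ∃ ε > 0, ε ≤ 1 / 64 ∧ K < 1 / (16 * ε) := by
    refine ⟨min (1 / 64) (1 / (32 * K)), by positivity, min_le_left _ _, ?_⟩
    rw [lt_one_div hKpos (by positivity)]
    have h1 : min (1 / 64) (1 / (32 * K)) ≤ 1 / (32 * K) := min_le_right _ _
    have h2 : 16 * (1 / (32 * K)) = 1 / K / 2 := by field_simp; norm_num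
    have h3 : 0 < 1 / K := by positivity
    linarith
  obtain ⟨p, hpe, hp, s₁, hs₁, htight⟩ := exists_almost_tight_subgrad hΩo hvc hconv hx₀ hv0 hc hε
    fun s hs hsΩ => (hray s hs hsΩ).le
  set ℓ : EuclideanSpace ℝ (Fin n) :=
    (InnerProductSpace.toDual ℝ (EuclideanSpace ℝ (Fin n))).symm l with hℓ
  have hℓl : ∀ u, ⟪ℓ, u⟫ = l u := fun u => InnerProductSpace.toDual_symm_apply
  obtain ⟨r, hr, hball⟩ := Metric.nhds_basis_closedBall.mem_iff.1 (hΩo.mem_nhds hx₀)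
  have hrΩ : ∀ u : EuclideanSpace ℝ (Fin n), ‖u‖ ≤ r → x₀ + u ∈ Ω := fun u hu =>
    hball (by simpa using hu)
  have hVc : ContinuousOn (fun u => v (x₀ + u)) (Metric.closedBall 0 r) :=
    hvc.comp (Continuous.continuousOn (by fun_prop)) fun u hu => hrΩ u (by simpa using hu)
  obtain ⟨a, ha, hev⟩ := exists_tilt (V := fun u => v (x₀ + u)) (ℓ := ℓ) (p := p) hr hε
    (by linarith) hVc (fun u hu => hnn _ (hrΩ u hu)) (fun u hu => hp u (hrΩ u hu)) (by
      intro u hu hu0 hu1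
      have h1 := (hl (x₀ + u) ⟨hrΩ u hu, hu0⟩).2
      rw [map_add, ← hℓl u] at h1
      simpa using h1 (by linarith))
  set k : ℝ := a / (4 * ε * ⟪p, e⟫) with hk
  have hkpos : 0 < k := by positivity
  obtain ⟨τ, htilt, hτ₁, hτ₂, hτ₃, hτ0⟩ := (hev.and ((eventually_mul_lt k hs₁).and
    ((eventually_mul_lt (k * ‖e‖) hr).and ((eventually_mul_lt (k * (‖ℓ‖ * ‖e‖)) (half_pos ha)).and
      self_mem_nhdsWithin)))).exists
  have hτ : 0 < τ := hτ0
  set h : ℝ := τ * a with hh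
  have hhpos : 0 < h := by positivity
  set G : ℝ := h / (4 * ε) with hG
  have hGpos : 0 < G := by positivity
  have hεG : ε * G = h / 4 := by rw [hG]; field_simp
  set P : EuclideanSpace ℝ (Fin n) := (1 - ε) • p + τ • ℓ with hP
  have hPu : ∀ u, ⟪P, u⟫ = (1 - ε) * ⟪p, u⟫ + τ * ⟪ℓ, u⟫ := fun u => by
    rw [hP, inner_add_left, real_inner_smul_left, real_inner_smul_left]
  set C : Set (EuclideanSpace ℝ (Fin n)) :=
    {u ∈ Metric.closedBall 0 r | v (x₀ + u) - ⟪P, u⟫ ≤ h} with hC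
  have hCle : ∀ u ∈ C, v (x₀ + u) ≤ ⟪P, u⟫ + h := fun u hu => by linarith [hu.2]
  have hCr : ∀ u ∈ C, ‖u‖ ≤ r := fun u hu => by simpa using hu.1
  have hCΩ : ∀ u ∈ C, x₀ + u ∈ Ω := fun u hu => hrΩ u (hCr u hu)
  have hCt : ∀ u ∈ C, ‖u‖ < r ∧ |⟪ℓ, u⟫| ≤ a := fun u hu =>
    htilt u (hCr u hu) (by have := hCle u hu; rw [hPu] at this; linarith)
  have hCτ : ∀ u ∈ C, |τ * ⟪ℓ, u⟫| ≤ h := fun u hu => by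
    rw [abs_mul, abs_of_pos hτ]
    exact mul_le_mul_of_nonneg_left (hCt u hu).2 hτ.le
  have hCp : ∀ u ∈ C, v (x₀ + u) ≤ (1 - ε) * ⟪p, u⟫ + 2 * h := fun u hu => by
    have h1 := hCle u hu
    have h2 := (abs_le.1 (hCτ u hu)).2
    rw [hPu] at h1
    linarith
  have hCconv : Convex ℝ C := by
    have h1 : ConvexOn ℝ (Metric.closedBall (0 : EuclideanSpace ℝ (Fin n)) r)
        (fun u => v (x₀ + u)) :=
      (hconv.translate_right x₀).subset (fun u hu => hrΩ u (by simpa using hu))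
        (convex_closedBall _ _)
    exact (h1.sub ((innerₛₗ ℝ P).concaveOn (convex_closedBall _ _))).convex_le h
  have hCcomp : IsCompact C :=
    (isCompact_closedBall _ _).of_isClosed_subset
      ((hVc.sub (Continuous.continuousOn (by fun_prop))).preimage_isClosed_of_isClosed
        Metric.isClosed_closedBall isClosed_Iic) Set.inter_subset_left
  have h0C : (0 : EuclideanSpace ℝ (Fin n)) ∈ C := by
    refine ⟨by simp [hr.le], ?_⟩
    simpa [hv0] using hhpos.le
  have hCnhds : ∀ u ∈ C, v (x₀ + u) < ⟪P, u⟫ + h → C ∈ nhds u := by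
    intro u hu hlt
    have hub : Metric.closedBall (0 : EuclideanSpace ℝ (Fin n)) r ∈ nhds u :=
      Metric.closedBall_mem_nhds_of_mem (by simpa using (hCt u hu).1)
    have hcont : ContinuousAt (fun u => v (x₀ + u) - ⟪P, u⟫) u :=
      (hVc.continuousAt hub).sub (Continuous.continuousAt (by fun_prop))
    filter_upwards [hub, hcont.eventually_lt_const (show v (x₀ + u) - ⟪P, u⟫ < h by linarith)]
      with y hy hy'
    exact ⟨hy, hy'.le⟩
  obtain ⟨b, hb, hdet, hrep⟩ := exists_maximal_simplex hCcomp
    (hCnhds 0 h0C (by simpa [hv0] using hhpos))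
  have hge : ∀ u ∈ C, ⟪P, u⟫ - h ≤ v (x₀ + u) := by
    intro u hu
    have h1 := hnn _ (hCΩ u hu)
    have h2 := hp u (hCΩ u hu)
    have h3 := (abs_le.1 (hCτ u hu)).2
    rw [hPu]
    nlinarith
  have hp4 : ∀ u ∈ C, -(4 * h) ≤ ⟪p, u⟫ := by
    intro u hu
    have h1 := hnn _ (hCΩ u hu)
    have h2 := hCp u hu
    by_contra! hcon
    nlinarith
  have hvG : ∀ u ∈ C, v (x₀ + u) ≤ 16 * G := by
    intro u hu
    have h1 := hp u (hCΩ u hu)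
    have h2 := hCp u hu
    refine le_of_mul_le_mul_left ?_ hε
    nlinarith
  have hz : (τ * k) • e ∈ C := by
    have hτk : 0 < τ * k := by positivity
    have hpz : τ * k * ⟪p, e⟫ = G := by rw [hk, hG, hh]; field_simp
    have h1 := htight (τ * k) hτk hτ₁.le
    have h2 : |⟪ℓ, (τ * k) • e⟫| ≤ a / 2 := by
      refine (abs_real_inner_le_norm _ _).trans ?_
      rw [norm_smul, Real.norm_of_nonneg hτk.le]
      linarith
    have h3 : -(h / 2) ≤ τ * ⟪ℓ, (τ * k) • e⟫ := by
      have := mul_le_mul_of_nonneg_left (abs_le.1 h2).1 hτ.le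
      linarith
    refine ⟨?_, ?_⟩
    · rw [mem_closedBall_zero_iff, norm_smul, Real.norm_of_nonneg hτk.le]
      linarith
    · rw [hPu, real_inner_smul_right p, hpz]
      rw [hpz] at h1
      linarith
  have hpz : ⟪p, (τ * k) • e⟫ = G := by
    rw [real_inner_smul_right, hk, hG, hh]; field_simp
  have hG8 : 8 * h ≤ G := by
    rw [hG, le_div_iff₀ (by positivity)]
    nlinarith
  have hA := det_le_of_lower_bound hn0 hq0 hlo hlam hhpos hG8 hCΩ hCconv h0C hCle hge
    (fun u hu => hp u (hCΩ u hu)) hp4 hz hpz hb hdet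
  have hB := le_det_of_upper_bound hn0 hq0 hLam hvc hconv hup hhpos hGpos hv0 hCΩ hCcomp h0C
    hCnhds hvG hp4 hz hpz hdet hrep
  have hfin := ratio_le_of_det_bounds hn0 hlam hLam hhpos hGpos (abs_pos.2 hdet) hA hB
  have hratio : G / (4 * h) = 1 / (16 * ε) := by rw [hG]; field_simp; norm_num
  rw [hratio] at hfin
  linarith
end
end
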